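/- Let N ≥ 2 be an even integer, k = N/2, and let f : [0,1) → [0,∞) be continuous with f(0) = 0 and f(r) > 0 for r ∈ (0,1). Assume there exists σ > 2 such that limsup_{r→0⁺} f(r)·|ln r|^σ < ∞. Then the supremum MT_N(f) = sup { ∫_B exp(μ_N |u(x)|^{(N+2)/N + f(|x|)}) dx : u ∈ Φ^k_{0,rad}(B), ‖u‖_{Φ^k_0} = 1 } is attained: there exists u ∈ Φ^k_{0,rad}(B) with ‖u‖_{Φ^k_0} = 1 such that ∫_B exp(μ_N |u(x)|^{(N+2)/N + f(|x|)}) dx = MT_N(f). -/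

import Mathlib

open MeasureTheory Real Set Filter
open scoped ENNReal

/-- Surface area of the unit sphere in `ℝ^N` (equals `N` times the volume of the unit ball). -/
noncomputable def omegaS (N : ℕ) : ℝ :=
  N * (volume (Metric.ball (0 : EuclideanSpace ℝ (Fin N)) 1)).toReal

/-- The normalising constant `c_N = ω_{N-1} · binom(N,k) / N`. -/
noncomputable def cN (N k : ℕ) : ℝ := omegaS N * (N.choose k) / N

/-- The critical constant `μ_N = N · (ω_{N-1} · binom(N-1,k-1) / k)^{2/N}`. -/
noncomputable def muN (N k : ℕ) : ℝ :=
  N * (omegaS N * ((N - 1).choose (k - 1)) / k) ^ ((2 : ℝ) / N)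

/-- Radial profile of a radially symmetric `k`-admissible function on the unit ball:
`w ∈ C²([0,1])`, `w(1) = 0`, and for each `1 ≤ j ≤ k` the function
`r ↦ r^{N-j} (w'(r))^j` is non-decreasing on `(0,1)`. -/
structure KAdmRad (N k : ℕ) (w : ℝ → ℝ) : Prop where
  smooth : ContDiffOn ℝ 2 w (Icc 0 1)
  bdry : w 1 = 0
  hess : ∀ j : ℕ, 1 ≤ j → j ≤ k →
    MonotoneOn (fun r => r ^ (N - j) * (deriv w r) ^ j) (Ioo (0:ℝ) 1)

/-- The norm `‖u‖_{Φᵏ₀} = (c_N ∫₀¹ r^{N-k} |w'|^{k+1} dr)^{1/(k+1)}` of the radial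
function `u(x) = w(|x|)`. -/
noncomputable def normPhi (N k : ℕ) (w : ℝ → ℝ) : ℝ :=
  (cN N k * ∫ r in Ioo (0:ℝ) 1, r ^ (N - k) * |deriv w r| ^ (k + 1)) ^ (1 / (k + 1 : ℝ))

/-- The supercritical Trudinger–Moser functional on the unit ball of `ℝ^N` for the
radial function `u(x) = w(|x|)`. -/
noncomputable def ballIntegral (N k : ℕ) (f w : ℝ → ℝ) : ℝ≥0∞ :=
  ∫⁻ x in Metric.ball (0 : EuclideanSpace ℝ (Fin N)) 1,
    ENNReal.ofReal (exp (muN N k * |w ‖x‖| ^ (((N : ℝ) + 2) / N + f ‖x‖)))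

/-- The conjugate exponent of `k + 1`. -/
noncomputable def conjExp (k : ℕ) : ℝ := 1 + 1 / (k : ℝ)

/-- Radial profiles in logarithmic coordinates: `v` is the derivative of the profile, with
energy `∫ v ^ (k + 1) ≤ 1`. -/
structure Profile (k : ℕ) (v : ℝ → ℝ) : Prop where
  meas : Measurable v
  nonneg : ∀ s, 0 ≤ v s
  integrable : IntegrableOn (fun s => v s ^ (k + 1)) (Ioi 0)
  energy_le : ∫ s in Ioi (0 : ℝ), v s ^ (k + 1) ≤ 1

/-- The primitive of `v` vanishing at `0`. -/
noncomputable def prim (v : ℝ → ℝ) (s : ℝ) : ℝ := ∫ x in (0 : ℝ)..s, v x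

lemma pow_tangent (k : ℕ) {m x : ℝ} (hm : 0 ≤ m) (hx : 0 ≤ x) :
    m ^ (k + 1) + (k + 1) * m ^ k * (x - m) ≤ x ^ (k + 1) := by
  rcases hm.eq_or_lt with rfl | hm
  · rcases Nat.eq_zero_or_pos k with rfl | hk
    · simp
    · simp [hk.ne']; positivity
  · have h := one_add_mul_le_pow (a := x / m - 1) (by have := div_nonneg hx hm.le; linarith) (k + 1)
    have h2 : (1 + (x / m - 1)) ^ (k + 1) * m ^ (k + 1) = x ^ (k + 1) := by
      rw [← mul_pow]; congr 1; field_simp; ring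
    have h3 := mul_le_mul_of_nonneg_right h (pow_nonneg hm.le (k + 1))
    rw [h2] at h3
    refine le_trans (le_of_eq ?_) h3
    push_cast
    field_simp
    ring

namespace Profile

variable {k : ℕ} {v : ℝ → ℝ}

lemma integrableOn (hv : Profile k v) {a b : ℝ} (ha : 0 ≤ a) : IntegrableOn v (Ioc a b) := by
  have h1 : IntegrableOn (fun s => v s ^ (k + 1)) (Ioc a b) :=
    hv.integrable.mono_set (fun x hx => lt_of_le_of_lt ha hx.1)
  have h2 : IntegrableOn (fun s => 1 + v s ^ (k + 1)) (Ioc a b) :=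
    (integrableOn_const (by simp)).add h1
  refine h2.mono' hv.meas.aestronglyMeasurable (Eventually.of_forall fun s => ?_)
  rw [norm_of_nonneg (hv.nonneg s)]
  rcases le_total (v s) 1 with h | h
  · have := pow_nonneg (hv.nonneg s) (k + 1); linarith
  · have := le_self_pow₀ h (Nat.succ_ne_zero k); simp only [Nat.succ_eq_add_one] at this; linarith

lemma intervalIntegrable (hv : Profile k v) {a b : ℝ} (ha : 0 ≤ a) (hab : a ≤ b) :
    IntervalIntegrable v volume a b :=
  (intervalIntegrable_iff_integrableOn_Ioc_of_le hab).2 (hv.integrableOn ha)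

lemma prim_sub (hv : Profile k v) {a b : ℝ} (ha : 0 ≤ a) (hab : a ≤ b) :
    prim v b - prim v a = ∫ x in a..b, v x :=
  intervalIntegral.integral_interval_sub_left
    (hv.intervalIntegrable le_rfl (ha.trans hab)) (hv.intervalIntegrable le_rfl ha)

lemma prim_mono (hv : Profile k v) {a b : ℝ} (ha : 0 ≤ a) (hab : a ≤ b) :
    prim v a ≤ prim v b := by
  have := hv.prim_sub ha hab
  have h2 : 0 ≤ ∫ x in a..b, v x := intervalIntegral.integral_nonneg hab fun x _ => hv.nonneg x
  linarith

lemma prim_zero : prim v 0 = 0 := by simp [prim]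

lemma prim_nonneg (hv : Profile k v) {a : ℝ} (ha : 0 ≤ a) : 0 ≤ prim v a := by
  simpa [prim_zero] using hv.prim_mono le_rfl ha

/-- Hölder's inequality for increments of a profile. -/
lemma increment_pow_le (hv : Profile k v) {a b : ℝ} (ha : 0 ≤ a) (hab : a ≤ b) :
    (prim v b - prim v a) ^ (k + 1) ≤ (∫ x in a..b, v x ^ (k + 1)) * (b - a) ^ k := by
  rcases hab.eq_or_lt with rfl | hab'
  · simp
  have hl : 0 < b - a := sub_pos.2 hab'
  rw [hv.prim_sub ha hab]
  set I := ∫ x in a..b, v x with hI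
  have hI0 : 0 ≤ I := intervalIntegral.integral_nonneg hab fun x _ => hv.nonneg x
  set m := I / (b - a) with hm
  have hm0 : 0 ≤ m := div_nonneg hI0 hl.le
  have hvi := hv.intervalIntegrable ha hab
  have hpi : IntervalIntegrable (fun x => v x ^ (k + 1)) volume a b :=
    (intervalIntegrable_iff_integrableOn_Ioc_of_le hab).2
      (hv.integrable.mono_set (fun x hx => lt_of_le_of_lt ha hx.1))
  have h1 : ∫ x in a..b, (m ^ (k + 1) + (k + 1) * m ^ k * (v x - m)) ≤
      ∫ x in a..b, v x ^ (k + 1) := by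
    apply intervalIntegral.integral_mono_on hab _ hpi
    · intro x _; exact pow_tangent k hm0 (hv.nonneg x)
    · exact intervalIntegrable_const.add ((hvi.sub intervalIntegrable_const).const_mul _)
  rw [intervalIntegral.integral_add intervalIntegrable_const
    ((hvi.sub intervalIntegrable_const).const_mul _), intervalIntegral.integral_const_mul,
    intervalIntegral.integral_sub hvi intervalIntegrable_const] at h1
  simp only [intervalIntegral.integral_const, smul_eq_mul, ← hI] at h1
  have h2 : I - (b - a) * m = 0 := by rw [hm]; field_simp; ring
  rw [h2] at h1
  calc I ^ (k + 1) = ((b - a) * m ^ (k + 1)) * (b - a) ^ k := by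
        rw [hm, div_pow]; field_simp; ring
    _ ≤ _ := mul_le_mul_of_nonneg_right (by linarith) (by positivity)

lemma energy_split (hv : Profile k v) {a : ℝ} (ha : 0 ≤ a) :
    (∫ x in (0 : ℝ)..a, v x ^ (k + 1)) + ∫ x in Ioi a, v x ^ (k + 1) ≤ 1 := by
  refine le_trans (le_of_eq ?_) hv.energy_le
  exact intervalIntegral.integral_interval_add_Ioi hv.integrable
    (hv.integrable.mono_set (Ioi_subset_Ioi ha))

lemma energy_interval_le_tail (hv : Profile k v) {a b : ℝ} (ha : 0 ≤ a) (hab : a ≤ b) :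
    ∫ x in a..b, v x ^ (k + 1) ≤ ∫ x in Ioi a, v x ^ (k + 1) := by
  rw [intervalIntegral.integral_of_le hab]
  exact setIntegral_mono_set (hv.integrable.mono_set (Ioi_subset_Ioi ha))
    (Eventually.of_forall fun x => pow_nonneg (hv.nonneg x) _)
    (Eventually.of_forall fun x hx => hx.1)

lemma energy_interval_le_one (hv : Profile k v) {a b : ℝ} (ha : 0 ≤ a) (hab : a ≤ b) :
    ∫ x in a..b, v x ^ (k + 1) ≤ 1 := by
  refine (hv.energy_interval_le_tail ha hab).trans ?_
  have := hv.energy_split ha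
  have h2 : 0 ≤ ∫ x in (0 : ℝ)..a, v x ^ (k + 1) :=
    intervalIntegral.integral_nonneg ha fun x _ => pow_nonneg (hv.nonneg x) _
  linarith

lemma increment_pow_le' (hv : Profile k v) {a b : ℝ} (ha : 0 ≤ a) (hab : a ≤ b) :
    (prim v b - prim v a) ^ (k + 1) ≤ (b - a) ^ k := by
  refine (hv.increment_pow_le ha hab).trans ?_
  have := mul_le_mul_of_nonneg_right (hv.energy_interval_le_one ha hab)
    (pow_nonneg (sub_nonneg.2 hab) k)
  simpa using this

end Profile

lemma conjExp_pos (k : ℕ) : 0 < conjExp k := by unfold conjExp; positivity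

lemma one_le_conjExp (k : ℕ) : 1 ≤ conjExp k := by
  unfold conjExp; have : (0 : ℝ) ≤ 1 / k := by positivity
  linarith

/-- `x ^ (k + 1) ≤ c * t ^ k` in terms of the conjugate exponent. -/
lemma rpow_conjExp_le {k : ℕ} (hk : 0 < k) {x c t : ℝ} (hx : 0 ≤ x) (hc : 0 ≤ c) (ht : 0 ≤ t)
    (h : x ^ (k + 1) ≤ c * t ^ k) : x ^ conjExp k ≤ c ^ (1 / (k : ℝ)) * t := by
  have hk' : (k : ℝ) ≠ 0 := by positivity
  have h1 : x ^ conjExp k = (x ^ (k + 1)) ^ (1 / (k : ℝ)) := by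
    rw [← rpow_natCast, ← rpow_mul hx]; congr 1; unfold conjExp; push_cast; field_simp
  have h2 : (c * t ^ k) ^ (1 / (k : ℝ)) = c ^ (1 / (k : ℝ)) * t := by
    rw [mul_rpow hc (by positivity), ← rpow_natCast t k, ← rpow_mul ht, mul_one_div_cancel hk',
      rpow_one]
  rw [h1, ← h2]
  exact rpow_le_rpow (by positivity) h (by positivity)

lemma Profile.prim_rpow_le {k : ℕ} (hk : 0 < k) {v : ℝ → ℝ} (hv : Profile k v) {s : ℝ}
    (hs : 0 ≤ s) : prim v s ^ conjExp k ≤ s := by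
  have h := hv.increment_pow_le' le_rfl hs
  rw [Profile.prim_zero, sub_zero, sub_zero] at h
  simpa using rpow_conjExp_le hk (hv.prim_nonneg hs) zero_le_one hs (by simpa using h)

/-- The truncated logarithm series `∑_{j=1}^k θ^j / j`. -/
noncomputable def logPartial (k : ℕ) (θ : ℝ) : ℝ := ∑ j ∈ Finset.range k, θ ^ (j + 1) / (j + 1)

/-- The harmonic number `1 + 1/2 + ⋯ + 1/k`. -/
noncomputable def harm (k : ℕ) : ℝ := ∑ j ∈ Finset.range k, 1 / ((j : ℝ) + 1)

/-- The optimal energy constant `k ^ k / (k + 1) ^ (k + 1)`. -/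
noncomputable def energyConst (k : ℕ) : ℝ := (k : ℝ) ^ k / ((k : ℝ) + 1) ^ (k + 1)

/-- The value function `log X - ∑_{j=1}^k (1 - 1/X)^j / j` of the linearised peak problem. -/
noncomputable def peakValue (k : ℕ) (X : ℝ) : ℝ := log X - logPartial k (1 - 1 / X)

lemma energyConst_pos {k : ℕ} (hk : 0 < k) : 0 < energyConst k := by
  unfold energyConst; have : (0 : ℝ) < k := by exact_mod_cast hk
  positivity

lemma logPartial_nonneg (k : ℕ) {θ : ℝ} (h : 0 ≤ θ) : 0 ≤ logPartial k θ :=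
  Finset.sum_nonneg fun j _ => by positivity

lemma logPartial_le_harm (k : ℕ) {θ : ℝ} (h0 : 0 ≤ θ) (h1 : θ ≤ 1) : logPartial k θ ≤ harm k :=
  Finset.sum_le_sum fun j _ => by
    have := pow_le_one₀ h0 h1 (n := j + 1)
    gcongr

lemma hasDerivAt_logPartial (k : ℕ) (θ : ℝ) :
    HasDerivAt (logPartial k) (∑ j ∈ Finset.range k, θ ^ j) θ := by
  unfold logPartial
  apply HasDerivAt.fun_sum
  intro j _
  have h := (hasDerivAt_pow (j + 1) θ).div_const ((j : ℝ) + 1)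
  refine h.congr_deriv ?_
  have : (j : ℝ) + 1 ≠ 0 := by positivity
  rw [Nat.add_sub_cancel]
  push_cast
  field_simp

lemma hasDerivAt_peakValue (k : ℕ) {X : ℝ} (hX : 0 < X) :
    HasDerivAt (peakValue k) ((1 - 1 / X) ^ k / X) X := by
  have h1 : HasDerivAt (fun X : ℝ => 1 - 1 / X) (1 / X ^ 2) X := by
    have := (hasDerivAt_inv hX.ne').const_sub 1
    simpa [one_div, neg_div] using this
  have h2 := (hasDerivAt_log hX.ne').sub ((hasDerivAt_logPartial k (1 - 1 / X)).comp X h1)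
  refine h2.congr_deriv ?_
  have h3 := geom_sum_mul (1 - 1 / X) k
  have h4 : (∑ j ∈ Finset.range k, (1 - 1 / X) ^ j) = X * (1 - (1 - 1 / X) ^ k) := by
    have : (1 - 1 / X - 1) = -(1 / X) := by ring
    rw [this] at h3
    field_simp at h3 ⊢
    linarith
  rw [h4]
  field_simp
  ring

lemma young_energyConst {k : ℕ} (hk : 0 < k) {ρ θ v : ℝ} (hρ : 0 < ρ) (hθ : 0 ≤ θ) (hv : 0 ≤ v) :
    θ ^ k * v - ρ * θ ^ (k + 1) ≤ energyConst k / ρ ^ k * v ^ (k + 1) := by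
  have hk' : (0 : ℝ) < k := by exact_mod_cast hk
  have h := pow_tangent k (m := ρ * θ * (k + 1) / k) (x := v) (by positivity) hv
  have h2 := mul_le_mul_of_nonneg_left h
    (show 0 ≤ energyConst k / ρ ^ k from div_nonneg (energyConst_pos hk).le (by positivity))
  refine le_trans (le_of_eq ?_) h2
  unfold energyConst
  rw [div_pow, div_pow, mul_pow, mul_pow, mul_pow, mul_pow, pow_succ (k : ℝ) k,
    pow_succ ((k : ℝ) + 1) k, pow_succ θ k, pow_succ ρ k]
  field_simp
  ring

/-- Sharp linearised peak estimate. -/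
lemma integral_exp_prim_le {k : ℕ} (hk : 0 < k) {v : ℝ → ℝ} (hc : Continuous v)
    (hn : ∀ s, 0 ≤ v s) (hi : IntegrableOn v (Ioi 0))
    (hp : IntegrableOn (fun s => v s ^ (k + 1)) (Ioi 0)) {ρ : ℝ} (hρ : 0 < ρ) :
    IntegrableOn (fun s => exp (prim v s - ρ * s)) (Ioi 0) ∧
    ∫ s in Ioi (0 : ℝ), exp (prim v s - ρ * s) ≤
      1 / ρ * exp (energyConst k / ρ ^ k * (∫ s in Ioi (0 : ℝ), v s ^ (k + 1)) + harm k) := by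
  set z := prim v with hz
  have hzd : ∀ s, HasDerivAt z (v s) s := fun s =>
    intervalIntegral.integral_hasDerivAt_right (hc.intervalIntegrable _ _)
      (hc.stronglyMeasurableAtFilter _ _) hc.continuousAt
  have hzc : Continuous z := continuous_iff_continuousAt.2 fun s => (hzd s).continuousAt
  have hzm : Monotone z := monotone_of_hasDerivAt_nonneg hzd hn
  set Z := ∫ s in Ioi (0 : ℝ), v s
  have hzlim : Tendsto z atTop (nhds Z) := intervalIntegral_tendsto_integral_Ioi 0 hi tendsto_id
  have hzZ : ∀ s, z s ≤ Z := fun s => hzm.ge_of_tendsto hzlim s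
  set g : ℝ → ℝ := fun s => exp (z s - ρ * s) with hg
  have hgc : Continuous g := by fun_prop
  have hexp : ∀ a, IntegrableOn (fun s => exp (Z) * exp (-ρ * s)) (Ioi a) := fun a =>
    (integrableOn_exp_mul_Ioi (by linarith) a).const_mul _
  have hgi : ∀ a, IntegrableOn g (Ioi a) := fun a => by
    refine (hexp a).mono' hgc.aestronglyMeasurable (Eventually.of_forall fun s => ?_)
    rw [norm_of_nonneg (exp_pos _).le, ← exp_add]
    exact exp_le_exp.2 (by have := hzZ s; linarith)
  refine ⟨hgi 0, ?_⟩
  set A : ℝ → ℝ := fun s => ∫ τ in Ioi s, g τ with hA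
  have hAd : ∀ s, HasDerivAt A (-g s) s := by
    intro s
    have h1 : A = fun s => (∫ τ in Ioi 0, g τ) - ∫ τ in (0 : ℝ)..s, g τ := by
      funext s
      have := intervalIntegral.integral_interval_add_Ioi (hgi 0) (hgi s)
      simp only [hA]; linarith
    rw [h1]
    exact (intervalIntegral.integral_hasDerivAt_right (hgc.intervalIntegrable _ _)
      (hgc.stronglyMeasurableAtFilter _ _) hgc.continuousAt).const_sub _
  set X : ℝ → ℝ := fun s => ρ * exp (ρ * s - z s) * A s with hX
  have hXd : ∀ s, HasDerivAt X ((ρ - v s) * X s - ρ) s := by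
    intro s
    have h1 : HasDerivAt (fun s => ρ * exp (ρ * s - z s))
        (ρ * (exp (ρ * s - z s) * (ρ * 1 - v s))) s :=
      ((((hasDerivAt_id s).const_mul ρ).sub (hzd s)).exp).const_mul ρ
    refine (h1.mul (hAd s)).congr_deriv ?_
    have h2 : exp (ρ * s - z s) * g s = 1 := by
      simp only [hg]; rw [← exp_add]; simp
    simp only [hX]
    linear_combination (-ρ) * h2
  have hint : ∀ s c : ℝ, ∫ τ in Ioi s, exp c * exp (-ρ * τ) = exp c * (exp (-ρ * s) / ρ) := by
    intro s c
    rw [integral_const_mul, integral_exp_mul_Ioi (by linarith)]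
    congr 1
    field_simp
  have hX1 : ∀ s, 1 ≤ X s := by
    intro s
    have h1 : exp (z s) * (exp (-ρ * s) / ρ) ≤ A s := by
      rw [← hint]
      refine setIntegral_mono_on ((integrableOn_exp_mul_Ioi (by linarith) s).const_mul _) (hgi s)
        measurableSet_Ioi fun τ hτ => ?_
      rw [← exp_add]
      exact exp_le_exp.2 (by have := hzm (le_of_lt hτ); linarith)
    calc (1 : ℝ) = ρ * exp (ρ * s - z s) * (exp (z s) * (exp (-ρ * s) / ρ)) := by
          rw [sub_eq_add_neg, exp_add, exp_neg, neg_mul, exp_neg]; field_simp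
      _ ≤ _ := mul_le_mul_of_nonneg_left h1 (by positivity)
  have hX2 : ∀ s, X s ≤ exp (Z - z s) := by
    intro s
    have h1 : A s ≤ exp Z * (exp (-ρ * s) / ρ) := by
      rw [← hint]
      refine setIntegral_mono_on (hgi s) (hexp s) measurableSet_Ioi fun τ hτ => ?_
      rw [← exp_add]
      exact exp_le_exp.2 (by have := hzZ τ; linarith)
    calc X s ≤ ρ * exp (ρ * s - z s) * (exp Z * (exp (-ρ * s) / ρ)) :=
          mul_le_mul_of_nonneg_left h1 (by positivity)
      _ = _ := by
          rw [sub_eq_add_neg, sub_eq_add_neg, exp_add, exp_add, exp_neg, neg_mul, exp_neg]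
          field_simp
  have hθ : ∀ s, 0 ≤ 1 - 1 / X s ∧ 1 - 1 / X s ≤ 1 := fun s => by
    have h0 : (0 : ℝ) < X s := lt_of_lt_of_le one_pos (hX1 s)
    have h1 : 1 / X s ≤ 1 := by rw [div_le_one h0]; exact hX1 s
    have h2 : 0 ≤ 1 / X s := by positivity
    constructor <;> linarith
  set β := energyConst k / ρ ^ k with hβ
  have hpc : Continuous fun s => v s ^ (k + 1) := hc.pow _
  set R : ℝ → ℝ := fun s => peakValue k (X s) + β * ∫ τ in (0 : ℝ)..s, v τ ^ (k + 1) with hR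
  have hRm : Monotone R := by
    refine monotone_of_hasDerivAt_nonneg
      (f' := fun s => (1 - 1 / X s) ^ k / X s * ((ρ - v s) * X s - ρ) + β * v s ^ (k + 1))
      (fun s => ?_) (fun s => ?_)
    · have h0 : (0 : ℝ) < X s := lt_of_lt_of_le one_pos (hX1 s)
      refine ((hasDerivAt_peakValue k h0).comp s (hXd s)).add
        ((intervalIntegral.integral_hasDerivAt_right (hpc.intervalIntegrable _ _)
          (hpc.stronglyMeasurableAtFilter _ _) hpc.continuousAt).const_mul β)
    · have h0 : (0 : ℝ) < X s := lt_of_lt_of_le one_pos (hX1 s)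
      have h1 := young_energyConst hk hρ (hθ s).1 (hn s)
      have h2 : (1 - 1 / X s) ^ k / X s * ((ρ - v s) * X s - ρ) =
          -((1 - 1 / X s) ^ k * v s - ρ * (1 - 1 / X s) ^ (k + 1)) := by
        rw [pow_succ]; field_simp; ring
      simp only [Pi.zero_apply]
      rw [h2]; linarith
  set E := ∫ s in Ioi (0 : ℝ), v s ^ (k + 1) with hE
  have hβ0 : 0 ≤ β := div_nonneg (energyConst_pos hk).le (by positivity)
  have hbound : ∀ᶠ S in atTop, peakValue k (X 0) ≤ (Z - z S) + β * E := by
    filter_upwards [eventually_ge_atTop 0] with S hS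
    have h1 := hRm hS
    simp only [hR, intervalIntegral.integral_same, mul_zero, add_zero] at h1
    have h0 : (0 : ℝ) < X S := lt_of_lt_of_le one_pos (hX1 S)
    have h2 : peakValue k (X S) ≤ Z - z S := by
      unfold peakValue
      have h3 := logPartial_nonneg k (hθ S).1
      have h4 : log (X S) ≤ Z - z S := by
        rw [← log_exp (Z - z S)]; exact log_le_log h0 (hX2 S)
      linarith
    have h5 : ∫ τ in (0 : ℝ)..S, v τ ^ (k + 1) ≤ E := by
      rw [intervalIntegral.integral_of_le hS]
      exact setIntegral_mono_set hp (Eventually.of_forall fun x => pow_nonneg (hn x) _)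
        (Eventually.of_forall fun x hx => hx.1)
    have := mul_le_mul_of_nonneg_left h5 hβ0
    linarith
  have hlim : Tendsto (fun S => (Z - z S) + β * E) atTop (nhds ((Z - Z) + β * E)) :=
    (tendsto_const_nhds.sub hzlim).add_const _
  have h1 := ge_of_tendsto hlim hbound
  rw [sub_self, zero_add] at h1
  have h0 : (0 : ℝ) < X 0 := lt_of_lt_of_le one_pos (hX1 0)
  have h2 : log (X 0) ≤ β * E + harm k := by
    have := logPartial_le_harm k (hθ 0).1 (hθ 0).2
    unfold peakValue at h1
    linarith
  have h3 : X 0 ≤ exp (β * E + harm k) := by rw [← exp_log h0]; exact exp_le_exp.2 h2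
  have h4 : X 0 = ρ * A 0 := by
    simp [hX, hz, prim]
  rw [h4] at h3
  rw [one_div, le_inv_mul_iff₀ hρ]
  exact h3

lemma conjExp_sub_one (k : ℕ) : conjExp k - 1 = 1 / (k : ℝ) := by unfold conjExp; ring

lemma hasDerivAt_rpow_conjExp (k : ℕ) (x : ℝ) :
    HasDerivAt (fun x : ℝ => x ^ conjExp k) (conjExp k * x ^ (1 / (k : ℝ))) x := by
  have := Real.hasDerivAt_rpow_const (x := x) (p := conjExp k) (Or.inr (one_le_conjExp k))
  rwa [conjExp_sub_one] at this

lemma rpow_conjExp_pow {k : ℕ} (hk : 0 < k) {x : ℝ} (hx : 0 ≤ x) :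
    (x ^ conjExp k) ^ k = x ^ (k + 1) := by
  have hk' : (k : ℝ) ≠ 0 := by positivity
  rw [← rpow_natCast, ← rpow_mul hx, ← rpow_natCast]
  congr 1; unfold conjExp; push_cast; field_simp

lemma rpow_inv_pow_succ {k : ℕ} (hk : 0 < k) {x : ℝ} (hx : 0 ≤ x) :
    (x ^ (1 / (k : ℝ))) ^ (k + 1) = x ^ conjExp k := by
  have hk' : (k : ℝ) ≠ 0 := by positivity
  rw [← rpow_natCast, ← rpow_mul hx]
  congr 1; unfold conjExp; push_cast; field_simp

lemma rpow_inv_pow {k : ℕ} (hk : 0 < k) {x : ℝ} (hx : 0 ≤ x) :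
    (x ^ (1 / (k : ℝ))) ^ k = x := by
  rw [one_div]; exact rpow_inv_natCast_pow hx hk.ne'

lemma add_rpow_conjExp_le {k : ℕ} (hk : 0 < k) {x y : ℝ} (hx : 0 ≤ x) (hy : 0 ≤ y) :
    (x + y) ^ conjExp k ≤ x ^ conjExp k + conjExp k * x ^ (1 / (k : ℝ)) * y + y ^ conjExp k := by
  have hq := conjExp_pos k
  have hd : ∀ t : ℝ, HasDerivAt (fun t => x ^ conjExp k + conjExp k * x ^ (1 / (k : ℝ)) * t +
      t ^ conjExp k - (x + t) ^ conjExp k)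
      (conjExp k * x ^ (1 / (k : ℝ)) + conjExp k * t ^ (1 / (k : ℝ)) -
        conjExp k * (x + t) ^ (1 / (k : ℝ))) t := by
    intro t
    have h1 := (hasDerivAt_rpow_conjExp k (x + t)).comp t ((hasDerivAt_id t).const_add x)
    have h2 := (((hasDerivAt_id t).const_mul (conjExp k * x ^ (1 / (k : ℝ)))).const_add
      (x ^ conjExp k)).add (hasDerivAt_rpow_conjExp k t)
    refine (h2.sub h1).congr_deriv ?_
    simp
  have hm : MonotoneOn (fun t => x ^ conjExp k + conjExp k * x ^ (1 / (k : ℝ)) * t +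
      t ^ conjExp k - (x + t) ^ conjExp k) (Ici 0) := by
    refine monotoneOn_of_deriv_nonneg (convex_Ici 0)
      (fun t _ => (hd t).continuousAt.continuousWithinAt)
      (fun t _ => (hd t).differentiableAt.differentiableWithinAt) fun t ht => ?_
    rw [interior_Ici] at ht
    rw [(hd t).deriv]
    have h3 : (x + t) ^ (1 / (k : ℝ)) ≤ x ^ (1 / (k : ℝ)) + t ^ (1 / (k : ℝ)) := by
      refine Real.rpow_add_le_add_rpow hx (le_of_lt ht) (by positivity) ?_
      rw [div_le_one (by positivity)]; exact_mod_cast hk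
    nlinarith
  have h := hm (mem_Ici.2 le_rfl) (mem_Ici.2 hy) hy
  simp only [mul_zero, add_zero, zero_rpow hq.ne', sub_self] at h
  linarith

/-- Parameters of the exponential functional in logarithmic coordinates. -/
structure Weight (k : ℕ) (b μ : ℝ) (φ : ℝ → ℝ) : Prop where
  b_pos : 0 < b
  mu_eq : μ * b ^ conjExp k = 1
  cont : ContinuousOn φ (Ioi 0)
  nonneg : ∀ s, 0 < s → 0 ≤ φ s
  lim : Tendsto φ atTop (nhds 0)
  slow : ∀ ε : ℝ, 0 < ε →
    ∀ᶠ s in atTop, s * (b * s ^ (1 / conjExp k)) ^ φ s ≤ s + ε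

/-- The exponent of the functional. -/
noncomputable def phase (k : ℕ) (b μ : ℝ) (φ : ℝ → ℝ) (s y : ℝ) : ℝ :=
  μ * (b * y) ^ (conjExp k + φ s)

/-- The functional in logarithmic coordinates. -/
noncomputable def logFunctional (k : ℕ) (b μ : ℝ) (φ Φ : ℝ → ℝ) : ℝ≥0∞ :=
  ∫⁻ s in Ioi (0 : ℝ), ENNReal.ofReal (exp (phase k b μ φ s (Φ s) - s))

namespace Weight

variable {k : ℕ} {b μ : ℝ} {φ : ℝ → ℝ}

lemma mu_pos (W : Weight k b μ φ) : 0 < μ := by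
  by_contra h
  have h1 : 0 < b ^ conjExp k := rpow_pos_of_pos W.b_pos _
  have h2 := W.mu_eq
  nlinarith [not_lt.1 h]

lemma phase_eq (W : Weight k b μ φ) {s y : ℝ} (hs : 0 < s) (hy : 0 ≤ y) :
    phase k b μ φ s y = y ^ conjExp k * (b * y) ^ φ s := by
  have hb := W.b_pos
  unfold phase
  rw [rpow_add_of_nonneg (by positivity) (conjExp_pos k).le (W.nonneg s hs),
    mul_rpow hb.le hy, ← mul_assoc, ← mul_assoc, W.mu_eq, one_mul]

lemma phase_nonneg (W : Weight k b μ φ) {s y : ℝ} (hy : 0 ≤ y) : 0 ≤ phase k b μ φ s y :=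
  mul_nonneg W.mu_pos.le (rpow_nonneg (mul_nonneg W.b_pos.le hy) _)

lemma phase_le_of_small (W : Weight k b μ φ) {s y : ℝ} (hs : 0 < s) (hy : 0 ≤ y)
    (h : b * y ≤ 1) : phase k b μ φ s y ≤ y ^ conjExp k := by
  rw [W.phase_eq hs hy]
  have := rpow_le_one (mul_nonneg W.b_pos.le hy) h (W.nonneg s hs)
  have h2 : 0 ≤ y ^ conjExp k := rpow_nonneg hy _
  nlinarith

lemma phase_ge_of_large (W : Weight k b μ φ) {s y : ℝ} (hs : 0 < s) (hy : 0 ≤ y)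
    (h : 1 ≤ b * y) : y ^ conjExp k ≤ phase k b μ φ s y := by
  rw [W.phase_eq hs hy]
  have := one_le_rpow h (W.nonneg s hs)
  have h2 : 0 ≤ y ^ conjExp k := rpow_nonneg hy _
  nlinarith

lemma phase_le_add (W : Weight k b μ φ) {ε : ℝ} (hε : 0 < ε) :
    ∀ᶠ s in atTop, ∀ y, 0 ≤ y → y ^ conjExp k ≤ s → phase k b μ φ s y ≤ y ^ conjExp k + ε := by
  filter_upwards [W.slow ε hε, eventually_gt_atTop 0] with s hs hs0 y hy hys
  have hb := W.b_pos
  rcases le_total (b * y) 1 with h | h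
  · exact (W.phase_le_of_small hs0 hy h).trans (by linarith)
  rw [W.phase_eq hs0 hy]
  have hφ := W.nonneg s hs0
  have h1 : 1 ≤ (b * y) ^ φ s := one_le_rpow h hφ
  have h2 : y ≤ s ^ (1 / conjExp k) := by
    have := rpow_le_rpow (by positivity) hys (by have := conjExp_pos k; positivity :
      0 ≤ 1 / conjExp k)
    rwa [← rpow_mul hy, mul_one_div_cancel (conjExp_pos k).ne', rpow_one] at this
  have h3 : (b * y) ^ φ s ≤ (b * s ^ (1 / conjExp k)) ^ φ s :=
    rpow_le_rpow (by positivity) (by gcongr) hφ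
  have h4 : 0 ≤ y ^ conjExp k := rpow_nonneg hy _
  nlinarith

end Weight

/-- Peak contribution of a profile which is nearly extremal at `a`. -/
lemma peak_bound_aux {k : ℕ} (hk : 0 < k) {v : ℝ → ℝ} (hv : Profile k v) (hc : Continuous v)
    (hi : IntegrableOn v (Ioi 0)) {a d : ℝ} (ha : 0 < a) (hd0 : 0 ≤ d) (hd : d ≤ 1 / 2)
    (hξ : (prim v a ^ conjExp k / a) ^ k = 1 - d ^ k) :
    IntegrableOn (fun s => exp (prim v s ^ conjExp k - s)) (Ioi a) ∧
    ∫ s in Ioi a, exp (prim v s ^ conjExp k - s) ≤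
      exp ((k + 1) * 2 ^ (k + 1) / k * (a * d ^ (k + 1)) + 2 * d + harm k) := by
  have hk' : (0 : ℝ) < k := by exact_mod_cast hk
  set α := prim v a with hα
  have hα0 : 0 ≤ α := hv.prim_nonneg ha.le
  set ξ := α ^ conjExp k with hξd
  have hξ0 : 0 ≤ ξ := rpow_nonneg hα0 _
  set δ := d ^ k with hδ
  have hδ0 : 0 ≤ δ := pow_nonneg hd0 k
  have hδ1 : δ ≤ 1 := pow_le_one₀ hd0 (by linarith)
  set ρ := 1 - d with hρ
  have hρ0 : 0 < ρ := by simp only [hρ]; linarith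
  set c := conjExp k * α ^ (1 / (k : ℝ)) with hcd
  have hc0 : 0 ≤ c := mul_nonneg (conjExp_pos k).le (rpow_nonneg hα0 _)
  set u : ℝ → ℝ := fun τ => c * v (a + τ) with hu
  have huc : Continuous u := by fun_prop
  have hun : ∀ s, 0 ≤ u s := fun s => mul_nonneg hc0 (hv.nonneg _)
  have hshift : ∀ f : ℝ → ℝ, IntegrableOn f (Ioi a) →
      IntegrableOn (fun τ => f (a + τ)) (Ioi 0) := by
    intro f hf
    have h := (measurePreserving_add_left volume a).integrableOn_comp_preimage
      (measurableEmbedding_addLeft a) (f := f) (s := Ioi a)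
    have h2 : (fun x => a + x) ⁻¹' Ioi a = Ioi 0 := by ext; simp
    rw [h2] at h
    exact h.2 hf
  have hshift' : ∀ f : ℝ → ℝ, IntegrableOn (fun τ => f (a + τ)) (Ioi 0) →
      IntegrableOn f (Ioi a) := by
    intro f hf
    have h := (measurePreserving_add_left volume a).integrableOn_comp_preimage
      (measurableEmbedding_addLeft a) (f := f) (s := Ioi a)
    have h2 : (fun x => a + x) ⁻¹' Ioi a = Ioi 0 := by ext; simp
    rw [h2] at h
    exact h.1 hf
  have hshiftI : ∀ f : ℝ → ℝ, ∫ s in Ioi a, f s = ∫ τ in Ioi (0 : ℝ), f (a + τ) := by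
    intro f
    have h := (measurePreserving_add_left volume a).setIntegral_preimage_emb
      (measurableEmbedding_addLeft a) f (Ioi a)
    have h2 : (fun x => a + x) ⁻¹' Ioi a = Ioi 0 := by ext; simp
    rw [h2] at h
    exact h.symm
  have hsub := Ioi_subset_Ioi ha.le
  have hui : IntegrableOn u (Ioi 0) := (hshift v (hi.mono_set hsub)).const_mul c
  have hup : IntegrableOn (fun s => u s ^ (k + 1)) (Ioi 0) := by
    simp only [hu, mul_pow]
    exact (hshift _ (hv.integrable.mono_set hsub)).const_mul _
  set T := ∫ s in Ioi a, v s ^ (k + 1) with hT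
  have hE : ∫ s in Ioi (0 : ℝ), u s ^ (k + 1) = c ^ (k + 1) * T := by
    simp only [hu, mul_pow]
    rw [integral_const_mul, hT, hshiftI (fun s => v s ^ (k + 1))]
  have hpow : ξ ^ k = α ^ (k + 1) := rpow_conjExp_pow hk hα0
  have hTδ : T ≤ δ := by
    have h1 := hv.increment_pow_le le_rfl ha.le
    rw [Profile.prim_zero, sub_zero, sub_zero, ← hα, ← hpow] at h1
    have h2 := hv.energy_split ha.le
    have h3 : (ξ / a) ^ k ≤ ∫ x in (0 : ℝ)..a, v x ^ (k + 1) := by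
      rw [div_pow, div_le_iff₀ (by positivity)]; exact h1
    rw [hξ] at h3
    linarith
  have hprim : ∀ τ, 0 ≤ τ → prim u τ = c * (prim v (a + τ) - α) := by
    intro τ hτ
    rw [hα, hv.prim_sub ha.le (by linarith)]
    simp only [prim, hu]
    rw [intervalIntegral.integral_const_mul,
      intervalIntegral.integral_comp_add_left (fun x => v x) a, add_zero]
  obtain ⟨hI1, hI2⟩ := integral_exp_prim_le hk huc hun hui hup hρ0
  have hpt : ∀ τ ∈ Ioi (0 : ℝ), exp (prim v (a + τ) ^ conjExp k - (a + τ)) ≤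
      exp (ξ - a) * exp (prim u τ - ρ * τ) := by
    intro τ hτ
    have hτ' : 0 < τ := hτ
    have hY0 : 0 ≤ prim v (a + τ) - α := by
      have := hv.prim_mono ha.le (show a ≤ a + τ by linarith); linarith
    rw [← exp_add, exp_le_exp, hprim τ hτ'.le]
    have h1 := add_rpow_conjExp_le hk hα0 hY0
    rw [add_sub_cancel] at h1
    have h2 : (prim v (a + τ) - α) ^ conjExp k ≤ δ ^ (1 / (k : ℝ)) * τ := by
      refine rpow_conjExp_le hk hY0 hδ0 hτ'.le ?_
      have h3 := hv.increment_pow_le ha.le (show a ≤ a + τ by linarith)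
      have h4 := hv.energy_interval_le_tail ha.le (show a ≤ a + τ by linarith)
      rw [add_sub_cancel_left] at h3
      exact h3.trans (mul_le_mul_of_nonneg_right (h4.trans hTδ) (by positivity))
    have h5 : δ ^ (1 / (k : ℝ)) = d := by
      rw [hδ, one_div, pow_rpow_inv_natCast hd0 hk.ne']
    rw [h5] at h2
    simp only [hρ]
    linarith
  have hcont : Continuous fun s => exp (prim v s ^ conjExp k - s) := by
    have h1 : Continuous (prim v) := by
      unfold prim
      exact intervalIntegral.continuous_primitive (fun _ _ => hc.intervalIntegrable _ _) 0
    have h2 : Continuous fun s => prim v s ^ conjExp k :=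
      h1.rpow_const fun s => Or.inr (conjExp_pos k).le
    fun_prop
  have hI3 : IntegrableOn (fun τ => exp (prim v (a + τ) ^ conjExp k - (a + τ))) (Ioi 0) := by
    refine (hI1.const_mul (exp (ξ - a))).mono' (by
      exact (hcont.comp (continuous_const.add continuous_id)).aestronglyMeasurable) ?_
    refine (ae_restrict_iff' measurableSet_Ioi).2 (Eventually.of_forall fun τ hτ => ?_)
    rw [norm_of_nonneg (exp_pos _).le]
    exact hpt τ hτ
  refine ⟨hshift' (fun s => exp (prim v s ^ conjExp k - s)) hI3, ?_⟩
  rw [hshiftI (fun s => exp (prim v s ^ conjExp k - s))]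
  refine (setIntegral_mono_on hI3 (hI1.const_mul _) measurableSet_Ioi hpt).trans ?_
  rw [integral_const_mul]
  refine (mul_le_mul_of_nonneg_left hI2 (exp_pos _).le).trans ?_
  rw [hE]
  have hcβ : energyConst k * c ^ (k + 1) = ξ / k := by
    rw [hcd, mul_pow, rpow_inv_pow_succ hk hα0, ← hξd]
    have : conjExp k = (k + 1) / k := by unfold conjExp; field_simp
    rw [this]
    unfold energyConst
    rw [div_pow, pow_succ (k : ℝ) k]
    field_simp
  set R := 1 / ρ ^ k with hR
  have hξa : ξ ≤ a * (1 - δ / k) := by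
    have h1 := one_add_mul_le_pow (a := -(δ / k)) (by
      have : δ / k ≤ 1 := by
        rw [div_le_one hk']; exact hδ1.trans (by exact_mod_cast hk)
      linarith) k
    have h2 : 1 + (k : ℝ) * -(δ / k) = 1 - δ := by field_simp; ring
    rw [h2, ← hξ] at h1
    have h3 := le_of_pow_le_pow_left₀ hk.ne' (by
      have : δ / k ≤ 1 := by
        rw [div_le_one hk']; exact hδ1.trans (by exact_mod_cast hk)
      linarith) h1
    rw [div_le_iff₀ ha] at h3
    linarith
  have hm : 1 / ρ ≤ 1 + 2 * d := by
    rw [div_le_iff₀ hρ0]; simp only [hρ]; nlinarith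
  have hR1 : 1 ≤ R := by
    rw [hR, le_div_iff₀ (by positivity), one_mul]
    exact pow_le_one₀ hρ0.le (by simp only [hρ]; linarith)
  have hR2 : R - 1 ≤ (k + 1) * 2 ^ (k + 1) * d := by
    have h1 := pow_tangent k (m := 1 + 2 * d) (x := 1) (by linarith) zero_le_one
    rw [one_pow] at h1
    have h2 : R ≤ (1 + 2 * d) ^ (k + 1) := by
      calc R = (1 / ρ) ^ k := by rw [hR, div_pow, one_pow]
        _ ≤ (1 + 2 * d) ^ k := pow_le_pow_left₀ (by positivity) hm k
        _ ≤ _ := pow_le_pow_right₀ (by linarith) (Nat.le_succ k)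
    have h3 : (1 + 2 * d) ^ k ≤ 2 ^ k := pow_le_pow_left₀ (by linarith) (by linarith) k
    have h4 : ((k : ℝ) + 1) * (1 + 2 * d) ^ k * (2 * d) ≤ (k + 1) * 2 ^ k * (2 * d) := by gcongr
    rw [pow_succ (2 : ℝ) k]
    linarith
  have hfin : ξ - a + (2 * d) + (energyConst k / ρ ^ k * (c ^ (k + 1) * T) + harm k) ≤
      (k + 1) * 2 ^ (k + 1) / k * (a * d ^ (k + 1)) + 2 * d + harm k := by
    have h1 : energyConst k / ρ ^ k * (c ^ (k + 1) * T) = ξ / k * R * T := by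
      rw [← hcβ, hR]; ring
    have h2 : ξ / k * R * T ≤ ξ * (R * δ / k) := by
      have : ξ / k * R * T ≤ ξ / k * R * δ :=
        mul_le_mul_of_nonneg_left hTδ (by positivity)
      linarith [show ξ / k * R * δ = ξ * (R * δ / k) by ring]
    have h3 : ξ * (1 + R * δ / k) ≤ a * (1 - δ / k) * (1 + R * δ / k) :=
      mul_le_mul_of_nonneg_right hξa (by positivity)
    have h4 : a * (1 - δ / k) * (1 + R * δ / k) =
        a + a * δ / k * (R - 1) - a * (δ / k) * (R * δ / k) := by
      ring
    have h5 : 0 ≤ a * (δ / k) * (R * δ / k) := by positivity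
    have h6 : a * δ / k * (R - 1) ≤ a * δ / k * ((k + 1) * 2 ^ (k + 1) * d) :=
      mul_le_mul_of_nonneg_left hR2 (by positivity)
    have h7 : a * δ / k * ((k + 1) * 2 ^ (k + 1) * d) =
        (k + 1) * 2 ^ (k + 1) / k * (a * d ^ (k + 1)) := by
      rw [hδ, pow_succ d k]; ring
    rw [h1]; linarith
  calc exp (ξ - a) * (1 / ρ * exp (energyConst k / ρ ^ k * (c ^ (k + 1) * T) + harm k))
      ≤ exp (ξ - a) * (exp (2 * d) * exp (energyConst k / ρ ^ k * (c ^ (k + 1) * T) + harm k)) := by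
        have : 1 / ρ ≤ exp (2 * d) := hm.trans (by have := add_one_le_exp (2 * d); linarith)
        gcongr
    _ = exp (ξ - a + (2 * d) + (energyConst k / ρ ^ k * (c ^ (k + 1) * T) + harm k)) := by
        rw [← exp_add, ← exp_add]; congr 1; ring
    _ ≤ _ := exp_le_exp.2 hfin

/-- Error in the peak estimate for a profile within distance `2 log a` of the critical line
at `a`. -/
noncomputable def peakDefect (k : ℕ) (a : ℝ) : ℝ := (2 * k * log a / a) ^ (1 / (k : ℝ))

lemma tendsto_log_pow_div (n : ℕ) (c : ℝ) :
    Tendsto (fun a : ℝ => c * log a ^ n / a) atTop (nhds 0) := by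
  have h := (isLittleO_pow_log_id_atTop (n := n)).tendsto_div_nhds_zero.const_mul c
  simpa [mul_div_assoc] using h

lemma tendsto_peakDefect {k : ℕ} (hk : 0 < k) : Tendsto (peakDefect k) atTop (nhds 0) := by
  have h := (tendsto_log_pow_div 1 (2 * k)).rpow_const (p := 1 / (k : ℝ))
    (Or.inr (by positivity))
  rw [zero_rpow (by positivity)] at h
  unfold peakDefect; simpa using h

lemma tendsto_mul_peakDefect {k : ℕ} (hk : 0 < k) :
    Tendsto (fun a => a * peakDefect k a ^ (k + 1)) atTop (nhds 0) := by
  have hk' : (k : ℝ) ≠ 0 := by positivity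
  have h := (tendsto_log_pow_div (k + 1) ((2 * k) ^ (k + 1))).rpow_const (p := 1 / (k : ℝ))
    (Or.inr (by positivity))
  rw [zero_rpow (by positivity)] at h
  refine h.congr' ?_
  filter_upwards [eventually_ge_atTop 1] with a ha
  have hl : 0 ≤ log a := log_nonneg ha
  have ha0 : 0 < a := by linarith
  have h0 : 0 ≤ 2 * k * log a / a := by positivity
  have hD : 0 ≤ peakDefect k a := rpow_nonneg h0 _
  have hDk : peakDefect k a ^ k = 2 * k * log a / a := rpow_inv_pow hk h0
  have h1 : (2 * (k : ℝ)) ^ (k + 1) * log a ^ (k + 1) / a = (a * peakDefect k a ^ (k + 1)) ^ k := by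
    rw [mul_pow a, ← pow_mul, mul_comm (k + 1) k, pow_mul, hDk, div_pow, mul_pow _ (log a),
      pow_succ a k]
    field_simp
  rw [h1, one_div, pow_rpow_inv_natCast (by positivity) hk.ne']

/-- Profiles that are small on a long initial interval have functional at most the
concentration level, up to `ε`. -/
theorem level_bound {k : ℕ} (hk : 0 < k) {b μ : ℝ} {φ : ℝ → ℝ} (W : Weight k b μ φ)
    {ε : ℝ} (hε : 0 < ε) :
    ∃ S > 0, ∃ η > 0, ∀ v, Profile k v → Continuous v → IntegrableOn v (Ioi 0) →
      prim v S ≤ η → logFunctional k b μ φ (prim v) ≤ ENNReal.ofReal (1 + exp (harm k) + ε) := by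
  have hk' : (0 : ℝ) < k := by exact_mod_cast hk
  obtain ⟨e, he0, hle⟩ : ∃ e > 0, exp e * (1 + e + exp (e + harm k)) ≤ 1 + exp (harm k) + ε := by
    have hc : Continuous fun e : ℝ => exp e * (1 + e + exp (e + harm k)) := by fun_prop
    have h := hc.tendsto 0
    simp only [exp_zero, one_mul, zero_add, add_zero] at h
    have h2 := (h.mono_left nhdsWithin_le_nhds : Tendsto _ (nhdsWithin (0 : ℝ) (Ioi 0)) _)
    obtain ⟨e, h3, h4⟩ := ((h2.eventually_le_const
      (show 1 + exp (harm k) < 1 + exp (harm k) + ε by linarith)).and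
      self_mem_nhdsWithin).exists
    exact ⟨e, h4, h3⟩
  have hE : Tendsto (fun a => (k + 1) * 2 ^ (k + 1) / k * (a * peakDefect k a ^ (k + 1)) +
      2 * peakDefect k a) atTop (nhds 0) := by
    have := ((tendsto_mul_peakDefect hk).const_mul (((k : ℝ) + 1) * 2 ^ (k + 1) / k)).add
      ((tendsto_peakDefect hk).const_mul 2)
    simpa using this
  obtain ⟨S, hS⟩ := ((((W.phase_le_add he0).and (hE.eventually_le_const he0)).and
    ((tendsto_peakDefect hk).eventually_le_const (show (0 : ℝ) < 1 / 2 by norm_num))).and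
    (eventually_ge_atTop (1 + 1 / e))).exists_forall_of_atTop
  have hSe : 1 + 1 / e ≤ S := (hS S le_rfl).2
  have he1 : 0 < 1 / e := by positivity
  have hS1 : 1 ≤ S := by linarith
  have hS0 : 0 < S := by linarith
  have hb := W.b_pos
  have hq := conjExp_pos k
  refine ⟨S, hS0, min (1 / b) (e ^ (1 / conjExp k)), by positivity, fun v hv hc hi hη => ?_⟩
  set Φ := prim v with hΦ
  have hΦc : Continuous Φ := by
    have : ∀ s, HasDerivAt Φ (v s) s := fun s =>
      intervalIntegral.integral_hasDerivAt_right (hc.intervalIntegrable _ _)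
        (hc.stronglyMeasurableAtFilter _ _) hc.continuousAt
    exact continuous_iff_continuousAt.2 fun s => (this s).continuousAt
  have hΦq : Continuous fun s => Φ s ^ conjExp k := hΦc.rpow_const fun s => Or.inr hq.le
  set F : ℝ → ℝ≥0∞ := fun s => ENNReal.ofReal (exp (phase k b μ φ s (Φ s) - s)) with hF
  have hlate : ∀ s, S ≤ s → phase k b μ φ s (Φ s) ≤ Φ s ^ conjExp k + e := fun s hs =>
    (hS s hs).1.1.1 _ (hv.prim_nonneg (by linarith)) (hv.prim_rpow_le hk (by linarith))
  have hA : ∫⁻ s in Ioc 0 S, F s ≤ ENNReal.ofReal (exp e * 1) := by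
    have h1 : ∫⁻ s in Ioc 0 S, F s ≤ ∫⁻ s in Ioi 0, ENNReal.ofReal (exp e * exp (-s)) := by
      refine (setLIntegral_mono (by fun_prop) fun s hs => ?_).trans
        (lintegral_mono_set Ioc_subset_Ioi_self)
      have hy0 := hv.prim_nonneg hs.1.le
      have hy : Φ s ≤ min (1 / b) (e ^ (1 / conjExp k)) := (hv.prim_mono hs.1.le hs.2).trans hη
      have hy1 : b * Φ s ≤ 1 := by
        have := mul_le_mul_of_nonneg_left (hy.trans (min_le_left _ _)) hb.le
        rwa [mul_one_div_cancel hb.ne'] at this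
      have hy2 : Φ s ^ conjExp k ≤ e := by
        have := rpow_le_rpow hy0 (hy.trans (min_le_right _ _)) hq.le
        rwa [← rpow_mul he0.le, one_div_mul_cancel hq.ne', rpow_one] at this
      have := (W.phase_le_of_small hs.1 hy0 hy1).trans hy2
      rw [← exp_add]
      apply ENNReal.ofReal_le_ofReal
      apply exp_le_exp.2
      linarith
    refine h1.trans (le_of_eq ?_)
    rw [← ofReal_integral_eq_lintegral_ofReal ((exp_neg_integrableOn_Ioi 0 one_pos).const_mul
      (exp e) |>.congr (by simp)) (Eventually.of_forall fun s => by positivity),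
      integral_const_mul, integral_exp_neg_Ioi_zero]
  have hB : ∀ T : Set ℝ, MeasurableSet T → T ⊆ Ioi S →
      (∀ s ∈ T, Φ s ^ conjExp k ≤ s - 2 * log s) →
      ∫⁻ s in T, F s ≤ ENNReal.ofReal (exp e * e) := by
    intro T hT hTS hTg
    have h1 : ∫⁻ s in T, F s ≤ ∫⁻ s in Ioi S, ENNReal.ofReal (exp e * s ^ (-2 : ℝ)) := by
      refine (setLIntegral_mono' hT fun s hs => ?_).trans (lintegral_mono_set hTS)
      have hs1 : S < s := hTS hs
      have hs0 : 0 < s := by linarith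
      apply ENNReal.ofReal_le_ofReal
      rw [rpow_def_of_pos hs0, ← exp_add]
      apply exp_le_exp.2
      linarith [hTg s hs, hlate s hs1.le]
    refine h1.trans ?_
    rw [← ofReal_integral_eq_lintegral_ofReal
      ((integrableOn_Ioi_rpow_of_lt (by norm_num) hS0).const_mul _)
      ((ae_restrict_iff' measurableSet_Ioi).2 (Eventually.of_forall fun s hs => by
        have : 0 < s := lt_trans hS0 hs
        positivity)), integral_const_mul, integral_Ioi_rpow_of_lt (by norm_num) hS0]
    apply ENNReal.ofReal_le_ofReal
    gcongr
    norm_num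
    rw [rpow_neg_one]
    rw [inv_le_comm₀ hS0 he0]
    rw [one_div] at *; linarith
  have hsplit : ∫⁻ s in Ioi 0, F s ≤ (∫⁻ s in Ioc 0 S, F s) + ∫⁻ s in Ioi S, F s := by
    rw [← Ioc_union_Ioi_eq_Ioi hS0.le]
    exact lintegral_union_le _ _ _
  have hee : 0 ≤ exp e * exp (e + harm k) := by positivity
  set K : Set ℝ := {s | s - 2 * log s ≤ Φ s ^ conjExp k} ∩ Ici S with hK
  by_cases hne : K.Nonempty
  swap
  · have h2 := hB (Ioi S) measurableSet_Ioi le_rfl fun s hs => by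
      by_contra h
      exact hne ⟨s, (not_le.1 h).le, le_of_lt (mem_Ioi.1 hs)⟩
    refine hsplit.trans ((add_le_add hA h2).trans ?_)
    rw [← ENNReal.ofReal_add (by positivity) (by positivity)]
    exact ENNReal.ofReal_le_ofReal (by nlinarith)
  have hKc : IsClosed K := by
    have h1 : ContinuousOn (fun s => Φ s ^ conjExp k - (s - 2 * log s)) (Ici S) := by
      refine hΦq.continuousOn.sub (continuousOn_id.sub (continuousOn_const.mul
        (continuousOn_log.mono fun s hs => ?_)))
      have : S ≤ s := hs
      simp; linarith
    have h2 := h1.preimage_isClosed_of_isClosed isClosed_Ici (isClosed_Ici (a := (0 : ℝ)))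
    convert h2 using 1
    ext s; simp [hK, and_comm]
  have hKb : BddBelow K := ⟨S, fun s hs => hs.2⟩
  set a := sInf K with ha
  obtain ⟨ha1, ha2⟩ : a ∈ K := hKc.csInf_mem hne hKb
  simp only [mem_ofPred_eq, mem_Ici] at ha1 ha2
  have ha0 : 0 < a := by linarith
  have hB' := hB (Ioo S a) measurableSet_Ioo Ioo_subset_Ioi_self fun s hs => by
    by_contra h
    exact absurd (csInf_le hKb (show s ∈ K from ⟨(not_le.1 h).le, hs.1.le⟩)) (not_le.2 hs.2)
  have hC : ∫⁻ s in Ici a, F s ≤ ENNReal.ofReal (exp e * exp (e + harm k)) := by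
    rw [setLIntegral_congr Ioi_ae_eq_Ici.symm]
    set ξ := Φ a ^ conjExp k with hξ
    have hξ0 : 0 ≤ ξ := rpow_nonneg (hv.prim_nonneg ha0.le) _
    have hξa : ξ / a ≤ 1 := (div_le_one ha0).2 (hv.prim_rpow_le hk ha0.le)
    have hξa0 : 0 ≤ ξ / a := by positivity
    have hδ0 : 0 ≤ 1 - (ξ / a) ^ k := sub_nonneg.2 (pow_le_one₀ hξa0 hξa)
    have hδ1 : 1 - (ξ / a) ^ k ≤ 2 * k * log a / a := by
      have h1 := one_add_mul_le_pow (a := ξ / a - 1) (by linarith) k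
      rw [show 1 + (ξ / a - 1) = ξ / a by ring] at h1
      have h2 : 1 - ξ / a ≤ 2 * log a / a := by
        rw [one_sub_div ha0.ne']; gcongr; linarith
      have h3 := mul_le_mul_of_nonneg_left h2 hk'.le
      have h4 : (k : ℝ) * (2 * log a / a) = 2 * k * log a / a := by ring
      linarith
    set d := (1 - (ξ / a) ^ k) ^ (1 / (k : ℝ)) with hd
    have hd0 : 0 ≤ d := rpow_nonneg hδ0 _
    have hdk : d ^ k = 1 - (ξ / a) ^ k := rpow_inv_pow hk hδ0
    have hdD : d ≤ peakDefect k a := rpow_le_rpow hδ0 hδ1 (by positivity)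
    obtain ⟨p1, p2⟩ := peak_bound_aux hk hv hc hi ha0 hd0 (hdD.trans (hS a ha2).1.2)
      (by rw [hdk]; ring)
    calc ∫⁻ s in Ioi a, F s
        ≤ ∫⁻ s in Ioi a, ENNReal.ofReal (exp e * exp (Φ s ^ conjExp k - s)) := by
          refine setLIntegral_mono' measurableSet_Ioi fun s hs => ?_
          rw [← exp_add]
          exact ENNReal.ofReal_le_ofReal (exp_le_exp.2 (by
            linarith [hlate s (ha2.trans (le_of_lt hs))]))
      _ = ENNReal.ofReal (exp e * ∫ s in Ioi a, exp (Φ s ^ conjExp k - s)) := by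
          rw [← ofReal_integral_eq_lintegral_ofReal (p1.const_mul _)
            (Eventually.of_forall fun s => by positivity), integral_const_mul]
      _ ≤ _ := by
          refine ENNReal.ofReal_le_ofReal ?_
          gcongr
          refine p2.trans (exp_le_exp.2 ?_)
          have h5 := (hS a ha2).1.1.2
          have h6 : (k + 1) * 2 ^ (k + 1) / k * (a * d ^ (k + 1)) ≤
              (k + 1) * 2 ^ (k + 1) / k * (a * peakDefect k a ^ (k + 1)) := by gcongr
          linarith
  have hsplit2 : ∫⁻ s in Ioi S, F s ≤ (∫⁻ s in Ioo S a, F s) + ∫⁻ s in Ici a, F s := by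
    refine (lintegral_mono_set fun s hs => ?_).trans (lintegral_union_le _ _ _)
    rcases lt_or_ge s a with h | h
    · exact Or.inl ⟨hs, h⟩
    · exact Or.inr h
  refine hsplit.trans ((add_le_add hA (hsplit2.trans (add_le_add hB' hC))).trans ?_)
  rw [← ENNReal.ofReal_add (by positivity) (by positivity),
    ← ENNReal.ofReal_add (by positivity) (by positivity)]
  exact ENNReal.ofReal_le_ofReal (by nlinarith)

/-- Derivative of the phase with respect to the value of the profile. -/
noncomputable def dphase (k : ℕ) (b μ : ℝ) (φ : ℝ → ℝ) (s y : ℝ) : ℝ :=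
  μ * b * ((conjExp k + φ s) * (b * y) ^ (1 / (k : ℝ) + φ s))

namespace Weight

variable {k : ℕ} {b μ : ℝ} {φ : ℝ → ℝ}

lemma dphase_nonneg (W : Weight k b μ φ) {s y : ℝ} (hs : 0 < s) (hy : 0 ≤ y) :
    0 ≤ dphase k b μ φ s y := by
  have h1 := W.mu_pos
  have h2 := W.b_pos
  have h3 := W.nonneg s hs
  have h4 := conjExp_pos k
  unfold dphase; positivity

lemma dphase_pos (W : Weight k b μ φ) {s y : ℝ} (hs : 0 < s) (hy : 0 < y) :
    0 < dphase k b μ φ s y := by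
  have h1 := W.mu_pos
  have h2 := W.b_pos
  have h3 := W.nonneg s hs
  have h4 := conjExp_pos k
  unfold dphase; positivity

lemma phase_tangent (W : Weight k b μ φ) (hk : 0 < k) {s y z : ℝ} (hs : 0 < s) (hy : 0 ≤ y)
    (hz : 0 ≤ z) :
    phase k b μ φ s y + dphase k b μ φ s y * (z - y) ≤ phase k b μ φ s z := by
  have hμ := W.mu_pos
  have hb := W.b_pos
  have hφ := W.nonneg s hs
  have hk' : (0 : ℝ) < k := by exact_mod_cast hk
  have hq := conjExp_pos k
  rcases hy.eq_or_lt with rfl | hy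
  · have h1 : phase k b μ φ s 0 = 0 := by
      unfold phase; rw [mul_zero, zero_rpow (by positivity), mul_zero]
    have h2 : dphase k b μ φ s 0 = 0 := by
      unfold dphase; rw [mul_zero, zero_rpow (by positivity), mul_zero, mul_zero]
    rw [h1, h2]; simpa using W.phase_nonneg hz
  have hr : 1 ≤ conjExp k + φ s := by linarith [one_le_conjExp k]
  have h := one_add_mul_self_le_rpow_one_add (s := z / y - 1)
    (by have := div_nonneg hz hy.le; linarith) hr
  rw [show 1 + (z / y - 1) = z / y by ring] at h
  have hby : 0 < b * y := by positivity
  have h2 : (z / y) ^ (conjExp k + φ s) * (b * y) ^ (conjExp k + φ s) =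
      (b * z) ^ (conjExp k + φ s) := by
    rw [← mul_rpow (by positivity) hby.le]; congr 1; field_simp
  have h3 : (b * y) ^ (conjExp k + φ s) = (b * y) ^ (1 / (k : ℝ) + φ s) * (b * y) := by
    rw [← rpow_add_one hby.ne']; congr 1; unfold conjExp; ring
  have h4 := mul_le_mul_of_nonneg_right h
    (show 0 ≤ μ * (b * y) ^ (conjExp k + φ s) by positivity)
  unfold phase dphase
  calc _ = (1 + (conjExp k + φ s) * (z / y - 1)) * (μ * (b * y) ^ (conjExp k + φ s)) := by
        rw [h3]; field_simp
    _ ≤ _ := h4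
    _ = _ := by rw [← h2]; ring

lemma exp_phase_tangent (W : Weight k b μ φ) (hk : 0 < k) {s y z : ℝ} (hs : 0 < s) (hy : 0 ≤ y)
    (hz : 0 ≤ z) :
    exp (phase k b μ φ s y - s) + dphase k b μ φ s y * exp (phase k b μ φ s y - s) * z ≤
      exp (phase k b μ φ s z - s) + dphase k b μ φ s y * exp (phase k b μ φ s y - s) * y := by
  have h := W.phase_tangent hk hs hy hz
  have h1 := add_one_le_exp (phase k b μ φ s z - phase k b μ φ s y)
  have h2 : exp (phase k b μ φ s z - s) =
      exp (phase k b μ φ s z - phase k b μ φ s y) * exp (phase k b μ φ s y - s) := by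
    rw [← exp_add]; congr 1; ring
  have h3 : dphase k b μ φ s y * (z - y) + 1 ≤ exp (phase k b μ φ s z - phase k b μ φ s y) := by
    linarith
  have h4 := mul_le_mul_of_nonneg_right h3 (exp_pos (phase k b μ φ s y - s)).le
  rw [h2]; nlinarith

lemma dphase_le_of_small (W : Weight k b μ φ) {s y : ℝ} (hs : 0 < s) (hy : 0 ≤ y)
    (h : b * y ≤ exp (-1)) :
    dphase k b μ φ s y ≤ μ * b * ((conjExp k + 1) * (b * y) ^ (1 / (k : ℝ))) := by
  have hμ := W.mu_pos
  have hb := W.b_pos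
  have hφ := W.nonneg s hs
  have hq := conjExp_pos k
  have hby : 0 ≤ b * y := by positivity
  unfold dphase
  gcongr μ * b * ?_
  rw [rpow_add_of_nonneg hby (by positivity) hφ]
  have h1 : (b * y) ^ φ s ≤ exp (-φ s) := by
    refine (rpow_le_rpow hby h hφ).trans (le_of_eq ?_)
    rw [← exp_mul]; congr 1; ring
  have h2 : φ s * (b * y) ^ φ s ≤ 1 := by
    have h3 : φ s * exp (-φ s) ≤ 1 := by
      rw [exp_neg]
      have := add_one_le_exp (φ s)
      rw [← div_eq_mul_inv, div_le_one (exp_pos _)]; linarith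
    exact (mul_le_mul_of_nonneg_left h1 hφ).trans h3
  have h3 : (b * y) ^ φ s ≤ 1 := h1.trans (exp_le_one_iff.2 (by linarith))
  have h4 : 0 ≤ (b * y) ^ (1 / (k : ℝ)) := rpow_nonneg hby _
  calc _ = (b * y) ^ (1 / (k : ℝ)) * (conjExp k * (b * y) ^ φ s + φ s * (b * y) ^ φ s) := by ring
    _ ≤ (b * y) ^ (1 / (k : ℝ)) * (conjExp k * 1 + 1) := by gcongr
    _ = _ := by ring

lemma exists_bound_of_pos (W : Weight k b μ φ) {s₁ : ℝ} (hs₁ : 0 < s₁) :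
    ∃ M, 0 ≤ M ∧ ∀ s, s₁ ≤ s → φ s ≤ M := by
  obtain ⟨S, hS⟩ := (W.lim.eventually_le_const one_pos).exists_forall_of_atTop
  obtain ⟨M, hM⟩ := (isCompact_Icc (a := s₁) (b := S)).bddAbove_image
    (W.cont.mono fun s hs => lt_of_lt_of_le hs₁ hs.1)
  refine ⟨max 1 M, by positivity, fun s hs => ?_⟩
  rcases le_total S s with h | h
  · exact (hS s h).trans (le_max_left _ _)
  · exact (hM (mem_image_of_mem _ ⟨hs, h⟩)).trans (le_max_right _ _)

/-- If `b * y > c` on the graph of a profile, then `s` is bounded below. -/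
lemma lt_of_lt_mul (W : Weight k b μ φ) {c s y : ℝ} (hc : 0 < c)
    (hys : y ^ conjExp k ≤ s) (h : c < b * y) : (c / b) ^ conjExp k ≤ s := by
  have hb := W.b_pos
  refine (rpow_le_rpow (by positivity) ?_ (conjExp_pos k).le).trans hys
  rw [div_le_iff₀ hb]; linarith

lemma exists_phase_bound (W : Weight k b μ φ) :
    ∃ C, 0 < C ∧ ∀ s, 0 < s → ∀ y, 0 ≤ y → y ^ conjExp k ≤ s →
      phase k b μ φ s y ≤ y ^ conjExp k + C := by
  have hb := W.b_pos
  obtain ⟨M, hM0, hM⟩ := W.exists_bound_of_pos (s₁ := (1 / b) ^ conjExp k) (by positivity)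
  obtain ⟨S, hS⟩ := (W.phase_le_add one_pos).exists_forall_of_atTop
  refine ⟨1 + S ^ 1 * (b * max S 1) ^ M ⊔ 0, by positivity, fun s hs y hy hys => ?_⟩
  have h0 : 0 ≤ y ^ conjExp k := rpow_nonneg hy _
  rcases le_total S s with h | h
  · have := hS s h y hy hys
    have h2 : 0 ≤ S ^ 1 * (b * max S 1) ^ M ⊔ 0 := le_sup_right
    linarith
  rcases le_or_gt (b * y) 1 with h1 | h1
  · have := W.phase_le_of_small hs hy h1
    have h2 : 0 ≤ S ^ 1 * (b * max S 1) ^ M ⊔ 0 := le_sup_right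
    linarith
  have hφ := hM s (W.lt_of_lt_mul one_pos hys h1)
  have hyS : y ≤ max S 1 := by
    rcases le_total y 1 with h2 | h2
    · exact h2.trans (le_max_right _ _)
    · refine le_trans ?_ ((hys.trans h).trans (le_max_left _ _))
      exact self_le_rpow_of_one_le h2 (one_le_conjExp k)
  have h3 : (b * y) ^ φ s ≤ (b * max S 1) ^ M :=
    (rpow_le_rpow_of_exponent_le h1.le hφ).trans (rpow_le_rpow (by positivity) (by gcongr) hM0)
  rw [W.phase_eq hs hy]
  have h4 : y ^ conjExp k * (b * y) ^ φ s ≤ S ^ 1 * (b * max S 1) ^ M := by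
    have hS0 : 0 ≤ S := h0.trans (hys.trans h)
    rw [pow_one]; gcongr; exact hys.trans h
  have := h4.trans (le_sup_left (b := (0 : ℝ)))
  linarith

lemma exists_dphase_bound (W : Weight k b μ φ) :
    ∃ C, 0 < C ∧ ∀ s, 0 < s → ∀ y, 0 ≤ y → y ^ conjExp k ≤ s →
      dphase k b μ φ s y ≤ C * (1 + s) := by
  have hb := W.b_pos
  have hμ := W.mu_pos
  have hq := conjExp_pos k
  have he : exp (-1) ≤ 1 := exp_le_one_iff.2 (by norm_num)
  obtain ⟨M, hM0, hM⟩ := W.exists_bound_of_pos (s₁ := (exp (-1) / b) ^ conjExp k) (by positivity)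
  obtain ⟨C₁, hC₁, hp⟩ := W.exists_phase_bound
  set C₂ := 1 + 1 / μ + C₁ / μ with hC₂
  have hC₂0 : 1 ≤ C₂ := by have : 0 ≤ 1 / μ + C₁ / μ := by positivity
                           linarith
  refine ⟨μ * b * ((conjExp k + 1 + M) * C₂), by positivity, fun s hs y hy hys => ?_⟩
  have hby : 0 ≤ b * y := by positivity
  rw [mul_assoc, mul_assoc (conjExp k + 1 + M)]
  have hCs : 1 ≤ C₂ * (1 + s) := by nlinarith
  rcases le_or_gt (b * y) (exp (-1)) with h | h
  · refine (W.dphase_le_of_small hs hy h).trans ?_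
    have h1 : (b * y) ^ (1 / (k : ℝ)) ≤ 1 := rpow_le_one hby (h.trans he) (by positivity)
    gcongr μ * b * (?_ * ?_)
    · linarith
    · exact h1.trans hCs
  have hφ := hM s (W.lt_of_lt_mul (exp_pos _) hys h)
  have hφ0 := W.nonneg s hs
  unfold dphase
  gcongr
  · linarith
  rcases le_total (b * y) 1 with h1 | h1
  · exact (rpow_le_one hby h1 (by positivity)).trans hCs
  have h2 : (b * y) ^ (1 / (k : ℝ) + φ s) ≤ (b * y) ^ (conjExp k + φ s) :=
    rpow_le_rpow_of_exponent_le h1 (by unfold conjExp; linarith)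
  have h3 := hp s hs y hy hys
  have h4 : (b * y) ^ (conjExp k + φ s) ≤ (s + C₁) / μ := by
    rw [le_div_iff₀ hμ, mul_comm]
    unfold phase at h3; linarith
  refine h2.trans (h4.trans ?_)
  have h5 : (s + C₁) / μ = 1 / μ * s + C₁ / μ := by ring
  have h6 : 0 ≤ 1 / μ := by positivity
  have h7 : 0 ≤ C₁ / μ := by positivity
  rw [h5, hC₂]; nlinarith [mul_nonneg h7 hs.le]

end Weight

/-- `Φ` satisfies the duality estimate enjoyed by primitives of profiles. -/
def DualBound (k : ℕ) (Φ : ℝ → ℝ) : Prop :=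
  ∀ h : ℝ → ℝ≥0∞, Measurable h → ∫⁻ s in Ioi (0 : ℝ), h s * ENNReal.ofReal (Φ s) ≤
    (∫⁻ x in Ioi (0 : ℝ), (∫⁻ s in Ioi x, h s) ^ conjExp k) ^ (1 / conjExp k)

lemma lintegral_mul_prim {k : ℕ} {v : ℝ → ℝ} (hv : Profile k v) {h : ℝ → ℝ≥0∞}
    (hh : Measurable h) : ∫⁻ s in Ioi (0 : ℝ), h s * ENNReal.ofReal (prim v s) =
      ∫⁻ x in Ioi (0 : ℝ), ENNReal.ofReal (v x) * ∫⁻ s in Ioi x, h s := by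
  have hvm : Measurable fun x => ENNReal.ofReal (v x) := hv.meas.ennreal_ofReal
  have h1 : ∀ s ∈ Ioi (0 : ℝ), h s * ENNReal.ofReal (prim v s) =
      ∫⁻ x in Ioi (0 : ℝ), (Iio s).indicator (fun x => h s * ENNReal.ofReal (v x)) x := by
    intro s hs
    have hs : 0 < s := hs
    rw [lintegral_indicator measurableSet_Iio, Measure.restrict_restrict measurableSet_Iio,
      lintegral_const_mul _ hvm, show Iio s ∩ Ioi 0 = Ioo 0 s by ext x; simp [and_comm],
      setLIntegral_congr Ioo_ae_eq_Ioc]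
    congr 1
    rw [prim, intervalIntegral.integral_of_le hs.le,
      ofReal_integral_eq_lintegral_ofReal (hv.integrableOn le_rfl)
        (Eventually.of_forall hv.nonneg)]
  rw [setLIntegral_congr_fun measurableSet_Ioi h1, lintegral_lintegral_swap]
  · refine setLIntegral_congr_fun measurableSet_Ioi fun x hx => ?_
    have hx : 0 < x := hx
    have h2 : ∀ s, (Iio s).indicator (fun x => h s * ENNReal.ofReal (v x)) x =
        (Ioi x).indicator (fun s => h s * ENNReal.ofReal (v x)) s := by
      intro s; simp [indicator_apply]
    simp only [h2]
    rw [lintegral_indicator measurableSet_Ioi, Measure.restrict_restrict measurableSet_Ioi,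
      Ioi_inter_Ioi, max_eq_left hx.le, lintegral_mul_const _ hh, mul_comm]
  · refine Measurable.aemeasurable ?_
    have h3 : (Function.uncurry fun s x =>
        (Iio s).indicator (fun x => h s * ENNReal.ofReal (v x)) x) =
        {p : ℝ × ℝ | p.2 < p.1}.indicator fun p => h p.1 * ENNReal.ofReal (v p.2) := by
      ext p; simp [indicator_apply, Function.uncurry]
    rw [h3]
    exact ((hh.comp measurable_fst).mul (hvm.comp measurable_snd)).indicator
      (measurableSet_lt measurable_snd measurable_fst)

lemma Profile.lintegral_energy_le {k : ℕ} {v : ℝ → ℝ} (hv : Profile k v) :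
    ∫⁻ s in Ioi (0 : ℝ), ENNReal.ofReal (v s) ^ ((k : ℝ) + 1) ≤ 1 := by
  have h : ∀ s, ENNReal.ofReal (v s) ^ ((k : ℝ) + 1) = ENNReal.ofReal (v s ^ (k + 1)) := fun s => by
    rw [ENNReal.ofReal_pow (hv.nonneg s), ← ENNReal.rpow_natCast]; push_cast; rfl
  simp only [h]
  rw [← ofReal_integral_eq_lintegral_ofReal hv.integrable
    (Eventually.of_forall fun s => pow_nonneg (hv.nonneg s) _)]
  exact ENNReal.ofReal_le_one.2 hv.energy_le

lemma holderConjugate_conjExp {k : ℕ} (hk : 0 < k) :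
    ((k : ℝ) + 1).HolderConjugate (conjExp k) := by
  have hk' : (0 : ℝ) < k := by exact_mod_cast hk
  rw [Real.holderConjugate_iff]
  refine ⟨by linarith, ?_⟩
  unfold conjExp; field_simp; ring

lemma measurable_tail (h : ℝ → ℝ≥0∞) : Measurable fun x : ℝ => ∫⁻ s in Ioi x, h s := by
  have : Antitone fun x : ℝ => ∫⁻ s in Ioi x, h s := fun x y hxy =>
    lintegral_mono_set (Ioi_subset_Ioi hxy)
  exact this.measurable

lemma Profile.dualBound {k : ℕ} (hk : 0 < k) {v : ℝ → ℝ} (hv : Profile k v) :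
    DualBound k (prim v) := by
  intro h hh
  rw [lintegral_mul_prim hv hh]
  have h1 := ENNReal.lintegral_mul_le_Lp_mul_Lq (volume.restrict (Ioi (0 : ℝ)))
    (holderConjugate_conjExp hk) (f := fun x => ENNReal.ofReal (v x))
    (g := fun x => ∫⁻ s in Ioi x, h s) hv.meas.ennreal_ofReal.aemeasurable
    (measurable_tail h).aemeasurable
  refine h1.trans ?_
  have h2 : (∫⁻ s in Ioi (0 : ℝ), ENNReal.ofReal (v s) ^ ((k : ℝ) + 1)) ^ (1 / ((k : ℝ) + 1)) ≤ 1 :=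
    (ENNReal.rpow_le_rpow hv.lintegral_energy_le (by positivity)).trans (by simp)
  exact (mul_le_mul_left h2 _).trans (one_mul _).le

/-- Curves to which the improvement step `exists_improved_profile` applies. -/
structure TestInput (k : ℕ) (Φ : ℝ → ℝ) : Prop where
  cont : ContinuousOn Φ (Ioi 0)
  nonneg : ∀ s, 0 < s → 0 ≤ Φ s
  dual : DualBound k Φ
  rpow_le : ∀ s, 0 < s → Φ s ^ conjExp k ≤ s
  growth : ∃ a C : ℝ, a < 1 ∧ ∀ s, 0 < s → Φ s ^ conjExp k ≤ a * s + C
  pos : ∃ s, 0 < s ∧ 0 < Φ s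

/-- The first variation of the functional at `Φ`. -/
noncomputable def density (k : ℕ) (b μ : ℝ) (φ Φ : ℝ → ℝ) (s : ℝ) : ℝ :=
  dphase k b μ φ s (Φ s) * exp (phase k b μ φ s (Φ s) - s)

section density

variable {k : ℕ} {b μ : ℝ} {φ Φ : ℝ → ℝ}

lemma Weight.continuousOn_phase (W : Weight k b μ φ) (hΦ : ContinuousOn Φ (Ioi 0)) :
    ContinuousOn (fun s => phase k b μ φ s (Φ s)) (Ioi 0) := by
  have hq := conjExp_pos k
  refine continuousOn_const.mul ((continuousOn_const.mul hΦ).rpow (continuousOn_const.add W.cont)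
    fun s hs => Or.inr ?_)
  have := W.nonneg s hs
  linarith

lemma Weight.continuousOn_dphase (hk : 0 < k) (W : Weight k b μ φ)
    (hΦ : ContinuousOn Φ (Ioi 0)) :
    ContinuousOn (fun s => dphase k b μ φ s (Φ s)) (Ioi 0) := by
  refine continuousOn_const.mul ((continuousOn_const.add W.cont).mul
    ((continuousOn_const.mul hΦ).rpow (continuousOn_const.add W.cont) fun s hs => Or.inr ?_))
  have := W.nonneg s hs
  have : (0 : ℝ) < 1 / k := by positivity
  linarith

lemma Weight.continuousOn_density (hk : 0 < k) (W : Weight k b μ φ)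
    (hΦ : ContinuousOn Φ (Ioi 0)) : ContinuousOn (density k b μ φ Φ) (Ioi 0) :=
  (W.continuousOn_dphase hk hΦ).mul ((W.continuousOn_phase hΦ).sub continuousOn_id).rexp

lemma TestInput.density_nonneg (W : Weight k b μ φ) (hΦ : TestInput k Φ) {s : ℝ} (hs : 0 < s) :
    0 ≤ density k b μ φ Φ s :=
  mul_nonneg (W.dphase_nonneg hs (hΦ.nonneg s hs)) (exp_pos _).le

lemma TestInput.density_le (W : Weight k b μ φ) (hΦ : TestInput k Φ) :
    ∃ C κ : ℝ, 0 < C ∧ 0 < κ ∧ ∀ s, 0 < s → density k b μ φ Φ s ≤ C * exp (-κ * s) := by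
  obtain ⟨a, A, ha, hA⟩ := hΦ.growth
  obtain ⟨C₁, h1, hp⟩ := W.exists_phase_bound
  obtain ⟨C₂, h2, hd⟩ := W.exists_dphase_bound
  set κ := 1 - a with hκ
  have hκ0 : 0 < κ := by simp only [hκ]; linarith
  refine ⟨C₂ * (1 + 2 / κ) * exp (A + C₁), κ / 2, by positivity, by positivity, fun s hs => ?_⟩
  have hy := hΦ.nonneg s hs
  have e1 := hp s hs _ hy (hΦ.rpow_le s hs)
  have e2 := hd s hs _ hy (hΦ.rpow_le s hs)
  have e3 : 1 + s ≤ (1 + 2 / κ) * exp (κ / 2 * s) := by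
    have := add_one_le_exp (κ / 2 * s)
    calc 1 + s ≤ (1 + 2 / κ) * (κ / 2 * s + 1) := by
          have : (1 + 2 / κ) * (κ / 2 * s + 1) = 1 + s + κ / 2 * s + 2 / κ := by field_simp; ring
          rw [this]; have : 0 < κ / 2 * s + 2 / κ := by positivity
          linarith
      _ ≤ _ := by gcongr
  have e4 : exp (phase k b μ φ s (Φ s) - s) ≤ exp (A + C₁) * exp (-κ * s) := by
    rw [← exp_add]; apply exp_le_exp.2
    have := hA s hs
    simp only [hκ]; linarith
  have e5 : exp (-(κ / 2) * s) = exp (κ / 2 * s) * exp (-κ * s) := by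
    rw [← exp_add]; congr 1; ring
  unfold density
  calc _ ≤ C₂ * ((1 + 2 / κ) * exp (κ / 2 * s)) * (exp (A + C₁) * exp (-κ * s)) := by
        refine mul_le_mul (e2.trans ?_) e4 (exp_pos _).le (by positivity)
        gcongr
    _ = _ := by rw [e5]; ring

end density

section tail

variable {g : ℝ → ℝ} {C κ : ℝ}

lemma integrableOn_of_exp_bound (hc : ContinuousOn g (Ioi 0)) (h0 : ∀ s, 0 < s → 0 ≤ g s)
    (hκ : 0 < κ) (hb : ∀ s, 0 < s → g s ≤ C * exp (-κ * s)) : IntegrableOn g (Ioi 0) := by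
  refine ((exp_neg_integrableOn_Ioi 0 hκ).const_mul C).mono'
    (hc.aestronglyMeasurable measurableSet_Ioi) ?_
  refine (ae_restrict_iff' measurableSet_Ioi).2 (Eventually.of_forall fun s hs => ?_)
  rw [norm_of_nonneg (h0 s hs)]; exact hb s hs

lemma setIntegral_tail_le (hc : ContinuousOn g (Ioi 0)) (h0 : ∀ s, 0 < s → 0 ≤ g s)
    (hκ : 0 < κ) (hb : ∀ s, 0 < s → g s ≤ C * exp (-κ * s)) {x : ℝ} (hx : 0 ≤ x) :
    ∫ s in Ioi x, g s ≤ C / κ * exp (-κ * x) := by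
  have hi := integrableOn_of_exp_bound hc h0 hκ hb
  have h1 : ∫ s in Ioi x, g s ≤ ∫ s in Ioi x, C * exp (-κ * s) :=
    setIntegral_mono_on (hi.mono_set (Ioi_subset_Ioi hx))
      ((exp_neg_integrableOn_Ioi x hκ).const_mul C) measurableSet_Ioi
      fun s hs => hb s (lt_of_le_of_lt hx hs)
  refine h1.trans (le_of_eq ?_)
  rw [integral_const_mul, integral_exp_mul_Ioi (by linarith) x]
  field_simp

end tail

/-- Improvement step: one iteration of the Euler–Lagrange map does not decrease the
functional, by convexity of the integrand and duality. -/
theorem exists_improved_profile {k : ℕ} (hk : 0 < k) {b μ : ℝ} {φ Φ : ℝ → ℝ}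
    (W : Weight k b μ φ) (hΦ : TestInput k Φ) :
    ∃ v c, 0 < c ∧ Profile k v ∧ Continuous v ∧ IntegrableOn v (Ioi 0) ∧
      ∫ s in Ioi (0 : ℝ), v s ^ (k + 1) = 1 ∧
      logFunctional k b μ φ Φ ≤ logFunctional k b μ φ (prim v) ∧ 0 < v 0 ∧
      ∀ x, 0 ≤ x → v x = (c * ∫ s in Ioi x, density k b μ φ Φ s) ^ (1 / (k : ℝ)) := by
  have hk' : (0 : ℝ) < k := by exact_mod_cast hk
  have hq := conjExp_pos k
  set g := density k b μ φ Φ with hg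
  have hgc : ContinuousOn g (Ioi 0) := W.continuousOn_density hk hΦ.cont
  have hg0 : ∀ s, 0 < s → 0 ≤ g s := fun s hs => hΦ.density_nonneg W hs
  obtain ⟨C, κ, hC, hκ, hgb⟩ := hΦ.density_le W
  have hgi : IntegrableOn g (Ioi 0) := integrableOn_of_exp_bound hgc hg0 hκ hgb
  set g₀ := (Ioi (0 : ℝ)).indicator g with hg₀
  have hg₀0 : ∀ s, 0 ≤ g₀ s := indicator_nonneg hg0
  have hg₀m : Measurable g₀ := by
    rw [hg₀, ← piecewise_eq_indicator]
    exact hgc.measurable_piecewise continuousOn_const measurableSet_Ioi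
  have hg₀i : Integrable g₀ := hgi.integrable_indicator measurableSet_Ioi
  have hg₀e : ∀ x, 0 ≤ x → ∫ s in Ioi x, g₀ s = ∫ s in Ioi x, g s := fun x hx =>
    setIntegral_congr_fun measurableSet_Ioi fun s hs => by
      have : s ∈ Ioi (0 : ℝ) := lt_of_le_of_lt hx hs
      simp [hg₀, indicator_of_mem this]
  set G : ℝ → ℝ := fun x => ∫ s in Ioi x, g₀ s with hG
  have hG0 : ∀ x, 0 ≤ G x := fun x => integral_nonneg hg₀0
  have hGc : Continuous G := by
    have h1 : G = fun x => G 0 - ∫ s in (0 : ℝ)..x, g₀ s := by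
      ext x
      have := intervalIntegral.integral_interval_add_Ioi (a := 0) (b := x) hg₀i.integrableOn
        hg₀i.integrableOn
      simp only [hG]; linarith
    rw [h1]
    exact continuous_const.sub (intervalIntegral.continuous_primitive
      (fun a b => hg₀i.intervalIntegrable) 0)
  have hGb : ∀ x, 0 ≤ x → G x ≤ C / κ * exp (-κ * x) := fun x hx => by
    rw [hG]; simp only; rw [hg₀e x hx]; exact setIntegral_tail_le hgc hg0 hκ hgb hx
  have hGpos : 0 < G 0 := by
    obtain ⟨s₀, hs₀, hp⟩ := hΦ.pos
    have hgs : 0 < g s₀ := mul_pos (W.dphase_pos hs₀ hp) (exp_pos _)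
    rw [hG]; simp only; rw [hg₀e 0 le_rfl]
    rw [setIntegral_pos_iff_support_of_nonneg_ae
      ((ae_restrict_iff' measurableSet_Ioi).2 (Eventually.of_forall hg0)) hgi]
    have h1 : ∀ᶠ s in nhds s₀, s ∈ Function.support g ∩ Ioi 0 := by
      have h2 := hgc.continuousAt (Ioi_mem_nhds hs₀)
      filter_upwards [h2.eventually_ne hgs.ne', Ioi_mem_nhds hs₀] with s h3 h4
      exact ⟨h3, h4⟩
    exact Measure.measure_pos_of_mem_nhds _ h1
  have hGqc : Continuous fun x => G x ^ conjExp k := hGc.rpow_const fun _ => Or.inr hq.le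
  have hdecay : ∀ p : ℝ, 0 < p → IntegrableOn (fun x => G x ^ p) (Ioi 0) := by
    intro p hp
    refine integrableOn_of_exp_bound (C := (C / κ) ^ p) (κ := κ * p)
      (hGc.rpow_const fun _ => Or.inr hp.le).continuousOn
      (fun s _ => rpow_nonneg (hG0 s) _) (by positivity) fun s hs => ?_
    refine (rpow_le_rpow (hG0 s) (hGb s hs.le) hp.le).trans (le_of_eq ?_)
    rw [mul_rpow (by positivity) (exp_pos _).le, ← exp_mul]
    congr 2; ring
  set I := ∫ x in Ioi (0 : ℝ), G x ^ conjExp k with hI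
  have hI0 : 0 < I := by
    rw [hI, setIntegral_pos_iff_support_of_nonneg_ae
      (Eventually.of_forall fun x => rpow_nonneg (hG0 x) _) (hdecay _ hq)]
    obtain ⟨r, hr, hball⟩ := Metric.eventually_nhds_iff.1
      (hGc.continuousAt.eventually_const_lt hGpos)
    refine lt_of_lt_of_le (b := volume (Ioo 0 r)) (by simp [hr])
      (measure_mono fun x hx => ⟨?_, hx.1⟩)
    have := hball (y := x) (by rw [dist_zero_right, norm_of_nonneg hx.1.le]; exact hx.2)
    exact (rpow_pos_of_pos this _).ne'
  set c := I ^ (-(1 / conjExp k)) with hc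
  have hc0 : 0 < c := rpow_pos_of_pos hI0 _
  set v : ℝ → ℝ := fun x => (c * G x) ^ (1 / (k : ℝ)) with hv
  have hvc : Continuous v := (continuous_const.mul hGc).rpow_const fun _ => Or.inr (by positivity)
  have hv0 : ∀ x, 0 ≤ v x := fun x => rpow_nonneg (mul_nonneg hc0.le (hG0 x)) _
  have hvp : ∀ x, v x ^ (k + 1) = I⁻¹ * G x ^ conjExp k := fun x => by
    simp only [hv]
    rw [rpow_inv_pow_succ hk (mul_nonneg hc0.le (hG0 x)), mul_rpow hc0.le (hG0 x), hc,
      ← rpow_mul hI0.le, neg_mul, one_div_mul_cancel hq.ne', rpow_neg_one]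
  have hvE : ∫ s in Ioi (0 : ℝ), v s ^ (k + 1) = 1 := by
    simp only [hvp]; rw [integral_const_mul]; exact inv_mul_cancel₀ hI0.ne'
  have hvprof : Profile k v := by
    refine ⟨hvc.measurable, hv0, ?_, hvE.le⟩
    simp only [hvp]; exact (hdecay _ hq).const_mul _
  have hvi : IntegrableOn v (Ioi 0) := by
    have : v = fun x => c ^ (1 / (k : ℝ)) * G x ^ (1 / (k : ℝ)) := by
      ext x; simp only [hv]; rw [mul_rpow hc0.le (hG0 x)]
    rw [this]; exact (hdecay _ (by positivity)).const_mul _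
  refine ⟨v, c, hc0, hvprof, hvc, hvi, hvE, ?_, rpow_pos_of_pos (mul_pos hc0 hGpos) _,
    fun x hx => by simp only [hv, hG]; rw [hg₀e x hx]⟩
  -- duality
  set hE : ℝ → ℝ≥0∞ := fun s => ENNReal.ofReal (g₀ s) with hhE
  have hEm : Measurable hE := hg₀m.ennreal_ofReal
  have htail : ∀ x, ∫⁻ s in Ioi x, hE s = ENNReal.ofReal (G x) := fun x => by
    rw [hhE, hG, ofReal_integral_eq_lintegral_ofReal hg₀i.integrableOn
      (Eventually.of_forall hg₀0)]
  have hIq : (∫⁻ x in Ioi (0 : ℝ), (∫⁻ s in Ioi x, hE s) ^ conjExp k) = ENNReal.ofReal I := by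
    simp only [htail]
    rw [hI, ofReal_integral_eq_lintegral_ofReal (hdecay _ hq)
      (Eventually.of_forall fun x => rpow_nonneg (hG0 x) _)]
    simp only [ENNReal.ofReal_rpow_of_nonneg (hG0 _) hq.le]
  have hdual := hΦ.dual hE hEm
  rw [hIq, ENNReal.ofReal_rpow_of_pos hI0] at hdual
  have hpair : ∫⁻ s in Ioi (0 : ℝ), hE s * ENNReal.ofReal (prim v s) =
      ENNReal.ofReal (I ^ (1 / conjExp k)) := by
    rw [lintegral_mul_prim hvprof hEm]
    simp only [htail]
    have h1 : ∀ x, ENNReal.ofReal (v x) * ENNReal.ofReal (G x) =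
        ENNReal.ofReal (c⁻¹ * v x ^ (k + 1)) := fun x => by
      rw [← ENNReal.ofReal_mul (hv0 x)]
      congr 1
      have h2 : v x ^ k = c * G x := rpow_inv_pow hk (mul_nonneg hc0.le (hG0 x))
      rw [pow_succ, h2]; field_simp
    simp only [h1]
    rw [← ofReal_integral_eq_lintegral_ofReal (hvprof.integrable.const_mul _)
      (Eventually.of_forall fun x => mul_nonneg (inv_nonneg.2 hc0.le) (pow_nonneg (hv0 x) _)),
      integral_const_mul, hvE, mul_one, hc, rpow_neg hI0.le, inv_inv]
  have hprimc : ContinuousOn (prim v) (Ioi 0) :=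
    (intervalIntegral.continuous_primitive (fun a b => hvc.intervalIntegrable a b) 0).continuousOn
  have hm1 : AEMeasurable (fun s => ENNReal.ofReal (exp (phase k b μ φ s (Φ s) - s)))
      (volume.restrict (Ioi 0)) :=
    ((((W.continuousOn_phase hΦ.cont).sub continuousOn_id).rexp).aemeasurable
      measurableSet_Ioi).ennreal_ofReal
  have hm2 : AEMeasurable (fun s => ENNReal.ofReal (exp (phase k b μ φ s (prim v s) - s)))
      (volume.restrict (Ioi 0)) :=
    ((((W.continuousOn_phase hprimc).sub continuousOn_id).rexp).aemeasurable
      measurableSet_Ioi).ennreal_ofReal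
  have hkey : logFunctional k b μ φ Φ + (∫⁻ s in Ioi (0 : ℝ), hE s * ENNReal.ofReal (prim v s)) ≤
      logFunctional k b μ φ (prim v) + ∫⁻ s in Ioi (0 : ℝ), hE s * ENNReal.ofReal (Φ s) := by
    unfold logFunctional
    rw [← lintegral_add_left' hm1, ← lintegral_add_left' hm2]
    refine setLIntegral_mono' measurableSet_Ioi fun s hs => ?_
    have hs0 : 0 < s := hs
    have hgs : g₀ s = g s := indicator_of_mem hs g
    have hz := hvprof.prim_nonneg hs0.le
    have hy := hΦ.nonneg s hs
    simp only [hhE, hgs]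
    rw [← ENNReal.ofReal_mul (hg0 s hs), ← ENNReal.ofReal_mul (hg0 s hs),
      ← ENNReal.ofReal_add (exp_pos _).le (mul_nonneg (hg0 s hs) hz),
      ← ENNReal.ofReal_add (exp_pos _).le (mul_nonneg (hg0 s hs) hy)]
    exact ENNReal.ofReal_le_ofReal (W.exp_phase_tangent hk hs0 hy hz)
  rw [hpair] at hkey
  exact (ENNReal.add_le_add_iff_right ENNReal.ofReal_ne_top).1
    (hkey.trans (add_le_add le_rfl hdual))

/-- A nontrivial integrable profile is an admissible input. -/
lemma Profile.testInput {k : ℕ} (hk : 0 < k) {v : ℝ → ℝ} (hv : Profile k v)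
    (hi : IntegrableOn v (Ioi 0)) (hpos : ∃ s, 0 < s ∧ 0 < prim v s) : TestInput k (prim v) where
  cont := by
    have h := intervalIntegral.continuous_primitive (f := (Ioi (0 : ℝ)).indicator v)
      (fun a b => (hi.integrable_indicator measurableSet_Ioi).intervalIntegrable) 0
    refine h.continuousOn.congr fun s hs => ?_
    simp only [prim]
    rw [intervalIntegral.integral_of_le (le_of_lt hs),
      intervalIntegral.integral_of_le (le_of_lt hs)]
    exact setIntegral_congr_fun measurableSet_Ioc fun x hx =>
      (indicator_of_mem (show x ∈ Ioi 0 from hx.1) v).symm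
  nonneg s hs := hv.prim_nonneg hs.le
  dual := hv.dualBound hk
  rpow_le s hs := hv.prim_rpow_le hk hs.le
  growth := by
    refine ⟨0, (∫ x in Ioi (0 : ℝ), v x) ^ conjExp k, one_pos, fun s hs => ?_⟩
    rw [zero_mul, zero_add]
    refine rpow_le_rpow (hv.prim_nonneg hs.le) ?_ (conjExp_pos k).le
    rw [prim, intervalIntegral.integral_of_le hs.le]
    exact setIntegral_mono_set hi (Eventually.of_forall hv.nonneg)
      (Eventually.of_forall fun x hx => hx.1)
  pos := hpos

/-- Denominator of the optimal tail. -/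
noncomputable def tailX (k : ℕ) (K A s : ℝ) : ℝ := 1 + K * exp (-(s - A) / k)

/-- Concentrating test profile: constant slope up to `A`, then the optimal tail. -/
noncomputable def testProfile (k : ℕ) (m K A : ℝ) (s : ℝ) : ℝ :=
  if s ≤ A then m else m * (1 - 1 / tailX k K A s)

section testProfile

variable {k : ℕ} {m K A : ℝ}

lemma one_le_tailX (hK : 0 ≤ K) (s : ℝ) : 1 ≤ tailX k K A s := by
  unfold tailX; have : 0 ≤ K * exp (-(s - A) / k) := by positivity
  linarith

lemma hasDerivAt_tailX (k : ℕ) (K A s : ℝ) :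
    HasDerivAt (tailX k K A) (-(tailX k K A s - 1) / k) s := by
  unfold tailX
  have h := ((((hasDerivAt_id s).sub_const A).neg.div_const (k : ℝ)).exp.const_mul K).const_add 1
  refine h.congr_deriv ?_
  simp; ring

lemma tendsto_tailX (hk : 0 < k) (K A : ℝ) : Tendsto (tailX k K A) atTop (nhds 1) := by
  have hk' : (0 : ℝ) < k := by exact_mod_cast hk
  have h : Tendsto (fun s : ℝ => -(s - A) / k) atTop atBot := by
    have : (fun s : ℝ => -(s - A) / k) = fun s => -((s + -A) / k) := by ext s; ring
    rw [this]
    exact tendsto_neg_atTop_atBot.comp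
      ((tendsto_atTop_add_const_right _ (-A) tendsto_id).atTop_div_const hk')
  have := ((tendsto_exp_atBot.comp h).const_mul K).const_add 1
  unfold tailX; simpa using this

lemma tail_factor_nonneg (hK : 0 ≤ K) (s : ℝ) : 0 ≤ 1 - 1 / tailX k K A s := by
  have h := one_le_tailX (k := k) (A := A) hK s
  rw [sub_nonneg, div_le_one (by linarith)]; exact h

lemma testProfile_nonneg (hm : 0 ≤ m) (hK : 0 ≤ K) (s : ℝ) : 0 ≤ testProfile k m K A s := by
  unfold testProfile; split_ifs
  · exact hm
  · exact mul_nonneg hm (tail_factor_nonneg hK s)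

lemma testProfile_of_le {s : ℝ} (hs : s ≤ A) : testProfile k m K A s = m := if_pos hs

lemma testProfile_of_lt {s : ℝ} (hs : A < s) :
    testProfile k m K A s = m * (1 - 1 / tailX k K A s) := if_neg (not_le.2 hs)

lemma continuous_tailX : Continuous (tailX k K A) := by unfold tailX; fun_prop

lemma measurable_testProfile : Measurable (testProfile k m K A) := by
  unfold testProfile
  refine Measurable.ite measurableSet_Iic measurable_const (measurable_const.mul
    (measurable_const.sub (measurable_const.div continuous_tailX.measurable)))

/-- The tail of the energy of the test profile. -/
lemma testProfile_tail_energy (hk : 0 < k) (hm : 0 ≤ m) (hK : 0 ≤ K) :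
    IntegrableOn (fun s => testProfile k m K A s ^ (k + 1)) (Ioi A) ∧
    ∫ s in Ioi A, testProfile k m K A s ^ (k + 1) = m ^ (k + 1) * (k * peakValue k (1 + K)) := by
  have hk' : (0 : ℝ) < k := by exact_mod_cast hk
  have hd : ∀ s ∈ Ici A, HasDerivAt (fun s => m ^ (k + 1) * (-(k * peakValue k (tailX k K A s))))
      ((m * (1 - 1 / tailX k K A s)) ^ (k + 1)) s := by
    intro s _
    have hX : 0 < tailX k K A s := by linarith [one_le_tailX (k := k) (A := A) hK s]
    have h := ((((hasDerivAt_peakValue k hX).comp s (hasDerivAt_tailX k K A s)).const_mul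
      (k : ℝ)).neg).const_mul (m ^ (k + 1))
    refine h.congr_deriv ?_
    rw [mul_pow, pow_succ (1 - 1 / tailX k K A s)]
    field_simp
  have hn : ∀ s ∈ Ioi A, 0 ≤ (m * (1 - 1 / tailX k K A s)) ^ (k + 1) := fun s _ =>
    pow_nonneg (mul_nonneg hm (tail_factor_nonneg hK s)) _
  have h1 : peakValue k 1 = 0 := by simp [peakValue, logPartial]
  have hl : Tendsto (fun s => m ^ (k + 1) * (-(k * peakValue k (tailX k K A s)))) atTop
      (nhds 0) := by
    have h := (((hasDerivAt_peakValue k one_pos).continuousAt.tendsto.comp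
      (tendsto_tailX hk K A)).const_mul (k : ℝ)).neg.const_mul (m ^ (k + 1))
    simpa [h1] using h
  have he : ∀ s ∈ Ioi A, (m * (1 - 1 / tailX k K A s)) ^ (k + 1) =
      testProfile k m K A s ^ (k + 1) := fun s hs => by rw [testProfile_of_lt hs]
  refine ⟨(integrableOn_Ioi_deriv_of_nonneg' hd hn hl).congr_fun he measurableSet_Ioi, ?_⟩
  rw [← setIntegral_congr_fun measurableSet_Ioi he, integral_Ioi_of_hasDerivAt_of_nonneg' hd hn hl]
  simp [tailX]

lemma hasDerivAt_log_tailX (hk : 0 < k) (hK : 0 ≤ K) (s : ℝ) :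
    HasDerivAt (fun s => m * (-(k * log (tailX k K A s)))) (m * (1 - 1 / tailX k K A s)) s := by
  have hk' : (0 : ℝ) < k := by exact_mod_cast hk
  have hX : 0 < tailX k K A s := by linarith [one_le_tailX (k := k) (A := A) hK s]
  have h := (((hasDerivAt_tailX k K A s).log hX.ne').const_mul (k : ℝ)).neg.const_mul m
  refine h.congr_deriv ?_
  field_simp

lemma testProfile_integrableOn (hk : 0 < k) (hm : 0 ≤ m) (hK : 0 ≤ K) (hA : 0 ≤ A) :
    IntegrableOn (testProfile k m K A) (Ioi 0) := by
  rw [← Ioc_union_Ioi_eq_Ioi hA]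
  refine IntegrableOn.union ?_ ?_
  · exact (integrableOn_const (C := m) (by simp)).congr_fun
      (fun s hs => (testProfile_of_le hs.2).symm) measurableSet_Ioc
  · have hl : Tendsto (fun s => m * (-(k * log (tailX k K A s)))) atTop
      (nhds 0) := by
      have h := (((tendsto_tailX hk K A).log one_ne_zero).const_mul (k : ℝ)).neg.const_mul m
      simpa using h
    exact (integrableOn_Ioi_deriv_of_nonneg' (fun s _ => hasDerivAt_log_tailX hk hK s)
      (fun s _ => mul_nonneg hm (tail_factor_nonneg hK s)) hl).congr_fun
      (fun s hs => (testProfile_of_lt hs).symm) measurableSet_Ioi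

lemma testProfile_profile (hk : 0 < k) (hm : 0 ≤ m) (hK : 0 ≤ K) (hA : 0 ≤ A)
    (h : m ^ (k + 1) * (A + k * peakValue k (1 + K)) ≤ 1) :
    Profile k (testProfile k m K A) := by
  obtain ⟨h1, h2⟩ := testProfile_tail_energy (A := A) hk hm hK
  have h3 : IntegrableOn (fun s => testProfile k m K A s ^ (k + 1)) (Ioc 0 A) :=
    (integrableOn_const (C := m ^ (k + 1)) (by simp)).congr_fun
      (fun s hs => by rw [testProfile_of_le hs.2]) measurableSet_Ioc
  have h4 : ∫ s in Ioc 0 A, testProfile k m K A s ^ (k + 1) = A * m ^ (k + 1) := by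
    rw [setIntegral_congr_fun (g := fun _ => m ^ (k + 1)) measurableSet_Ioc
      fun s hs => by simp only [testProfile_of_le hs.2]]
    simp [hA]
  refine ⟨measurable_testProfile, testProfile_nonneg hm hK, ?_, ?_⟩
  · rw [← Ioc_union_Ioi_eq_Ioi hA]; exact h3.union h1
  · rw [← Ioc_union_Ioi_eq_Ioi hA, setIntegral_union (by
      rw [disjoint_left]; exact fun s hs hs' => not_lt.2 hs.2 hs') measurableSet_Ioi h3 h1, h4, h2]
    linarith

lemma prim_testProfile_of_le {s : ℝ} (hs0 : 0 ≤ s) (hs : s ≤ A) :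
    prim (testProfile k m K A) s = m * s := by
  rw [prim, intervalIntegral.integral_of_le hs0,
    setIntegral_congr_fun (g := fun _ => m) measurableSet_Ioc
      fun x hx => testProfile_of_le (hx.2.trans hs)]
  simp [hs0, mul_comm]

lemma prim_testProfile_of_ge (hk : 0 < k) (hm : 0 ≤ m) (hK : 0 ≤ K) (hA : 0 ≤ A) {s : ℝ}
    (hs : A ≤ s) : prim (testProfile k m K A) s =
      m * (A + k * log ((1 + K) / tailX k K A s)) := by
  have hi := testProfile_integrableOn (A := A) hk hm hK hA
  have hX : 0 < tailX k K A s := by linarith [one_le_tailX (k := k) (A := A) hK s]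
  have hii : ∀ a b : ℝ, 0 ≤ a → a ≤ b → IntervalIntegrable (testProfile k m K A) volume a b :=
    fun a b ha hab => (intervalIntegrable_iff_integrableOn_Ioc_of_le hab).2
      (hi.mono_set fun x hx => lt_of_le_of_lt ha hx.1)
  have h1 : prim (testProfile k m K A) s = prim (testProfile k m K A) A +
      ∫ x in A..s, testProfile k m K A x :=
    (intervalIntegral.integral_add_adjacent_intervals (hii 0 A le_rfl hA) (hii A s hA hs)).symm
  have h2 : ∫ x in A..s, testProfile k m K A x = ∫ x in A..s, m * (1 - 1 / tailX k K A x) :=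
    intervalIntegral.integral_congr_ae (Eventually.of_forall fun x hx => by
      rw [uIoc_of_le hs] at hx; exact testProfile_of_lt hx.1)
  rw [h1, h2, prim_testProfile_of_le hA le_rfl, intervalIntegral.integral_eq_sub_of_hasDerivAt
    (fun x _ => hasDerivAt_log_tailX hk hK x), log_div (by linarith) hX.ne']
  · simp [tailX]; ring
  · refine Continuous.intervalIntegrable ?_ _ _
    refine continuous_const.mul (continuous_const.sub (continuous_const.div continuous_tailX
      fun x => ?_))
    linarith [one_le_tailX (k := k) (A := A) hK x]

lemma integral_tail_exp (hk : 0 < k) (hK : 0 ≤ K) :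
    IntegrableOn (fun s => ((1 + K) / tailX k K A s) ^ (k + 1) * exp (-(s - A))) (Ioi A) ∧
    ∫ s in Ioi A, ((1 + K) / tailX k K A s) ^ (k + 1) * exp (-(s - A)) = 1 + K := by
  have hk' : (0 : ℝ) < k := by exact_mod_cast hk
  have hX : ∀ s, 0 < tailX k K A s := fun s => by
    linarith [one_le_tailX (k := k) (A := A) hK s]
  have hd : ∀ s ∈ Ici A, HasDerivAt
      (fun s => -((1 + K) ^ (k + 1) * ((tailX k K A s ^ k)⁻¹ * exp (-(s - A)))))
      (((1 + K) / tailX k K A s) ^ (k + 1) * exp (-(s - A))) s := by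
    intro s _
    have h1 := ((hasDerivAt_tailX k K A s).fun_pow k).fun_inv (pow_pos (hX s) k).ne'
    have h2 := (((hasDerivAt_id s).sub_const A).neg).exp
    have h := (((h1.mul h2)).const_mul ((1 + K) ^ (k + 1))).neg
    refine h.congr_deriv ?_
    obtain ⟨n, rfl⟩ : ∃ n, k = n + 1 := ⟨k - 1, by omega⟩
    have := hX s
    simp only [Nat.add_sub_cancel]
    push_cast at *
    rw [div_pow]
    simp only [id, Pi.neg_apply]
    field_simp
    ring
  have hn : ∀ s ∈ Ioi A, 0 ≤ ((1 + K) / tailX k K A s) ^ (k + 1) * exp (-(s - A)) := fun s _ => by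
    have := hX s
    positivity
  have hl : Tendsto (fun s => -((1 + K) ^ (k + 1) * ((tailX k K A s ^ k)⁻¹ * exp (-(s - A)))))
      atTop (nhds 0) := by
    have h1 : Tendsto (fun s : ℝ => exp (-(s - A))) atTop (nhds 0) :=
      tendsto_exp_neg_atTop_nhds_zero.comp (tendsto_atTop_add_const_right _ (-A) tendsto_id)
    have h2 := ((((tendsto_tailX hk K A).pow k).inv₀ (by simp)).mul h1).const_mul
      ((1 + K) ^ (k + 1)) |>.neg
    simpa using h2
  refine ⟨integrableOn_Ioi_deriv_of_nonneg' hd hn hl, ?_⟩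
  rw [integral_Ioi_of_hasDerivAt_of_nonneg' hd hn hl]
  have : 0 < 1 + K := by linarith
  simp [tailX]
  field_simp
  ring

end testProfile

lemma harm_sub_logPartial_le (k : ℕ) {θ : ℝ} (h0 : 0 ≤ θ) :
    harm k - k * (1 - θ) ≤ logPartial k θ := by
  unfold harm logPartial
  have h : ∀ j ∈ Finset.range k, 1 / ((j : ℝ) + 1) - (1 - θ) ≤ θ ^ (j + 1) / (j + 1) := by
    intro j _
    have h1 := one_add_mul_le_pow (a := θ - 1) (by linarith) (j + 1)
    rw [show 1 + (θ - 1) = θ by ring] at h1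
    rw [le_div_iff₀ (by positivity)]
    push_cast at h1
    field_simp
    linarith
  have := Finset.sum_le_sum h
  rw [Finset.sum_sub_distrib, Finset.sum_const, Finset.card_range, nsmul_eq_mul] at this
  exact this

set_option maxHeartbeats 1000000 in
/-- The concentration level is strictly exceeded by some profile. -/
theorem exists_profile_gt_level {k : ℕ} (hk : 0 < k) {b μ : ℝ} {φ : ℝ → ℝ}
    (W : Weight k b μ φ) :
    ∃ v, Profile k v ∧ IntegrableOn v (Ioi 0) ∧ (∃ s, 0 < s ∧ 0 < prim v s) ∧
      ENNReal.ofReal (1 + exp (harm k)) < logFunctional k b μ φ (prim v) := by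
  have hk' : (0 : ℝ) < k := by exact_mod_cast hk
  have hk1 : (1 : ℝ) ≤ k := by exact_mod_cast hk
  have hb := W.b_pos
  have hμ := W.mu_pos
  have hq := conjExp_pos k
  obtain ⟨s₀, hs₀⟩ := ((W.lim.eventually_le_const (show (0 : ℝ) < 1 / 2 by norm_num)).and
    (eventually_ge_atTop 1)).exists_forall_of_atTop
  have hs₀1 : 1 ≤ s₀ := (hs₀ s₀ le_rfl).2
  set p : ℝ := k + 1 with hp
  have hp0 : 0 < p := by positivity
  set c₃ := μ * b ^ (conjExp k + 1 / 2) * exp (-(s₀ + 1)) with hc₃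
  have hc₃0 : 0 < c₃ := by positivity
  have e1 : ∀ᶠ η : ℝ in atTop, 2 * k * log η ≤ η / 2 := by
    have h := (tendsto_log_pow_div 1 (2 * k)).eventually_le_const
      (show (0 : ℝ) < 1 / 2 by norm_num)
    filter_upwards [h, eventually_gt_atTop 0] with η h1 h2
    rw [div_le_iff₀ h2] at h1
    rw [pow_one] at h1; linarith
  have e2 : ∀ᶠ η : ℝ in atTop, η ^ (-(1 / p)) * (b * (s₀ + 1)) ≤ 1 := by
    have h := ((tendsto_rpow_neg_atTop (show 0 < 1 / p by positivity)).mul_const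
      (b * (s₀ + 1)))
    rw [zero_mul] at h
    exact h.eventually_le_const one_pos
  have e3 : ∀ᶠ η : ℝ in atTop, 2 / b ≤ η ^ (1 - 1 / p) :=
    (tendsto_rpow_atTop (by
      rw [sub_pos, div_lt_one hp0]; simp only [hp]; linarith)).eventually_ge_atTop _
  have e4 : ∀ᶠ η : ℝ in atTop, η ^ (3 / 2 : ℝ) * exp (-(1 / 2) * η) +
      exp (harm k) * k * η ^ (-(1 / 2 : ℝ)) < c₃ := by
    have h := (tendsto_rpow_mul_exp_neg_mul_atTop_nhds_zero (3 / 2) (1 / 2) (by norm_num)).add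
      ((tendsto_rpow_neg_atTop (show (0 : ℝ) < 1 / 2 by norm_num)).const_mul (exp (harm k) * k))
    simp only [mul_zero, add_zero] at h
    exact h.eventually_lt_const hc₃0
  obtain ⟨η, ⟨⟨⟨⟨h1, h2⟩, h3⟩, h4⟩, hη⟩⟩ := ((((e1.and e2).and e3).and e4).and
    (eventually_ge_atTop (2 * (s₀ + 1)))).exists
  have hη0 : 0 < η := by linarith
  have hη1 : 1 ≤ η := by linarith
  set K := η ^ 2 - 1 with hK
  have hK0 : 0 ≤ K := by simp only [hK]; nlinarith
  have hX₀ : 1 + K = η ^ 2 := by simp only [hK]; ring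
  set θ₀ := 1 - 1 / η ^ 2 with hθ₀
  have hθ₀0 : 0 ≤ θ₀ := by
    rw [hθ₀, sub_nonneg, div_le_one (by positivity)]; nlinarith
  set Q := peakValue k (1 + K) with hQ
  have hQe : Q = 2 * log η - logPartial k θ₀ := by
    rw [hQ, hX₀, peakValue, log_pow]; push_cast; rfl
  have hQl : Q ≤ 2 * log η := by have := logPartial_nonneg k hθ₀0; linarith
  set A := η - k * Q with hA
  have hAη : η / 2 ≤ A := by
    have := mul_le_mul_of_nonneg_left hQl hk'.le
    simp only [hA]; linarith
  have hA0 : 0 < A := by linarith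
  have hAs : s₀ + 1 ≤ A := by linarith
  set m := η ^ (-(1 / p)) with hm
  have hm0 : 0 < m := rpow_pos_of_pos hη0 _
  have hmp : m ^ (k + 1) = η⁻¹ := by
    rw [hm, ← rpow_natCast, ← rpow_mul hη0.le]
    push_cast
    rw [neg_mul, one_div_mul_cancel hp0.ne', rpow_neg_one]
  have hmq : m ^ conjExp k * η ^ (1 / (k : ℝ)) = 1 := by
    have h0 : -(1 / p) * conjExp k + 1 / (k : ℝ) = 0 := by
      unfold conjExp; simp only [hp]; field_simp; ring
    rw [hm, ← rpow_mul hη0.le, ← rpow_add hη0, h0, rpow_zero]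
  have hv : Profile k (testProfile k m K A) := by
    refine testProfile_profile hk hm0.le hK0 hA0.le (le_of_eq ?_)
    rw [hmp, ← hQ, hA]; field_simp; ring
  refine ⟨testProfile k m K A, hv, testProfile_integrableOn hk hm0.le hK0 hA0.le,
    ⟨A, hA0, by rw [prim_testProfile_of_le hA0.le le_rfl]; positivity⟩, ?_⟩
  set Φ := prim (testProfile k m K A) with hΦ
  set F : ℝ → ℝ≥0∞ := fun s => ENNReal.ofReal (exp (phase k b μ φ s (Φ s) - s)) with hF
  -- the peak
  have hpeak : ENNReal.ofReal (exp (logPartial k θ₀)) ≤ ∫⁻ s in Ioi A, F s := by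
    obtain ⟨i1, i2⟩ := integral_tail_exp (A := A) hk hK0
    have h5 : exp (logPartial k θ₀) =
        ∫ s in Ioi A, exp (-Q) * (((1 + K) / tailX k K A s) ^ (k + 1) * exp (-(s - A))) := by
      rw [integral_const_mul, i2, hX₀, hQe, neg_sub, exp_sub, two_mul, exp_add, exp_log hη0]
      field_simp
    rw [h5, ofReal_integral_eq_lintegral_ofReal (i1.const_mul _) (Eventually.of_forall fun s => by
      have := one_le_tailX (k := k) (A := A) hK0 s
      have : 0 < tailX k K A s := by linarith
      positivity)]
    refine setLIntegral_mono' measurableSet_Ioi fun s hs => ENNReal.ofReal_le_ofReal ?_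
    have hsA : A < s := hs
    have hs0 : 0 < s := by linarith
    have hX1 := one_le_tailX (k := k) (A := A) hK0 s
    have hX : 0 < tailX k K A s := by linarith
    set l := log ((1 + K) / tailX k K A s) with hl
    have hΦs : Φ s = m * (A + k * l) := prim_testProfile_of_ge hk hm0.le hK0 hA0.le hsA.le
    have hΦ0 := hv.prim_nonneg hs0.le
    have hΦA : m * A ≤ Φ s := by
      have := hv.prim_mono hA0.le hsA.le
      rwa [prim_testProfile_of_le hA0.le le_rfl] at this
    have hbig : 1 ≤ b * Φ s := by
      have h6 : m * η = η ^ (1 - 1 / p) := by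
        rw [hm, mul_comm, ← rpow_one_add' hη0.le]
        · congr 1
        · have : 1 / p < 1 := by
            rw [div_lt_one hp0]; simp only [hp]; linarith
          linarith
      have h7 : 1 / b ≤ Φ s := by
        have : m * (η / 2) ≤ m * A := by gcongr
        have h8 : 2 / b = 2 * (1 / b) := by ring
        rw [← h6, h8] at h3
        linarith
      rw [div_le_iff₀ hb] at h7; linarith
    have ht0 : 0 ≤ A + k * l := by
      by_contra hneg
      have := mul_neg_of_pos_of_neg hm0 (not_le.1 hneg)
      rw [← hΦs] at this; linarith
    have hbern := one_add_mul_self_le_rpow_one_add (s := (A + k * l) / η - 1)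
      (by have := div_nonneg ht0 hη0.le; linarith) (one_le_conjExp k)
    rw [show 1 + ((A + k * l) / η - 1) = (A + k * l) / η by ring, div_rpow ht0 hη0.le] at hbern
    have hηq : η ^ conjExp k = η * η ^ (1 / (k : ℝ)) := by
      unfold conjExp; rw [rpow_add hη0, rpow_one]
    have hphase : Φ s ^ conjExp k ≥ η * (1 + conjExp k * ((A + k * l) / η - 1)) := by
      rw [hΦs, mul_rpow hm0.le ht0]
      have h9 := mul_le_mul_of_nonneg_left hbern
        (show 0 ≤ m ^ conjExp k * η ^ conjExp k by positivity)
      rw [mul_assoc _ _ (_ / _), mul_div_cancel₀ _ (rpow_pos_of_pos hη0 _).ne'] at h9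
      have h10 : m ^ conjExp k * η ^ conjExp k = η := by
        rw [hηq, mul_left_comm, hmq, mul_one]
      rw [h10] at h9; exact h9
    have hexp : η * (1 + conjExp k * ((A + k * l) / η - 1)) = A - Q + (k + 1) * l := by
      have : k * conjExp k = k + 1 := by unfold conjExp; field_simp
      calc η * (1 + conjExp k * ((A + k * l) / η - 1))
          = η + conjExp k * (A + k * l - η) := by field_simp
        _ = η + conjExp k * k * (l - Q) := by simp only [hA]; ring
        _ = η + (k + 1) * (l - Q) := by rw [mul_comm (conjExp k), this]
        _ = _ := by simp only [hA]; ring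
    have hlp : ((1 + K) / tailX k K A s) ^ (k + 1) = exp ((k + 1) * l) := by
      have : 0 < (1 + K) / tailX k K A s := by positivity
      rw [hl, mul_comm, exp_mul, exp_log this, ← rpow_natCast]; push_cast; rfl
    rw [hlp, ← exp_add, ← exp_add]
    have := W.phase_ge_of_large hs0 hΦ0 hbig
    apply exp_le_exp.2
    linarith
  -- the gain on a bounded interval
  have hlow : ∀ s, 0 < s → exp (-s) + phase k b μ φ s (Φ s) * exp (-s) ≤
      exp (phase k b μ φ s (Φ s) - s) := fun s hs => by
    rw [sub_eq_add_neg, exp_add]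
    have := add_one_le_exp (phase k b μ φ s (Φ s))
    nlinarith [exp_pos (-s)]
  set γ := μ * (b * m) ^ (conjExp k + 1 / 2) * exp (-(s₀ + 1)) with hγ
  have hγ0 : 0 ≤ γ := by positivity
  have hgain : ∀ s ∈ Ioc s₀ (s₀ + 1), γ ≤ phase k b μ φ s (Φ s) * exp (-s) := by
    intro s hs
    have hs0 : 0 < s := by linarith [hs.1]
    have hΦs : Φ s = m * s := prim_testProfile_of_le hs0.le (hs.2.trans hAs)
    have hbs : b * Φ s ≤ 1 := by
      rw [hΦs]
      calc b * (m * s) ≤ b * (m * (s₀ + 1)) := by gcongr; exact hs.2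
        _ = m * (b * (s₀ + 1)) := by ring
        _ ≤ 1 := h2
    have hbm : b * m ≤ b * Φ s := by
      rw [hΦs]; gcongr; nlinarith [hs.1]
    have hbm0 : 0 < b * m := by positivity
    unfold phase
    have h5 : (b * m) ^ (conjExp k + 1 / 2) ≤ (b * Φ s) ^ (conjExp k + φ s) :=
      (rpow_le_rpow hbm0.le hbm (by positivity)).trans
        (rpow_le_rpow_of_exponent_ge (by linarith) hbs (by linarith [(hs₀ s hs.1.le).1]))
    have h6 : exp (-(s₀ + 1)) ≤ exp (-s) := exp_le_exp.2 (by linarith [hs.2])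
    have h7 : 0 ≤ (b * Φ s) ^ (conjExp k + φ s) := rpow_nonneg (hbm0.le.trans hbm) _
    exact mul_le_mul (mul_le_mul_of_nonneg_left h5 hμ.le) h6 (exp_pos _).le
      (mul_nonneg hμ.le h7)
  have hhead : ENNReal.ofReal (1 - exp (-A) + γ) ≤ ∫⁻ s in Ioc 0 A, F s := by
    set G : ℝ → ℝ := fun s => exp (-s) + (Ioc s₀ (s₀ + 1)).indicator (fun _ => γ) s with hG
    have hi1 : IntegrableOn (fun s : ℝ => exp (-s)) (Ioc 0 A) := by
      have : Continuous fun s : ℝ => exp (-s) := by fun_prop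
      exact this.integrableOn_Ioc
    have hi2 : IntegrableOn ((Ioc s₀ (s₀ + 1)).indicator fun _ => γ) (Ioc 0 A) :=
      (integrableOn_const (by simp)).indicator measurableSet_Ioc
    have hGI : ∫ s in Ioc 0 A, G s = 1 - exp (-A) + γ := by
      have hsub : Ioc 0 A ∩ Ioc s₀ (s₀ + 1) = Ioc s₀ (s₀ + 1) :=
        inter_eq_right.2 fun s hs => ⟨by linarith [hs.1], hs.2.trans hAs⟩
      rw [hG, integral_add hi1 hi2, setIntegral_indicator measurableSet_Ioc, hsub,
        ← intervalIntegral.integral_of_le hA0.le]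
      simp
    have hGi : IntegrableOn G (Ioc 0 A) := hi1.add hi2
    have hGn : ∀ s, 0 ≤ G s := fun s => by
      have : 0 ≤ (Ioc s₀ (s₀ + 1)).indicator (fun _ => γ) s := indicator_nonneg (fun _ _ => hγ0) s
      exact add_nonneg (exp_pos _).le this
    rw [← hGI, ofReal_integral_eq_lintegral_ofReal hGi (Eventually.of_forall hGn)]
    refine setLIntegral_mono' measurableSet_Ioc fun s hs => ENNReal.ofReal_le_ofReal ?_
    refine le_trans ?_ (hlow s hs.1)
    simp only [hG]
    gcongr
    by_cases hmem : s ∈ Ioc s₀ (s₀ + 1)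
    · rw [indicator_of_mem hmem]; exact hgain s hmem
    · rw [indicator_of_notMem hmem]
      exact mul_nonneg (W.phase_nonneg (hv.prim_nonneg hs.1.le)) (exp_pos _).le
  have hsum : logFunctional k b μ φ Φ = (∫⁻ s in Ioc 0 A, F s) + ∫⁻ s in Ioi A, F s := by
    unfold logFunctional
    rw [← Ioc_union_Ioi_eq_Ioi hA0.le, lintegral_union measurableSet_Ioi]
    rw [disjoint_left]; exact fun s hs hs' => not_lt.2 hs.2 hs'
  have hhead0 : 0 ≤ 1 - exp (-A) + γ := by
    have : exp (-A) ≤ 1 := exp_le_one_iff.2 (by linarith)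
    linarith
  rw [hsum]
  refine lt_of_lt_of_le ?_ (add_le_add hhead hpeak)
  rw [← ENNReal.ofReal_add hhead0 (exp_pos _).le]
  refine (ENNReal.ofReal_lt_ofReal_iff (by positivity)).2 ?_
  -- comparing gain and losses
  have hloss1 : exp (harm k) - exp (harm k) * k * η ^ (-(2 : ℝ)) ≤ exp (logPartial k θ₀) := by
    have h5 := harm_sub_logPartial_le k hθ₀0
    have h6 : (k : ℝ) * (1 - θ₀) = k * η ^ (-(2 : ℝ)) := by
      rw [hθ₀, rpow_neg hη0.le]; norm_num
    rw [h6] at h5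
    have h7 : exp (harm k) * exp (-(k * η ^ (-(2 : ℝ)))) ≤ exp (logPartial k θ₀) := by
      rw [← exp_add]; exact exp_le_exp.2 (by linarith)
    have h8 := add_one_le_exp (-(k * η ^ (-(2 : ℝ))))
    have h9 := mul_le_mul_of_nonneg_left h8 (exp_pos (harm k)).le
    linarith
  have hloss2 : exp (-A) ≤ exp (-(1 / 2) * η) := exp_le_exp.2 (by linarith)
  have hγ' : c₃ * η ^ (-(3 / 2 : ℝ)) ≤ γ := by
    have h5 : η ^ (-(3 / 2 : ℝ)) ≤ m ^ (conjExp k + 1 / 2) := by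
      rw [hm, ← rpow_mul hη0.le]
      refine rpow_le_rpow_of_exponent_le hη1 ?_
      have h6 : 1 / p * (conjExp k + 1 / 2) ≤ 3 / 2 := by
        rw [div_mul_eq_mul_div, one_mul, div_le_iff₀ hp0]
        have : conjExp k ≤ 2 := by
          unfold conjExp
          have : 1 / (k : ℝ) ≤ 1 := by rw [div_le_one hk']; exact hk1
          linarith
        simp only [hp]; linarith
      linarith
    rw [hγ, mul_rpow hb.le hm0.le, hc₃]
    have h7 := mul_le_mul_of_nonneg_left h5 hc₃0.le
    rw [hc₃] at h7
    refine h7.trans (le_of_eq (by ring))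
  have hη3 : 0 < η ^ (-(3 / 2 : ℝ)) := rpow_pos_of_pos hη0 _
  have h5 := mul_lt_mul_of_pos_right h4 hη3
  have h6 : η ^ (3 / 2 : ℝ) * η ^ (-(3 / 2 : ℝ)) = 1 := by
    rw [← rpow_add hη0]; norm_num
  have h7 : η ^ (-(1 / 2 : ℝ)) * η ^ (-(3 / 2 : ℝ)) = η ^ (-(2 : ℝ)) := by
    rw [← rpow_add hη0]; norm_num
  have h8 : (η ^ (3 / 2 : ℝ) * exp (-(1 / 2) * η) + exp (harm k) * k * η ^ (-(1 / 2 : ℝ))) *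
      η ^ (-(3 / 2 : ℝ)) = exp (-(1 / 2) * η) + exp (harm k) * k * η ^ (-(2 : ℝ)) := by
    rw [← h7]
    linear_combination exp (-(1 / 2) * η) * h6
  rw [h8] at h5
  linarith

lemma Profile.abs_sub_pow_le {k : ℕ} {v : ℝ → ℝ} (hv : Profile k v) {a b : ℝ} (ha : 0 ≤ a)
    (hb : 0 ≤ b) : |prim v a - prim v b| ^ (k + 1) ≤ |a - b| ^ k := by
  rcases le_total a b with h | h
  · rw [abs_sub_comm, abs_of_nonneg (sub_nonneg.2 (hv.prim_mono ha h)), abs_sub_comm a,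
      abs_of_nonneg (sub_nonneg.2 h)]
    exact hv.increment_pow_le' ha h
  · rw [abs_of_nonneg (sub_nonneg.2 (hv.prim_mono hb h)), abs_of_nonneg (sub_nonneg.2 h)]
    exact hv.increment_pow_le' hb h

/-- Profiles are relatively compact for pointwise convergence of their primitives. -/
lemma exists_subseq_tendsto_prim {k : ℕ} (hk : 0 < k) {V : ℕ → ℝ → ℝ}
    (hV : ∀ n, Profile k (V n)) :
    ∃ (ψ : ℕ → ℕ) (Φ : ℝ → ℝ), StrictMono ψ ∧
      ∀ s, 0 ≤ s → Tendsto (fun n => prim (V (ψ n)) s) atTop (nhds (Φ s)) := by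
  have hbd : ∀ n (p : ℚ), prim (V n) |(p : ℝ)| ∈ Icc (0 : ℝ) (1 + |(p : ℝ)|) := fun n p => by
    refine ⟨(hV n).prim_nonneg (abs_nonneg _), ?_⟩
    have h := (hV n).prim_rpow_le hk (abs_nonneg (p : ℝ))
    rcases le_total (prim (V n) |(p : ℝ)|) 1 with h1 | h1
    · linarith [abs_nonneg (p : ℝ)]
    · have := self_le_rpow_of_one_le h1 (one_le_conjExp k)
      linarith
  obtain ⟨g, -, ψ, hψ, hg⟩ := (isCompact_univ_pi fun p : ℚ =>
    isCompact_Icc (a := (0 : ℝ)) (b := 1 + |(p : ℝ)|)).tendsto_subseq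
    (x := fun n (p : ℚ) => prim (V n) |(p : ℝ)|) fun n p _ => hbd n p
  have hcau : ∀ s, 0 ≤ s → CauchySeq fun n => prim (V (ψ n)) s := by
    intro s hs
    rw [Metric.cauchySeq_iff']
    intro ε hε
    have hδ : 0 < (ε / 4) ^ (k + 1) := by positivity
    obtain ⟨δ, hδ0, hδk⟩ : ∃ δ : ℝ, 0 < δ ∧ δ ^ k < (ε / 4) ^ (k + 1) := by
      have : Tendsto (fun δ : ℝ => δ ^ k) (nhdsWithin 0 (Ioi 0)) (nhds 0) := by
        have := (continuous_pow k).tendsto (0 : ℝ)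
        rw [zero_pow hk.ne'] at this
        exact this.mono_left nhdsWithin_le_nhds
      obtain ⟨δ, h1, h2⟩ := ((this.eventually_lt_const hδ).and self_mem_nhdsWithin).exists
      exact ⟨δ, h2, h1⟩
    obtain ⟨p, hp1, hp2⟩ := exists_rat_btwn (show s < s + δ by linarith)
    have hp0 : (0 : ℝ) ≤ p := hs.trans hp1.le
    have hnear : ∀ n, |prim (V (ψ n)) s - prim (V (ψ n)) p| < ε / 4 := fun n => by
      refine lt_of_pow_lt_pow_left₀ (k + 1) (by positivity)
        (((hV (ψ n)).abs_sub_pow_le hs hp0).trans_lt (lt_of_le_of_lt ?_ hδk))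
      gcongr
      rw [abs_sub_comm, abs_of_pos (by linarith)]; linarith
    have hcp : CauchySeq fun n => prim (V (ψ n)) (p : ℝ) := by
      have := (tendsto_pi_nhds.1 hg p).cauchySeq
      simpa [Function.comp_def, abs_of_nonneg hp0] using this
    obtain ⟨M, hM⟩ := Metric.cauchySeq_iff'.1 hcp (ε / 4) (by positivity)
    refine ⟨M, fun n hn => ?_⟩
    have h1 := abs_lt.1 (hnear n)
    have h2 := abs_lt.1 (hnear M)
    have h3 := abs_lt.1 (by simpa [Real.dist_eq] using hM n hn)
    rw [Real.dist_eq, abs_lt]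
    constructor <;> linarith [h1.1, h1.2, h2.1, h2.2, h3.1, h3.2]
  choose! Φ hΦ using fun s hs => cauchySeq_tendsto_of_complete (hcau s hs)
  exact ⟨ψ, Φ, hψ, hΦ⟩

lemma DualBound.of_tendsto {k : ℕ} {Ψ : ℕ → ℝ → ℝ} {Φ : ℝ → ℝ}
    (hΨ : ∀ n, DualBound k (Ψ n)) (hc : ∀ n, ContinuousOn (Ψ n) (Ioi 0))
    (hlim : ∀ s, 0 < s → Tendsto (fun n => Ψ n s) atTop (nhds (Φ s))) : DualBound k Φ := by
  intro h hh
  calc ∫⁻ s in Ioi (0 : ℝ), h s * ENNReal.ofReal (Φ s)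
      ≤ ∫⁻ s in Ioi (0 : ℝ), liminf (fun n => h s * ENNReal.ofReal (Ψ n s)) atTop := by
        refine setLIntegral_mono' measurableSet_Ioi fun s hs => ?_
        rcases eq_or_ne (ENNReal.ofReal (Φ s)) 0 with h0 | h0
        · simp [h0]
        · exact (ENNReal.Tendsto.const_mul (ENNReal.tendsto_ofReal (hlim s hs))
            (Or.inl h0)).liminf_eq.ge
    _ ≤ liminf (fun n => ∫⁻ s in Ioi (0 : ℝ), h s * ENNReal.ofReal (Ψ n s)) atTop :=
        lintegral_liminf_le' fun n => hh.aemeasurable.mul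
          ((hc n).aemeasurable measurableSet_Ioi).ennreal_ofReal
    _ ≤ _ := liminf_le_of_le (h := fun b hb => by
        obtain ⟨n, hn⟩ := hb.exists
        exact hn.trans (hΨ n h hh))

lemma mul_le_rpow_conjExp_add {k : ℕ} (hk : 0 < k) {L y ε : ℝ} (hL : 0 ≤ L) (hy : 0 ≤ y)
    (hε : 0 < ε) : L * y ≤ ε * y ^ conjExp k + L * (L / ε) ^ k := by
  have hq0 : 0 ≤ y ^ conjExp k := rpow_nonneg hy _
  rcases le_or_gt y ((L / ε) ^ k) with h | h
  · nlinarith [mul_le_mul_of_nonneg_left h hL, mul_nonneg hε.le hq0]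
  · have hy0 : 0 < y := lt_of_le_of_lt (by positivity) h
    have h1 : L / ε ≤ y ^ (1 / (k : ℝ)) := by
      refine le_of_lt (lt_of_pow_lt_pow_left₀ k (by positivity) ?_)
      rwa [rpow_inv_pow hk hy]
    have h2 : y ^ conjExp k = y * y ^ (1 / (k : ℝ)) := by
      unfold conjExp; rw [rpow_add hy0, rpow_one]
    rw [div_le_iff₀ hε] at h1
    rw [h2]
    have : 0 ≤ L * (L / ε) ^ k := by positivity
    nlinarith [mul_le_mul_of_nonneg_left h1 hy]

/-- Profiles that carry a fixed amount of mass near the origin grow strictly slower than allowed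
by their total energy. -/
lemma exists_growth_bound {k : ℕ} (hk : 0 < k) {S η : ℝ} (hS : 0 < S) (hη : 0 < η) :
    ∃ a C : ℝ, a < 1 ∧ ∀ v, Profile k v → η < prim v S →
      ∀ s, 0 < s → prim v s ^ conjExp k ≤ a * s + C := by
  have hk' : (0 : ℝ) < k := by exact_mod_cast hk
  have hq := conjExp_pos k
  set δ := min 1 (η ^ (k + 1) / S ^ k) with hδ
  have hδ0 : 0 < δ := by positivity
  have hδ1 : δ ≤ 1 := min_le_left _ _
  set a₀ := (1 - δ) ^ (1 / (k : ℝ)) with ha₀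
  have ha₀1 : a₀ < 1 := rpow_lt_one (by linarith) (by linarith) (by positivity)
  have ha₀0 : 0 ≤ a₀ := rpow_nonneg (by linarith) _
  set L := conjExp k * (S ^ (1 / conjExp k)) ^ (1 / (k : ℝ)) with hL
  have hL0 : 0 ≤ L := by positivity
  set ε := (1 - a₀) / 2 with hε
  have hε0 : 0 < ε := by rw [hε]; linarith
  refine ⟨a₀ + ε, S + L * (L / ε) ^ k, by rw [hε]; linarith, fun v hv hvη s hs => ?_⟩
  have hT0 : 0 ≤ L * (L / ε) ^ k := by positivity
  rcases le_total s S with h | h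
  · have := hv.prim_rpow_le hk hs.le
    nlinarith [mul_nonneg (add_nonneg ha₀0 hε0.le) hs.le]
  have hx0 := hv.prim_nonneg hS.le
  set x := prim v S with hx
  set y := prim v s - x with hy
  have hy0 : 0 ≤ y := sub_nonneg.2 (hv.prim_mono hS.le h)
  have hxq : x ^ conjExp k ≤ S := hv.prim_rpow_le hk hS.le
  have hxS : x ≤ S ^ (1 / conjExp k) := by
    rw [one_div]; exact (le_rpow_inv_iff_of_pos hx0 hS.le hq).2 hxq
  have hen : δ ≤ ∫ t in (0 : ℝ)..S, v t ^ (k + 1) := by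
    refine (min_le_right _ _).trans ?_
    rw [div_le_iff₀ (by positivity)]
    have h1 := hv.increment_pow_le le_rfl hS.le
    rw [Profile.prim_zero, sub_zero, sub_zero] at h1
    exact (pow_le_pow_left₀ hη.le hvη.le _).trans h1
  have hyq : y ^ conjExp k ≤ a₀ * s := by
    refine rpow_conjExp_le hk hy0 (by linarith) hs.le ?_
    refine (hv.increment_pow_le hS.le h).trans ?_
    have h1 := hv.energy_interval_le_tail hS.le h
    have h2 := hv.energy_split hS.le
    refine mul_le_mul (by linarith) (pow_le_pow_left₀ (by linarith) (by linarith) _)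
      (pow_nonneg (by linarith) _) (by linarith)
  have hadd := add_rpow_conjExp_le hk hx0 hy0
  rw [hy, add_sub_cancel, ← hy] at hadd
  have hLx : conjExp k * x ^ (1 / (k : ℝ)) ≤ L := by rw [hL]; gcongr
  have h3 := mul_le_rpow_conjExp_add hk hL0 hy0 hε0
  have h4 : y ^ conjExp k ≤ s := hyq.trans (by nlinarith)
  have h5 := mul_le_mul_of_nonneg_right hLx hy0
  have h6 := mul_le_mul_of_nonneg_left h4 hε0.le
  linarith

/-- A maximising sequence above the concentration level has a limit curve realising the limit
of the functional. -/
theorem exists_limit_curve {k : ℕ} (hk : 0 < k) {b μ : ℝ} {φ : ℝ → ℝ} (W : Weight k b μ φ)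
    {M : ℝ≥0∞} (hM : ENNReal.ofReal (1 + exp (harm k)) < M) {V : ℕ → ℝ → ℝ}
    (hV : ∀ n, Profile k (V n)) (hVc : ∀ n, Continuous (V n))
    (hVi : ∀ n, IntegrableOn (V n) (Ioi 0))
    (hlim : Tendsto (fun n => logFunctional k b μ φ (prim (V n))) atTop (nhds M)) :
    ∃ Φ, TestInput k Φ ∧ logFunctional k b μ φ Φ = M := by
  have hq := conjExp_pos k
  obtain ⟨ε, hε, hεM⟩ : ∃ ε > 0, ENNReal.ofReal (1 + exp (harm k) + ε) < M := by
    have hc : Tendsto (fun ε : ℝ => ENNReal.ofReal (1 + exp (harm k) + ε))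
        (nhdsWithin 0 (Ioi 0)) (nhds (ENNReal.ofReal (1 + exp (harm k)))) := by
      have : Continuous fun ε : ℝ => ENNReal.ofReal (1 + exp (harm k) + ε) :=
        ENNReal.continuous_ofReal.comp (by fun_prop)
      simpa using (this.tendsto 0).mono_left nhdsWithin_le_nhds
    obtain ⟨ε, h1, h2⟩ := ((hc.eventually_lt_const hM).and self_mem_nhdsWithin).exists
    exact ⟨ε, h2, h1⟩
  obtain ⟨S, hS, η, hη, hlev⟩ := level_bound hk W hε
  obtain ⟨n₀, hn₀⟩ := (hlim.eventually_const_lt hεM).exists_forall_of_atTop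
  have hbig : ∀ n ≥ n₀, η < prim (V n) S := fun n hn => by
    by_contra hcon
    exact absurd (hlev _ (hV n) (hVc n) (hVi n) (not_lt.1 hcon)) (not_le.2 (hn₀ n hn))
  obtain ⟨a, C, ha, hgrow⟩ := exists_growth_bound hk hS hη
  obtain ⟨ψ, Φ, hψ, hΦ⟩ := exists_subseq_tendsto_prim hk fun n => hV (n + n₀)
  set U : ℕ → ℝ → ℝ := fun n => V (ψ n + n₀) with hU
  have hUp : ∀ n, Profile k (U n) := fun n => hV _
  have hUη : ∀ n, η < prim (U n) S := fun n => hbig _ (Nat.le_add_left _ _)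
  have hUt : ∀ n, TestInput k (prim (U n)) := fun n =>
    (hUp n).testInput hk (hVi _) ⟨S, hS, hη.trans (hUη n)⟩
  have hΦ' : ∀ s, 0 < s → Tendsto (fun n => prim (U n) s) atTop (nhds (Φ s)) :=
    fun s hs => hΦ s hs.le
  have hrp : ∀ s, 0 < s → Tendsto (fun n => prim (U n) s ^ conjExp k) atTop
      (nhds (Φ s ^ conjExp k)) := fun s hs =>
    (continuous_rpow_const hq.le).continuousAt.tendsto.comp (hΦ' s hs)
  have hgΦ : ∀ s, 0 < s → Φ s ^ conjExp k ≤ a * s + C := fun s hs =>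
    le_of_tendsto' (hrp s hs) fun n => hgrow _ (hUp n) (hUη n) s hs
  have hT : TestInput k Φ :=
    { cont := by
        intro s hs
        rw [Metric.continuousWithinAt_iff]
        intro e he
        have hpos : 0 < e ^ (k + 1) := by positivity
        have ht : Tendsto (fun δ : ℝ => δ ^ k) (nhds 0) (nhds 0) := by
          simpa [hk.ne'] using (continuous_pow k).tendsto (0 : ℝ)
        obtain ⟨δ, hδ, hδ'⟩ := Metric.eventually_nhds_iff.1 (ht.eventually_lt_const hpos)
        refine ⟨δ, hδ, fun t ht hts => ?_⟩
        have h1 : |Φ t - Φ s| ^ (k + 1) ≤ |t - s| ^ k :=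
          le_of_tendsto' ((((hΦ' t ht).sub (hΦ' s hs)).abs).pow (k + 1)) fun n =>
            (hUp n).abs_sub_pow_le (le_of_lt ht) (le_of_lt hs)
        have h2 := hδ' (y := |t - s|) (by simpa [Real.dist_eq] using hts)
        rw [Real.dist_eq]
        exact lt_of_pow_lt_pow_left₀ (k + 1) he.le (h1.trans_lt h2)
      nonneg := fun s hs => ge_of_tendsto' (hΦ' s hs) fun n => (hUp n).prim_nonneg hs.le
      dual := DualBound.of_tendsto (fun n => (hUt n).dual) (fun n => (hUt n).cont) hΦ'
      rpow_le := fun s hs => le_of_tendsto' (hrp s hs) fun n => (hUp n).prim_rpow_le hk hs.le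
      growth := ⟨a, C, ha, hgΦ⟩
      pos := ⟨S, hS, hη.trans_le (ge_of_tendsto' (hΦ' S hS) fun n => (hUη n).le)⟩ }
  refine ⟨Φ, hT, ?_⟩
  obtain ⟨K, hK, hph⟩ := W.exists_phase_bound
  have hfin : ∫⁻ s in Ioi (0 : ℝ), ENNReal.ofReal (exp (C + K) * exp ((a - 1) * s)) ≠ ⊤ := by
    have hi : IntegrableOn (fun s : ℝ => exp (C + K) * exp ((a - 1) * s)) (Ioi 0) :=
      (integrableOn_exp_mul_Ioi (by linarith) 0).const_mul _
    rw [← ofReal_integral_eq_lintegral_ofReal hi (Eventually.of_forall fun s => by positivity)]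
    exact ENNReal.ofReal_ne_top
  have hmeas : ∀ Ψ, TestInput k Ψ → AEMeasurable
      (fun s => ENNReal.ofReal (exp (phase k b μ φ s (Ψ s) - s))) (volume.restrict (Ioi 0)) :=
    fun Ψ h => ContinuousOn.aemeasurable (by
      have := W.continuousOn_phase h.cont
      exact ENNReal.continuous_ofReal.comp_continuousOn
        (continuous_exp.comp_continuousOn (this.sub continuousOn_id))) measurableSet_Ioi
  have hdct : Tendsto (fun n => logFunctional k b μ φ (prim (U n))) atTop
      (nhds (logFunctional k b μ φ Φ)) := by
    unfold logFunctional
    refine tendsto_lintegral_of_dominated_convergence' _ (fun n => hmeas _ (hUt n)) ?_ hfin ?_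
    · intro n
      filter_upwards [ae_restrict_mem measurableSet_Ioi] with s hs
      refine ENNReal.ofReal_le_ofReal ?_
      rw [← exp_add]
      refine exp_le_exp.2 ?_
      have h1 := hph s hs _ ((hUp n).prim_nonneg (le_of_lt hs))
        ((hUp n).prim_rpow_le hk (le_of_lt hs))
      have h2 := hgrow _ (hUp n) (hUη n) s hs
      linarith
    · filter_upwards [ae_restrict_mem measurableSet_Ioi] with s hs
      refine ENNReal.tendsto_ofReal ((continuous_exp.tendsto _).comp (Tendsto.sub_const ?_ s))
      have hexp : 0 < conjExp k + φ s := by have := W.nonneg s hs; linarith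
      refine Tendsto.const_mul _ ?_
      exact (continuous_rpow_const hexp.le).continuousAt.tendsto.comp ((hΦ' s hs).const_mul b)
  refine tendsto_nhds_unique hdct ?_
  exact hlim.comp (tendsto_atTop_mono (fun n => Nat.le_add_right _ _) hψ.tendsto_atTop)

/-- Integration in polar coordinates for nonnegative radial functions. -/
lemma lintegral_fun_norm {E : Type*} [NormedAddCommGroup E] [NormedSpace ℝ E]
    [FiniteDimensional ℝ E] [MeasurableSpace E] [BorelSpace E] [Nontrivial E]
    (ν : Measure E) [ν.IsAddHaarMeasure] {g : ℝ → ℝ≥0∞} (hg : Measurable g) :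
    ∫⁻ x, g ‖x‖ ∂ν = (Module.finrank ℝ E * ν (Metric.ball 0 1)) *
      ∫⁻ r in Ioi (0 : ℝ), ENNReal.ofReal (r ^ (Module.finrank ℝ E - 1)) * g r := by
  calc ∫⁻ x, g ‖x‖ ∂ν = ∫⁻ x : ({(0)}ᶜ : Set E), g ‖x.1‖ ∂(ν.comap (↑)) := by
        rw [lintegral_subtype_comap (measurableSet_singleton _).compl fun x => g ‖x‖,
          restrict_compl_singleton]
    _ = ∫⁻ x, g x.2 ∂ν.toSphere.prod (.volumeIoiPow (Module.finrank ℝ E - 1)) := by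
        simpa using ν.measurePreserving_homeomorphUnitSphereProd.lintegral_comp_emb
          (Homeomorph.measurableEmbedding _) (g ∘ Subtype.val ∘ Prod.snd)
    _ = ν.toSphere univ * ∫⁻ x : Ioi (0 : ℝ), g x ∂.volumeIoiPow (Module.finrank ℝ E - 1) := by
        rw [lintegral_prod (fun x : _ × Ioi (0 : ℝ) => g x.2) (by fun_prop)]
        simp [lintegral_const, mul_comm]
    _ = _ := by
        rw [Measure.toSphere_apply_univ]
        congr 1
        rw [Measure.volumeIoiPow, lintegral_withDensity_eq_lintegral_mul _
          (by fun_prop) (by fun_prop)]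
        exact lintegral_subtype_comap measurableSet_Ioi
          fun r => ENNReal.ofReal (r ^ (Module.finrank ℝ E - 1)) * g r

section LogCoordinates

variable {N : ℕ}

lemma exp_neg_div_mem_Ioo (hN : 0 < N) {s : ℝ} (hs : 0 < s) :
    exp (-s / N) ∈ Ioo (0 : ℝ) 1 := by
  have hN' : (0 : ℝ) < N := by exact_mod_cast hN
  exact ⟨exp_pos _, exp_lt_one_iff.2 (div_neg_of_neg_of_pos (by linarith) hN')⟩

lemma hasDerivAt_exp_neg_div (N : ℕ) (s : ℝ) :
    HasDerivAt (fun s : ℝ => exp (-s / N)) (-(exp (-s / N) / N)) s := by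
  have := ((hasDerivAt_neg s).div_const (N : ℝ)).exp
  convert this using 1
  ring

lemma image_exp_neg_div (hN : 0 < N) :
    (fun s : ℝ => exp (-s / N)) '' Ioi 0 = Ioo 0 1 := by
  have hN' : (0 : ℝ) < N := by exact_mod_cast hN
  ext r
  constructor
  · rintro ⟨s, hs, rfl⟩
    exact exp_neg_div_mem_Ioo hN hs
  · rintro ⟨h0, h1⟩
    refine ⟨-(N * log r), ?_, ?_⟩
    · have := log_neg h0 h1
      rw [mem_Ioi]; nlinarith
    · simp only [neg_neg]
      rw [mul_div_cancel_left₀ _ hN'.ne', exp_log h0]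

lemma injOn_exp_neg_div (hN : 0 < N) (S : Set ℝ) :
    InjOn (fun s : ℝ => exp (-s / N)) S := by
  have hN' : (N : ℝ) ≠ 0 := by exact_mod_cast hN.ne'
  intro a _ b _ h
  have := exp_injective h
  field_simp at this
  linarith

lemma lintegral_Ioo_eq_log (hN : 0 < N) (g : ℝ → ℝ≥0∞) :
    ∫⁻ r in Ioo (0 : ℝ) 1, g r =
      ∫⁻ s in Ioi (0 : ℝ), ENNReal.ofReal (exp (-s / N) / N) * g (exp (-s / N)) := by
  rw [← image_exp_neg_div hN, lintegral_image_eq_lintegral_abs_deriv_mul measurableSet_Ioi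
    (fun s _ => (hasDerivAt_exp_neg_div N s).hasDerivWithinAt) (injOn_exp_neg_div hN _)]
  refine lintegral_congr fun s => ?_
  rw [abs_neg, abs_of_nonneg (by positivity)]

lemma integral_Ioo_eq_log (hN : 0 < N) (g : ℝ → ℝ) :
    ∫ r in Ioo (0 : ℝ) 1, g r =
      ∫ s in Ioi (0 : ℝ), exp (-s / N) / N * g (exp (-s / N)) := by
  rw [← image_exp_neg_div hN, integral_image_eq_integral_abs_deriv_smul measurableSet_Ioi
    (fun s _ => (hasDerivAt_exp_neg_div N s).hasDerivWithinAt) (injOn_exp_neg_div hN _)]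
  refine integral_congr_ae (Eventually.of_forall fun s => ?_)
  simp only [abs_neg, smul_eq_mul]
  rw [abs_of_nonneg (by positivity)]

/-- Radial integrals over the unit ball in logarithmic coordinates. -/
lemma lintegral_ball_eq_log (hN : 0 < N) {g : ℝ → ℝ} (hg : ContinuousOn g (Ioo 0 1)) :
    ∫⁻ x in Metric.ball (0 : EuclideanSpace ℝ (Fin N)) 1, ENNReal.ofReal (g ‖x‖) =
      volume (Metric.ball (0 : EuclideanSpace ℝ (Fin N)) 1) *
        ∫⁻ s in Ioi (0 : ℝ), ENNReal.ofReal (exp (-s) * g (exp (-s / N))) := by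
  have hN' : (0 : ℝ) < N := by exact_mod_cast hN
  have : Nonempty (Fin N) := ⟨⟨0, hN⟩⟩
  have : Nontrivial (EuclideanSpace ℝ (Fin N)) := inferInstance
  set G : ℝ → ℝ≥0∞ := (Ioo (0 : ℝ) 1).indicator fun r => ENNReal.ofReal (g r) with hG
  have hGm : Measurable G := by
    rw [hG, ← piecewise_eq_indicator]
    exact (ENNReal.continuous_ofReal.comp_continuousOn hg).measurable_piecewise
      continuousOn_const measurableSet_Ioo
  have h1 : ∫⁻ x in Metric.ball (0 : EuclideanSpace ℝ (Fin N)) 1, ENNReal.ofReal (g ‖x‖) =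
      ∫⁻ x : EuclideanSpace ℝ (Fin N), G ‖x‖ := by
    rw [← lintegral_indicator Metric.isOpen_ball.measurableSet]
    refine lintegral_congr_ae ?_
    have h0 : ∀ᵐ x : EuclideanSpace ℝ (Fin N), x ≠ 0 := Measure.ae_ne volume 0
    filter_upwards [h0] with x hx
    by_cases hb : ‖x‖ < 1
    · rw [indicator_of_mem (by simpa using hb), hG,
        indicator_of_mem (show ‖x‖ ∈ Ioo (0 : ℝ) 1 from ⟨norm_pos_iff.2 hx, hb⟩)]
    · rw [indicator_of_notMem (by simpa using hb), hG, indicator_of_notMem fun h => hb h.2]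
  rw [h1, lintegral_fun_norm volume hGm]
  simp only [finrank_euclideanSpace, Fintype.card_fin]
  have h2 : ∫⁻ r in Ioi (0 : ℝ), ENNReal.ofReal (r ^ (N - 1)) * G r =
      ∫⁻ r in Ioo (0 : ℝ) 1, ENNReal.ofReal (r ^ (N - 1) * g r) := by
    rw [← lintegral_indicator measurableSet_Ioi, ← lintegral_indicator measurableSet_Ioo]
    refine lintegral_congr fun r => ?_
    by_cases hr : r ∈ Ioo (0 : ℝ) 1
    · rw [indicator_of_mem (show r ∈ Ioi (0 : ℝ) from hr.1), indicator_of_mem hr, hG,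
        indicator_of_mem hr, ENNReal.ofReal_mul (pow_nonneg hr.1.le _)]
    · rw [indicator_of_notMem hr]
      by_cases hr0 : r ∈ Ioi (0 : ℝ)
      · rw [indicator_of_mem hr0, hG, indicator_of_notMem hr, mul_zero]
      · rw [indicator_of_notMem hr0]
  rw [h2, lintegral_Ioo_eq_log hN, mul_comm (N : ℝ≥0∞), mul_assoc,
    ← lintegral_const_mul' _ _ (ENNReal.natCast_ne_top N)]
  congr 1
  refine lintegral_congr fun s => ?_
  rw [← ENNReal.ofReal_natCast, ← ENNReal.ofReal_mul (by positivity),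
    ← ENNReal.ofReal_mul hN'.le]
  congr 1
  have : exp (-s) = exp (-s / N) * exp (-s / N) ^ (N - 1) := by
    rw [← pow_succ', Nat.sub_add_cancel hN, ← exp_nat_mul]
    congr 1; field_simp
  rw [this]
  field_simp

end LogCoordinates

/-- The scale `μ_N^{-1/q}`, `q = (N+2)/N`, normalising radial functions. -/
noncomputable def critScale (N k : ℕ) : ℝ := muN N k ^ (-(1 / conjExp k))

/-- The rescaled logarithmic derivative of `w` in the variable `s = -N log r`. -/
noncomputable def logProfile (N k : ℕ) (w : ℝ → ℝ) (s : ℝ) : ℝ :=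
  exp (-|s| / N) * derivWithin w (Icc 0 1) (exp (-|s| / N)) / (critScale N k * N)

lemma omegaS_pos {N : ℕ} (hN : 0 < N) : 0 < omegaS N := by
  have hN' : (0 : ℝ) < N := by exact_mod_cast hN
  exact mul_pos hN' (ENNReal.toReal_pos (Metric.measure_ball_pos _ _ one_pos).ne'
    measure_ball_lt_top.ne)

lemma cN_eq {N k : ℕ} (hk : 0 < k) (hN : N = 2 * k) :
    cN N k = omegaS N * ((N - 1).choose (k - 1)) / k := by
  obtain ⟨k, rfl⟩ : ∃ j, k = j + 1 := ⟨k - 1, by omega⟩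
  obtain ⟨n, rfl⟩ : ∃ n, N = n + 1 := ⟨N - 1, by omega⟩
  have h := Nat.add_one_mul_choose_eq n k
  have h' : ((n + 1 : ℕ) : ℝ) * (n.choose k : ℝ) = ((n + 1).choose (k + 1) : ℝ) * (k + 1 : ℕ) := by
    exact_mod_cast h
  unfold cN
  have h1 : ((n + 1 : ℕ) : ℝ) ≠ 0 := by positivity
  have h2 : ((k + 1 : ℕ) : ℝ) ≠ 0 := by positivity
  simp only [Nat.add_sub_cancel]
  rw [div_eq_div_iff h1 h2, mul_assoc, ← h']
  ring

lemma cN_pos {N k : ℕ} (hk : 0 < k) (hN : N = 2 * k) : 0 < cN N k := by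
  have h1 := omegaS_pos (N := N) (by omega)
  have h2 : (0 : ℝ) < N.choose k := by exact_mod_cast Nat.choose_pos (by omega)
  have h3 : (0 : ℝ) < N := by exact_mod_cast (by omega : 0 < N)
  unfold cN; positivity

lemma muN_pow {N k : ℕ} (hk : 0 < k) (hN : N = 2 * k) :
    muN N k ^ k = (N : ℝ) ^ k * cN N k := by
  have hc := (cN_pos hk hN).le
  unfold muN
  rw [← cN_eq hk hN, mul_pow, ← rpow_natCast (_ ^ _) k, ← rpow_mul hc]
  have : (2 : ℝ) / N * k = 1 := by
    have : (k : ℝ) ≠ 0 := by positivity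
    rw [hN]; push_cast; field_simp
  rw [this, rpow_one]

lemma muN_pos {N k : ℕ} (hk : 0 < k) (hN : N = 2 * k) : 0 < muN N k := by
  have hc := cN_pos hk hN
  have h3 : (0 : ℝ) < N := by exact_mod_cast (by omega : 0 < N)
  unfold muN
  rw [← cN_eq hk hN]; positivity

lemma critScale_pos {N k : ℕ} (hk : 0 < k) (hN : N = 2 * k) : 0 < critScale N k :=
  rpow_pos_of_pos (muN_pos hk hN) _

lemma muN_mul_critScale {N k : ℕ} (hk : 0 < k) (hN : N = 2 * k) :
    muN N k * critScale N k ^ conjExp k = 1 := by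
  have h := muN_pos hk hN
  have hq := (conjExp_pos k).ne'
  unfold critScale
  rw [← rpow_mul h.le, neg_mul, one_div_mul_cancel hq, rpow_neg_one, mul_inv_cancel₀ h.ne']

lemma cN_mul_critScale {N k : ℕ} (hk : 0 < k) (hN : N = 2 * k) :
    cN N k * (critScale N k ^ (k + 1) * N ^ k) = 1 := by
  have hb := critScale_pos hk hN
  rw [← rpow_conjExp_pow hk hb.le, mul_comm, mul_assoc, ← muN_pow hk hN, ← mul_pow, mul_comm,
    muN_mul_critScale hk hN, one_pow]

lemma critical_exponent_eq {N k : ℕ} (hk : 0 < k) (hN : N = 2 * k) :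
    ((N : ℝ) + 2) / N = conjExp k := by
  have : (k : ℝ) ≠ 0 := by positivity
  unfold conjExp
  rw [hN]; push_cast; field_simp

lemma weight_of_decay {N k : ℕ} (hk : 0 < k) (hN : N = 2 * k) {f : ℝ → ℝ}
    (hfc : ContinuousOn f (Ico 0 1)) (hf0 : f 0 = 0) (hfnn : ∀ r ∈ Ico (0 : ℝ) 1, 0 ≤ f r)
    (hσ : ∃ σ : ℝ, 2 < σ ∧ IsBoundedUnder (· ≤ ·) (nhdsWithin (0:ℝ) (Ioi 0))
      (fun r => f r * |log r| ^ σ)) :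
    Weight k (critScale N k) (muN N k) fun s => f (exp (-s / N)) := by
  have hN0 : 0 < N := by omega
  have hN' : (0 : ℝ) < N := by exact_mod_cast hN0
  have hb := critScale_pos hk hN
  set b := critScale N k
  have hmem : ∀ s, 0 < s → exp (-s / N) ∈ Ico (0 : ℝ) 1 := fun s hs =>
    Ioo_subset_Ico_self (exp_neg_div_mem_Ioo hN0 hs)
  have htend : Tendsto (fun s : ℝ => exp (-s / N)) atTop (nhds 0) :=
    tendsto_exp_atBot.comp (tendsto_neg_atTop_atBot.atBot_div_const hN')
  refine ⟨hb, muN_mul_critScale hk hN, ?_, fun s hs => hfnn _ (hmem s hs), ?_, fun ε hε => ?_⟩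
  · exact hfc.comp (by fun_prop) hmem
  · have h := hfc 0 ⟨le_rfl, one_pos⟩
    rw [ContinuousWithinAt, hf0] at h
    refine h.comp (tendsto_nhdsWithin_iff.2 ⟨htend, ?_⟩)
    filter_upwards [eventually_gt_atTop 0] with s hs using hmem s hs
  · obtain ⟨σ, hσ2, B, hB⟩ := hσ
    rw [eventually_map] at hB
    have htend' : Tendsto (fun s : ℝ => exp (-s / N)) atTop (nhdsWithin 0 (Ioi 0)) :=
      tendsto_nhdsWithin_iff.2 ⟨htend, Eventually.of_forall fun s => exp_pos _⟩
    set C := max B 0 * N ^ σ with hC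
    have hC0 : 0 ≤ C := by positivity
    have hlim : Tendsto (fun s : ℝ => 2 * C * (|log b| / s ^ (σ - 1) + log s / s ^ (σ - 1)))
        atTop (nhds 0) := by
      have hs1 : 0 < σ - 1 := by linarith
      have h1 : Tendsto (fun s : ℝ => |log b| / s ^ (σ - 1)) atTop (nhds 0) :=
        (tendsto_rpow_atTop hs1).const_div_atTop _
      have h2 : Tendsto (fun s : ℝ => log s / s ^ (σ - 1)) atTop (nhds 0) :=
        (isLittleO_log_rpow_atTop hs1).tendsto_div_nhds_zero
      simpa using (h1.add h2).const_mul (2 * C)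
    have hlim' : Tendsto (fun s : ℝ => C * (|log b| / s ^ (σ - 1) + log s / s ^ (σ - 1)))
        atTop (nhds 0) := by
      have := hlim.const_mul (1 / 2)
      simpa [mul_assoc] using this
    filter_upwards [htend'.eventually hB, eventually_ge_atTop 1, hlim.eventually_lt_const hε,
      hlim'.eventually_lt_const one_pos] with s hs hs1 hsε hsone
    have hs0 : 0 < s := by linarith
    set p := f (exp (-s / N)) with hp
    have hp0 : 0 ≤ p := hfnn _ (hmem s hs0)
    have hL : |log (exp (-s / N))| = s / N := by
      rw [log_exp, neg_div, abs_neg, abs_of_pos (by positivity)]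
    rw [hL, div_rpow hs0.le hN'.le, mul_div_assoc', div_le_iff₀ (by positivity)] at hs
    have hpC : p * s ^ σ ≤ C := hs.trans (by rw [hC]; gcongr; exact le_max_left _ _)
    have hsσ : s ^ σ = s * s ^ (σ - 1) := by
      rw [← rpow_one_add' hs0.le (by linarith)]; congr 1; ring
    have hps : s * p ≤ C / s ^ (σ - 1) := by
      rw [le_div_iff₀ (by positivity)]
      calc s * p * s ^ (σ - 1) = p * s ^ σ := by rw [hsσ]; ring
        _ ≤ C := hpC
    have hlogs : 0 ≤ log s := log_nonneg hs1
    have hl : log (b * s ^ (1 / conjExp k)) ≤ |log b| + log s := by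
      rw [log_mul hb.ne' (by positivity), log_rpow hs0]
      have h1 : 1 / conjExp k ≤ 1 := by
        rw [div_le_one (conjExp_pos k)]; exact one_le_conjExp k
      nlinarith [le_abs_self (log b)]
    have hbase : 0 < b * s ^ (1 / conjExp k) := by positivity
    rw [rpow_def_of_pos hbase]
    set L := |log b| + log s with hLdef
    have hL0 : 0 ≤ L := by positivity
    have hsx : s * (L * p) ≤ C * (|log b| / s ^ (σ - 1) + log s / s ^ (σ - 1)) := by
      calc s * (L * p) = L * (s * p) := by ring
        _ ≤ L * (C / s ^ (σ - 1)) := by gcongr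
        _ = _ := by rw [hLdef]; ring
    have hx0 : 0 ≤ L * p := by positivity
    have hx1 : L * p ≤ 1 := by nlinarith
    have he1 : exp (log (b * s ^ (1 / conjExp k)) * p) ≤ exp (L * p) :=
      exp_le_exp.2 (mul_le_mul_of_nonneg_right hl hp0)
    have he2 : exp (L * p) ≤ 1 + 2 * (L * p) := by
      have h := abs_exp_sub_one_le (x := L * p) (by rwa [abs_of_nonneg hx0])
      rw [abs_of_nonneg hx0] at h
      linarith [le_abs_self (exp (L * p) - 1)]
    have := mul_le_mul_of_nonneg_left (he1.trans he2) hs0.le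
    linarith

section LogProfile

variable {N k : ℕ} {w : ℝ → ℝ}

lemma hasDerivAt_of_smooth (hw : ContDiffOn ℝ 2 w (Icc 0 1)) {r : ℝ} (hr : r ∈ Ioo (0 : ℝ) 1) :
    HasDerivAt w (derivWithin w (Icc 0 1) r) r := by
  have hn : Icc (0 : ℝ) 1 ∈ nhds r := Icc_mem_nhds hr.1 hr.2
  exact ((hw.differentiableOn (by norm_num)) r (Ioo_subset_Icc_self hr)).hasDerivWithinAt.hasDerivAt
    hn

lemma continuousOn_derivWithin_Icc (hw : ContDiffOn ℝ 2 w (Icc 0 1)) :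
    ContinuousOn (derivWithin w (Icc 0 1)) (Icc 0 1) :=
  hw.continuousOn_derivWithin (uniqueDiffOn_Icc one_pos) (by norm_num)

lemma KAdmRad.derivWithin_nonneg (hk : 0 < k) (hN : N = 2 * k) (hw : KAdmRad N k w) :
    ∀ r ∈ Icc (0 : ℝ) 1, 0 ≤ derivWithin w (Icc 0 1) r := by
  have hc := continuousOn_derivWithin_Icc hw.smooth
  have hmono := hw.hess 1 le_rfl hk
  have hin : ∀ r ∈ Ioo (0 : ℝ) 1, 0 ≤ derivWithin w (Icc 0 1) r := by
    intro r hr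
    set h : ℝ → ℝ := fun r => r ^ (N - 1) * derivWithin w (Icc 0 1) r with hh
    have hhc : ContinuousOn h (Icc 0 1) := (continuousOn_pow _).mul hc
    have h0 : h 0 = 0 := by
      have : N - 1 ≠ 0 := by omega
      simp [hh, zero_pow this]
    have hle : h 0 ≤ h r := by
      have ht : Tendsto h (nhdsWithin 0 (Ioo 0 1)) (nhds (h 0)) :=
        (hhc 0 ⟨le_rfl, zero_le_one⟩).mono Ioo_subset_Icc_self
      have : (nhdsWithin (0 : ℝ) (Ioo 0 1)).NeBot := by
        rw [nhdsWithin_Ioo_eq_nhdsGT one_pos]; infer_instance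
      refine le_of_tendsto ht ?_
      have hev : ∀ᶠ x in nhdsWithin (0 : ℝ) (Ioo 0 1), x < r :=
        nhdsWithin_le_nhds (eventually_lt_nhds hr.1)
      filter_upwards [hev, self_mem_nhdsWithin] with x hx hx1
      have := hmono hx1 hr hx.le
      simp only [pow_one] at this
      rwa [(hasDerivAt_of_smooth hw.smooth hx1).deriv,
        (hasDerivAt_of_smooth hw.smooth hr).deriv] at this
    rw [h0] at hle
    exact nonneg_of_mul_nonneg_right hle (pow_pos hr.1 _)
  have hcl : closure (Ioo (0 : ℝ) 1) = Icc 0 1 := closure_Ioo zero_ne_one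
  intro r hr
  have ht := (hc r hr).mono Ioo_subset_Icc_self
  have : (nhdsWithin r (Ioo (0 : ℝ) 1)).NeBot :=
    mem_closure_iff_nhdsWithin_neBot.1 (by rwa [hcl])
  exact ge_of_tendsto ht (eventually_of_mem self_mem_nhdsWithin hin)

lemma exp_neg_abs_div_mem (N : ℕ) (s : ℝ) : exp (-|s| / N) ∈ Icc (0 : ℝ) 1 :=
  ⟨(exp_pos _).le, exp_le_one_iff.2
    (div_nonpos_of_nonpos_of_nonneg (neg_nonpos.2 (abs_nonneg s)) (Nat.cast_nonneg N))⟩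

lemma continuous_logProfile (hw : ContDiffOn ℝ 2 w (Icc 0 1)) : Continuous (logProfile N k w) := by
  have he : Continuous fun s : ℝ => exp (-|s| / N) := by fun_prop
  exact (he.mul ((continuousOn_derivWithin_Icc hw).comp_continuous he
    (exp_neg_abs_div_mem N))).div_const _

lemma logProfile_nonneg (hk : 0 < k) (hN : N = 2 * k)
    (hd : ∀ r ∈ Icc (0 : ℝ) 1, 0 ≤ derivWithin w (Icc 0 1) r) (s : ℝ) :
    0 ≤ logProfile N k w s :=
  div_nonneg (mul_nonneg (exp_pos _).le (hd _ (exp_neg_abs_div_mem N s)))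
    (mul_nonneg (critScale_pos hk hN).le (Nat.cast_nonneg N))

lemma prim_logProfile (hk : 0 < k) (hN : N = 2 * k) (hw : ContDiffOn ℝ 2 w (Icc 0 1))
    (hw1 : w 1 = 0) {s : ℝ} (hs : 0 ≤ s) :
    prim (logProfile N k w) s = -w (exp (-s / N)) / critScale N k := by
  have hb := critScale_pos hk hN
  have hN0 : 0 < N := by omega
  have hmem : ∀ t ∈ Icc 0 s, exp (-t / N) ∈ Icc (0 : ℝ) 1 := fun t ht => by
    simpa [abs_of_nonneg ht.1] using exp_neg_abs_div_mem N t
  have h := intervalIntegral.integral_eq_sub_of_hasDerivAt_of_le hs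
    (f := fun t => -w (exp (-t / N)) / critScale N k) (f' := logProfile N k w)
    (((hw.continuousOn.comp (by fun_prop) hmem).neg).div_const _) (fun t ht => ?_)
    ((continuous_logProfile hw).intervalIntegrable _ _)
  · rw [prim, h]; simp [hw1]
  · have h1 := (hasDerivAt_of_smooth hw (exp_neg_div_mem_Ioo hN0 ht.1)).comp t
      (hasDerivAt_exp_neg_div N t)
    refine HasDerivAt.congr_deriv (h1.neg.div_const (critScale N k)) ?_
    have hN' : (N : ℝ) ≠ 0 := by exact_mod_cast hN0.ne'
    simp only [logProfile]
    rw [abs_of_pos ht.1]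
    field_simp

lemma integrableOn_logProfile_pow (hN0 : 0 < N)
    (hw : ContDiffOn ℝ 2 w (Icc 0 1)) (j : ℕ) :
    IntegrableOn (fun s => logProfile N k w s ^ (j + 1)) (Ioi 0) := by
  have hN' : (0 : ℝ) < N := by exact_mod_cast hN0
  obtain ⟨B, hB⟩ := isCompact_Icc.exists_bound_of_continuousOn (continuousOn_derivWithin_Icc hw)
  set D := B / |critScale N k * N| with hD
  have hi : IntegrableOn (fun s : ℝ => D ^ (j + 1) * exp (-(1 / N : ℝ) * s)) (Ioi 0) :=
    (integrableOn_exp_mul_Ioi (by rw [neg_lt_zero]; positivity) 0).const_mul _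
  refine Integrable.mono' hi ((continuous_logProfile hw).pow _).aestronglyMeasurable ?_
  filter_upwards [ae_restrict_mem measurableSet_Ioi] with s hs
  have h1 := hB _ (exp_neg_abs_div_mem N s)
  have hB0 : 0 ≤ B := (norm_nonneg _).trans h1
  have he : |s| = s := abs_of_pos hs
  have h2 : ‖logProfile N k w s‖ ≤ D * exp (-(1 / N : ℝ) * s) := by
    unfold logProfile
    rw [norm_div, norm_mul, norm_of_nonneg (exp_pos _).le, hD, Real.norm_eq_abs (_ * _)]
    rw [div_mul_eq_mul_div, mul_comm B]
    have : exp (-|s| / N) = exp (-(1 / N : ℝ) * s) := by rw [he]; congr 1; ring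
    rw [this] at h1 ⊢
    gcongr
  rw [norm_pow]
  calc ‖logProfile N k w s‖ ^ (j + 1) ≤ (D * exp (-(1 / N : ℝ) * s)) ^ (j + 1) := by gcongr
    _ = D ^ (j + 1) * exp (-(1 / N : ℝ) * s) ^ (j + 1) := mul_pow _ _ _
    _ ≤ D ^ (j + 1) * exp (-(1 / N : ℝ) * s) := by
        have : exp (-(1 / N : ℝ) * s) ≤ 1 := exp_le_one_iff.2 (by
          rw [neg_mul, neg_nonpos]; have : 0 < s := hs; positivity)
        have h4 := pow_le_of_le_one (exp_pos _).le this (Nat.succ_ne_zero j)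
        exact mul_le_mul_of_nonneg_left h4 (by positivity)

lemma integral_logProfile_pow (hk : 0 < k) (hN : N = 2 * k) (hw : ContDiffOn ℝ 2 w (Icc 0 1))
    (hd : ∀ r ∈ Icc (0 : ℝ) 1, 0 ≤ derivWithin w (Icc 0 1) r) :
    ∫ s in Ioi (0 : ℝ), logProfile N k w s ^ (k + 1) =
      cN N k * ∫ r in Ioo (0:ℝ) 1, r ^ (N - k) * |deriv w r| ^ (k + 1) := by
  have hN0 : 0 < N := by omega
  have hN' : (N : ℝ) ≠ 0 := by exact_mod_cast hN0.ne'
  have hb := (critScale_pos hk hN).ne'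
  have hNk : N - k = k := by omega
  rw [integral_Ioo_eq_log hN0, ← integral_const_mul]
  refine setIntegral_congr_fun measurableSet_Ioi fun s hs => ?_
  have hm := exp_neg_div_mem_Ioo hN0 hs
  have habs : |s| = s := abs_of_pos hs
  have hc : cN N k = 1 / (critScale N k ^ (k + 1) * N ^ k) :=
    eq_one_div_of_mul_eq_one_left (cN_mul_critScale hk hN)
  simp only [logProfile]
  rw [habs, (hasDerivAt_of_smooth hw hm).deriv, abs_of_nonneg (hd _ (Ioo_subset_Icc_self hm)),
    hNk, hc, div_pow, mul_pow, mul_pow, pow_succ (N : ℝ), pow_succ (exp (-s / N))]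
  field_simp

lemma ballIntegral_eq_logFunctional (hk : 0 < k) (hN : N = 2 * k) {f : ℝ → ℝ}
    (hfc : ContinuousOn f (Ico 0 1)) (hfnn : ∀ r ∈ Ico (0 : ℝ) 1, 0 ≤ f r)
    (hw : ContDiffOn ℝ 2 w (Icc 0 1)) (hw1 : w 1 = 0)
    (hd : ∀ r ∈ Icc (0 : ℝ) 1, 0 ≤ derivWithin w (Icc 0 1) r) :
    ballIntegral N k f w = volume (Metric.ball (0 : EuclideanSpace ℝ (Fin N)) 1) *
      logFunctional k (critScale N k) (muN N k) (fun s => f (exp (-s / N)))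
        (prim (logProfile N k w)) := by
  have hN0 : 0 < N := by omega
  have hb := critScale_pos hk hN
  have hq := conjExp_pos k
  have hwc : ContinuousOn w (Ioo 0 1) := hw.continuousOn.mono Ioo_subset_Icc_self
  have hfc' : ContinuousOn f (Ioo 0 1) := hfc.mono Ioo_subset_Ico_self
  have hc : ContinuousOn (fun r => exp (muN N k * |w r| ^ (((N : ℝ) + 2) / N + f r)))
      (Ioo 0 1) := by
    refine continuous_exp.comp_continuousOn (continuousOn_const.mul
      (hwc.abs.rpow (continuousOn_const.add hfc') fun r hr => Or.inr ?_))
    have := hfnn r (Ioo_subset_Ico_self hr)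
    rw [critical_exponent_eq hk hN]; linarith
  unfold ballIntegral
  rw [lintegral_ball_eq_log hN0 hc]
  unfold logFunctional
  congr 1
  refine setLIntegral_congr_fun measurableSet_Ioi fun s hs => ?_
  have hs0 : 0 ≤ s := le_of_lt hs
  have hpr := prim_logProfile hk hN hw hw1 hs0
  have hpn : 0 ≤ prim (logProfile N k w) s :=
    intervalIntegral.integral_nonneg hs0 fun t _ => logProfile_nonneg hk hN hd t
  have hwa : |w (exp (-s / N))| = critScale N k * prim (logProfile N k w) s := by
    rw [hpr] at hpn ⊢
    rw [mul_div_cancel₀ _ hb.ne']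
    have : 0 ≤ -w (exp (-s / N)) := by
      by_contra hcon
      exact absurd hpn (not_le.2 (div_neg_of_neg_of_pos (not_le.1 hcon) hb))
    rw [abs_of_nonpos (by linarith)]
  simp only [phase]
  rw [hwa, critical_exponent_eq hk hN, ← exp_add]
  congr 2; ring

lemma profile_logProfile (hk : 0 < k) (hN : N = 2 * k) (hw : ContDiffOn ℝ 2 w (Icc 0 1))
    (hd : ∀ r ∈ Icc (0 : ℝ) 1, 0 ≤ derivWithin w (Icc 0 1) r)
    (he : ∫ s in Ioi (0 : ℝ), logProfile N k w s ^ (k + 1) = 1) :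
    Profile k (logProfile N k w) where
  meas := (continuous_logProfile hw).measurable
  nonneg := logProfile_nonneg hk hN hd
  integrable := integrableOn_logProfile_pow (by omega) hw k
  energy_le := he.le

lemma normPhi_eq_one_iff (hk : 0 < k) (hN : N = 2 * k) (hw : ContDiffOn ℝ 2 w (Icc 0 1))
    (hd : ∀ r ∈ Icc (0 : ℝ) 1, 0 ≤ derivWithin w (Icc 0 1) r) :
    normPhi N k w = 1 ↔ ∫ s in Ioi (0 : ℝ), logProfile N k w s ^ (k + 1) = 1 := by
  have h0 : 0 ≤ ∫ s in Ioi (0 : ℝ), logProfile N k w s ^ (k + 1) :=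
    integral_nonneg fun s => pow_nonneg (logProfile_nonneg hk hN hd s) _
  unfold normPhi
  rw [← integral_logProfile_pow hk hN hw hd]
  have hk1 : (1 / (k + 1 : ℝ)) ≠ 0 := by positivity
  simpa using rpow_left_inj h0 zero_le_one hk1

end LogProfile

/-- Antiderivative representation: a positive continuous weight `h` yields a `k`-admissible
radial function whose derivative is given by the integrated weight. -/
lemma exists_radial_of_density {N k : ℕ} (hk : 0 < k) (hN : N = 2 * k) {h : ℝ → ℝ}
    (hh : Continuous h) (hpos : ∀ r ∈ Ico (0 : ℝ) 1, 0 < h r) {A : ℝ} (hA : 0 ≤ A) :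
    ∃ w, KAdmRad N k w ∧ ∀ r ∈ Ioc (0 : ℝ) 1, r * derivWithin w (Icc 0 1) r =
      A * (∫ ρ in (0 : ℝ)..r, h ρ * ρ ^ (N - 1)) ^ (1 / (k : ℝ)) := by
  have hk' : (0 : ℝ) < k := by exact_mod_cast hk
  have hN0 : 0 < N := by omega
  have hN' : (0 : ℝ) < N := by exact_mod_cast hN0
  set m : ℝ → ℝ := fun r => ∫ x in (0 : ℝ)..1, h (r * x) * x ^ (N - 1) with hm
  have hmc : Continuous m := by
    rw [hm]
    exact intervalIntegral.continuous_parametric_intervalIntegral_of_continuous'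
      (by fun_prop) 0 1
  have hmpos : ∀ r ∈ Icc (0 : ℝ) 1, 0 < m r := fun r hr => by
    refine intervalIntegral.intervalIntegral_pos_of_pos_on
      (Continuous.intervalIntegrable (by fun_prop) _ _) (fun x hx => ?_) one_pos
    refine mul_pos (hpos _ ⟨mul_nonneg hr.1 hx.1.le, ?_⟩) (pow_pos hx.1 _)
    nlinarith [hr.1, hr.2, hx.1, hx.2]
  set M : ℝ → ℝ := fun r => ∫ ρ in (0 : ℝ)..r, h ρ * ρ ^ (N - 1) with hM
  have hMm : ∀ r, 0 < r → M r = r ^ N * m r := fun r hr => by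
    have h1 := intervalIntegral.integral_comp_mul_left
      (fun ρ => h ρ * ρ ^ (N - 1)) hr.ne' (a := 0) (b := 1)
    simp only [mul_zero, mul_one, smul_eq_mul] at h1
    have h2 : ∫ x in (0 : ℝ)..1, h (r * x) * (r * x) ^ (N - 1) = r ^ (N - 1) * m r := by
      rw [hm, ← intervalIntegral.integral_const_mul]
      congr 1; ext x; rw [mul_pow]; ring
    rw [h2] at h1
    have h3 : r ^ N = r * r ^ (N - 1) := by rw [← pow_succ', Nat.sub_add_cancel hN0]
    rw [h3, mul_assoc, h1, mul_inv_cancel_left₀ hr.ne']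
  have hMd : ∀ r, HasDerivAt M (h r * r ^ (N - 1)) r := fun r =>
    intervalIntegral.integral_hasDerivAt_right
      (Continuous.intervalIntegrable (by fun_prop) _ _)
      (Continuous.stronglyMeasurableAtFilter (by fun_prop) _ _)
      (Continuous.continuousAt (by fun_prop))
  set z : ℝ → ℝ := fun r => A * (r * m r ^ (1 / (k : ℝ))) with hz
  set Z : ℝ → ℝ := fun r => A * (m r ^ (1 / (k : ℝ)) +
    1 / k * m r ^ (1 / (k : ℝ) - 1) * (h r - N * m r)) with hZ
  have hmd : ∀ r, 0 < r → HasDerivAt m ((h r - N * m r) / r) r := fun r hr => by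
    have h1 : HasDerivAt (fun r => M r / r ^ N) ((h r - N * m r) / r) r := by
      refine ((hMd r).div (hasDerivAt_pow N r) (pow_pos hr N).ne').congr_deriv ?_
      rw [hMm r hr]
      have h3 : r ^ N = r * r ^ (N - 1) := by rw [← pow_succ', Nat.sub_add_cancel hN0]
      have : r ^ (N - 1) ≠ 0 := (pow_pos hr _).ne'
      rw [h3]
      field_simp
    refine h1.congr_of_eventuallyEq ?_
    filter_upwards [eventually_gt_nhds hr] with x hx
    rw [hMm x hx, mul_div_cancel_left₀ _ (pow_pos hx N).ne']
  have hzd : ∀ r ∈ Ioo (0 : ℝ) 1, HasDerivAt z (Z r) r := fun r hr => by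
    have hmr := hmpos r (Ioo_subset_Icc_self hr)
    have h1 := ((hasDerivAt_id r).mul ((hmd r hr.1).rpow_const (p := 1 / (k : ℝ))
      (Or.inl hmr.ne'))).const_mul A
    refine h1.congr_deriv ?_
    have := hr.1.ne'
    simp only [hZ, id]
    field_simp
  have hzc : ContinuousOn z (Icc 0 1) :=
    continuousOn_const.mul (continuousOn_id.mul (hmc.continuousOn.rpow_const
      fun r hr => Or.inl (hmpos r hr).ne'))
  have hZc : ContinuousOn Z (Icc 0 1) := by
    refine continuousOn_const.mul ((hmc.continuousOn.rpow_const
      fun r hr => Or.inl (hmpos r hr).ne').add ((continuousOn_const.mul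
        (hmc.continuousOn.rpow_const fun r hr => Or.inl (hmpos r hr).ne')).mul ?_))
    exact (hh.sub (continuous_const.mul hmc)).continuousOn
  set Y : ℝ → ℝ := IccExtend zero_le_one (domRestrict (Icc 0 1) Z) with hY
  have hYc : Continuous Y := (continuousOn_iff_continuous_domRestrict.1 hZc).Icc_extend'
  have hYZ : ∀ r ∈ Icc (0 : ℝ) 1, Y r = Z r := fun r hr => by
    rw [hY, IccExtend_of_mem _ _ hr, domRestrict_apply]
  set y : ℝ → ℝ := fun r => ∫ ρ in (0 : ℝ)..r, Y ρ with hy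
  have hyd : ∀ r, HasDerivAt y (Y r) r := fun r =>
    intervalIntegral.integral_hasDerivAt_right (hYc.intervalIntegrable _ _)
      (hYc.stronglyMeasurableAtFilter _ _) hYc.continuousAt
  have hyz : ∀ r ∈ Icc (0 : ℝ) 1, y r = z r := fun r hr => by
    have h1 := intervalIntegral.integral_eq_sub_of_hasDerivAt_of_le hr.1
      (hzc.mono (Icc_subset_Icc_right hr.2)) (f' := Y) (fun x hx => by
        have hx' : x ∈ Ioo (0 : ℝ) 1 := ⟨hx.1, hx.2.trans_le hr.2⟩
        rw [hYZ x (Ioo_subset_Icc_self hx')]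
        exact hzd x hx') (hYc.intervalIntegrable _ _)
    rw [hy]; simp only
    rw [h1]; simp [hz]
  have hyc : Continuous y := continuous_iff_continuousAt.2 fun r => (hyd r).continuousAt
  set w : ℝ → ℝ := fun r => ∫ ρ in (1 : ℝ)..r, y ρ with hw
  have hwd : ∀ r, HasDerivAt w (y r) r := fun r =>
    intervalIntegral.integral_hasDerivAt_right (hyc.intervalIntegrable _ _)
      (hyc.stronglyMeasurableAtFilter _ _) hyc.continuousAt
  have hdw : deriv w = y := funext fun r => (hwd r).deriv
  have hdy : deriv y = Y := funext fun r => (hyd r).deriv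
  have hw2 : ContDiff ℝ 2 w := by
    rw [show (2 : WithTop ℕ∞) = 1 + 1 by norm_num, contDiff_succ_iff_deriv, hdw]
    refine ⟨fun r => (hwd r).differentiableAt, by simp, ?_⟩
    rw [contDiff_one_iff_deriv, hdy]
    exact ⟨fun r => (hyd r).differentiableAt, hYc⟩
  have hrz : ∀ r ∈ Ioc (0 : ℝ) 1, r * y r = A * M r ^ (1 / (k : ℝ)) := fun r hr => by
    have hr0 := hr.1
    have hr' := Ioc_subset_Icc_self hr
    have h1 : (r ^ N) ^ (1 / (k : ℝ)) = r * r := by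
      rw [hN, pow_mul, one_div, pow_rpow_inv_natCast (by positivity) hk.ne', sq]
    rw [hyz r hr', hMm r hr0, mul_rpow (by positivity) (hmpos r hr').le, h1]
    ring
  have hM0 : ∀ r ∈ Ioc (0 : ℝ) 1, 0 ≤ M r := fun r hr => by
    rw [hMm r hr.1]
    exact mul_nonneg (pow_nonneg hr.1.le _) (hmpos r (Ioc_subset_Icc_self hr)).le
  refine ⟨w, ⟨hw2.contDiffOn, by simp [hw], fun j hj1 hjk => ?_⟩, fun r hr => ?_⟩
  · intro r hr t ht hrt
    have hr1 := Ioo_subset_Ioc_self hr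
    have ht1 := Ioo_subset_Ioc_self ht
    have hMmono : M r ≤ M t := by
      have h1 := intervalIntegral.integral_add_adjacent_intervals (μ := volume)
        (f := fun ρ => h ρ * ρ ^ (N - 1)) (a := 0) (b := r) (c := t)
        (Continuous.intervalIntegrable (by fun_prop) _ _)
        (Continuous.intervalIntegrable (by fun_prop) _ _)
      have h2 : 0 ≤ ∫ ρ in r..t, h ρ * ρ ^ (N - 1) :=
        intervalIntegral.integral_nonneg hrt fun x hx => by
          have hx0 : 0 < x := hr.1.trans_le hx.1
          exact mul_nonneg (hpos x ⟨hx0.le, hx.2.trans_lt ht.2⟩).le (pow_nonneg hx0.le _)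
      simp only [hM]
      linarith
    have hsplit : ∀ x, x ^ (N - j) * y x ^ j = x ^ (N - 2 * j) * (x * y x) ^ j := fun x => by
      rw [mul_pow, ← mul_assoc, ← pow_add]
      congr 2; omega
    simp only [hdw]
    rw [hsplit, hsplit, hrz r hr1, hrz t ht1]
    have h1 : 0 ≤ M r ^ (1 / (k : ℝ)) := rpow_nonneg (hM0 r hr1) _
    have h2 : M r ^ (1 / (k : ℝ)) ≤ M t ^ (1 / (k : ℝ)) :=
      rpow_le_rpow (hM0 r hr1) hMmono (by positivity)
    have h3 := hr.1.le
    gcongr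
    exact pow_nonneg (h3.trans hrt) _
  · rw [(hwd r).differentiableAt.derivWithin
      (uniqueDiffOn_Icc one_pos r (Ioc_subset_Icc_self hr)), hdw, hrz r hr]

section Regularity

variable {k : ℕ} {b μ : ℝ} {φ v : ℝ → ℝ}

lemma Profile.prim_pos (hv : Profile k v) (hvc : Continuous v) (hv0 : 0 < v 0) {s : ℝ}
    (hs : 0 < s) : 0 < prim v s := by
  obtain ⟨δ, hδ, hδv⟩ := Metric.eventually_nhds_iff.1
    (continuousAt_const.eventually_lt hvc.continuousAt hv0 : ∀ᶠ x in nhds (0 : ℝ), 0 < v x)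
  have hm : 0 < min s (δ / 2) := by positivity
  refine lt_of_lt_of_le ?_ (hv.prim_mono hm.le (min_le_left s (δ / 2)))
  refine intervalIntegral.intervalIntegral_pos_of_pos_on (hvc.intervalIntegrable _ _)
    (fun x hx => hδv ?_) hm
  rw [Real.dist_eq, sub_zero, abs_of_pos hx.1]
  have := hx.2.trans_le (min_le_right _ _)
  linarith

/-- The density without its exponential decay factor, which is regular in the variable `r`. -/
lemma exists_continuous_density (hk : 0 < k) (W : Weight k b μ φ) (hv : Profile k v)
    (hvc : Continuous v) (hvi : IntegrableOn v (Ioi 0)) (hv0 : 0 < v 0) {N : ℕ} (hN : 0 < N) :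
    ∃ h : ℝ → ℝ, Continuous h ∧ (∀ r ∈ Ico (0 : ℝ) 1, 0 < h r) ∧
      ∀ s, 0 < s → density k b μ φ (prim v) s = exp (-s) * h (exp (-s / N)) := by
  have hk' : (0 : ℝ) < k := by exact_mod_cast hk
  have hN' : (0 : ℝ) < N := by exact_mod_cast hN
  have hb := W.b_pos
  have hμ := W.mu_pos
  have hq := conjExp_pos k
  have hpos : ∀ s, 0 < s → 0 < prim v s := fun s hs => hv.prim_pos hvc hv0 hs
  have hT : TestInput k (prim v) := hv.testInput hk hvi ⟨1, one_pos, hpos 1 one_pos⟩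
  set D : ℝ → ℝ := fun s => dphase k b μ φ s (prim v s) * exp (phase k b μ φ s (prim v s)) with hD
  have hDc : ContinuousOn D (Ioi 0) := (W.continuousOn_dphase hk hT.cont).mul
    (continuous_exp.comp_continuousOn (W.continuousOn_phase hT.cont))
  have hDpos : ∀ s, 0 < s → 0 < D s := fun s hs =>
    mul_pos (W.dphase_pos hs (hpos s hs)) (exp_pos _)
  obtain ⟨ℓ, hℓ, hDtop⟩ : ∃ ℓ, 0 < ℓ ∧ Tendsto D atTop (nhds ℓ) := by
    set P := ∫ x in Ioi (0 : ℝ), v x with hP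
    have hprim : Tendsto (prim v) atTop (nhds P) :=
      intervalIntegral_tendsto_integral_Ioi 0 hvi tendsto_id
    have hP0 : 0 < P := (hpos 1 one_pos).trans_le (ge_of_tendsto hprim (by
      filter_upwards [eventually_ge_atTop 1] with s hs using hv.prim_mono zero_le_one hs))
    have hbP : 0 < b * P := by positivity
    have h1 : Tendsto (fun s => dphase k b μ φ s (prim v s)) atTop
        (nhds (μ * b * ((conjExp k + 0) * (b * P) ^ (1 / (k : ℝ) + 0)))) :=
      ((W.lim.const_add _).mul ((hprim.const_mul b).rpow (W.lim.const_add _)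
        (Or.inl hbP.ne'))).const_mul _
    have h2 : Tendsto (fun s => phase k b μ φ s (prim v s)) atTop
        (nhds (μ * (b * P) ^ (conjExp k + 0))) :=
      ((hprim.const_mul b).rpow (W.lim.const_add _) (Or.inl hbP.ne')).const_mul _
    exact ⟨_, by positivity, h1.mul ((continuous_exp.tendsto _).comp h2)⟩
  have hD0 : Tendsto D (nhdsWithin 0 (Ioi 0)) (nhds 0) := by
    obtain ⟨C, hC, hph⟩ := W.exists_phase_bound
    have hprim : Tendsto (prim v) (nhdsWithin 0 (Ioi 0)) (nhds 0) := by
      have hpc : Continuous (prim v) := intervalIntegral.continuous_primitive (μ := volume)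
        (fun a c => hvc.intervalIntegrable a c) 0
      have h := hpc.tendsto 0
      rw [show prim v 0 = 0 from intervalIntegral.integral_same] at h
      exact h.mono_left nhdsWithin_le_nhds
    have hbprim : Tendsto (fun s => b * prim v s) (nhdsWithin 0 (Ioi 0)) (nhds 0) := by
      simpa using hprim.const_mul b
    have hup : Tendsto (fun s => μ * b * ((conjExp k + 1) * (b * prim v s) ^ (1 / (k : ℝ))) *
        exp (s + C)) (nhdsWithin 0 (Ioi 0)) (nhds 0) := by
      have h1 : Tendsto (fun s => (b * prim v s) ^ (1 / (k : ℝ))) (nhdsWithin 0 (Ioi 0))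
          (nhds 0) := by
        have := (continuous_rpow_const (q := 1 / (k : ℝ)) (by positivity)).tendsto 0
        rw [zero_rpow (by positivity)] at this
        exact this.comp hbprim
      have h2 : Tendsto (fun s : ℝ => exp (s + C)) (nhdsWithin 0 (Ioi 0)) (nhds (exp (0 + C))) :=
        ((by fun_prop : Continuous fun s : ℝ => exp (s + C)).tendsto 0).mono_left
          nhdsWithin_le_nhds
      simpa using ((h1.const_mul (conjExp k + 1)).const_mul (μ * b)).mul h2
    refine tendsto_of_tendsto_of_tendsto_of_le_of_le' tendsto_const_nhds hup ?_ ?_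
    · filter_upwards [self_mem_nhdsWithin] with s hs using (hDpos s hs).le
    · filter_upwards [self_mem_nhdsWithin, hbprim.eventually_lt_const (exp_pos (-1))] with s hs hs1
      have hp0 := (hpos s hs).le
      have h1 := W.dphase_le_of_small hs hp0 hs1.le
      have h2 := hph s hs _ hp0 (hT.rpow_le s hs)
      have h3 : exp (phase k b μ φ s (prim v s)) ≤ exp (s + C) :=
        exp_le_exp.2 (h2.trans (by linarith [hT.rpow_le s hs]))
      exact mul_le_mul h1 h3 (exp_pos _).le
        ((W.dphase_nonneg hs hp0).trans h1)
  set H : ℝ → ℝ := fun r => D (-(N * log r)) with hH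
  have hlogpos : ∀ r ∈ Ioo (0 : ℝ) 1, -(N * log r) ∈ Ioi (0 : ℝ) := fun r hr => by
    have := log_neg hr.1 hr.2
    rw [mem_Ioi]; nlinarith
  have hHc : ContinuousOn H (Ioo 0 1) := by
    refine hDc.comp ?_ hlogpos
    exact (continuousOn_const.mul (continuousOn_log.mono fun r hr => hr.1.ne')).neg
  have hH0 : Tendsto H (nhdsWithin 0 (Ioi 0)) (nhds ℓ) := by
    refine hDtop.comp ?_
    exact tendsto_neg_atBot_atTop.comp (tendsto_log_nhdsGT_zero.const_mul_atBot hN')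
  have hH1 : Tendsto H (nhdsWithin 1 (Iio 1)) (nhds 0) := by
    refine hD0.comp (tendsto_nhdsWithin_iff.2 ⟨?_, ?_⟩)
    · have : ContinuousAt (fun r => -(N * log r)) 1 :=
        (continuousAt_const.mul (continuousAt_log one_ne_zero)).neg
      have h := this.tendsto
      simp only [log_one, mul_zero, neg_zero] at h
      exact h.mono_left nhdsWithin_le_nhds
    · filter_upwards [Ioo_mem_nhdsLT (zero_lt_one (α := ℝ))] with r hr using hlogpos r hr
  set E := extendFrom (Ioo (0 : ℝ) 1) H with hE
  have hEc : ContinuousOn E (Icc 0 1) := continuousOn_Icc_extendFrom_Ioo hHc hH0 hH1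
  have hEH : ∀ r ∈ Ioo (0 : ℝ) 1, E r = H r := extendFrom_extends hHc
  have hE0 : E 0 = ℓ := eq_lim_at_left_extendFrom_Ioo one_pos hH0
  have hext : ∀ r ∈ Icc (0 : ℝ) 1, IccExtend zero_le_one (domRestrict (Icc 0 1) E) r = E r :=
    fun r hr => by rw [IccExtend_of_mem _ _ hr, domRestrict_apply]
  refine ⟨IccExtend zero_le_one (domRestrict (Icc 0 1) E),
    (continuousOn_iff_continuous_domRestrict.1 hEc).Icc_extend', fun r hr => ?_, fun s hs => ?_⟩
  · rw [hext r (Ico_subset_Icc_self hr)]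
    rcases hr.1.eq_or_lt with h0 | h0
    · rw [← h0, hE0]; exact hℓ
    · rw [hEH r ⟨h0, hr.2⟩]; exact hDpos _ (hlogpos r ⟨h0, hr.2⟩)
  · have hm := exp_neg_div_mem_Ioo hN hs
    rw [hext _ (Ioo_subset_Icc_self hm), hEH _ hm]
    have : -(N * log (exp (-s / N))) = s := by rw [log_exp]; field_simp
    simp only [hH, this, hD, density]
    rw [sub_eq_add_neg, exp_add]; ring

end Regularity

lemma integral_Ioi_density_eq {N : ℕ} (hN : 0 < N) {h g : ℝ → ℝ}
    (hg : ∀ s, 0 < s → g s = exp (-s) * h (exp (-s / N))) {x : ℝ} (hx : 0 ≤ x) :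
    ∫ s in Ioi x, g s = N * ∫ ρ in (0 : ℝ)..exp (-x / N), h ρ * ρ ^ (N - 1) := by
  have hN' : (0 : ℝ) < N := by exact_mod_cast hN
  have himg : (fun s : ℝ => exp (-s / N)) '' Ioi x = Ioo 0 (exp (-x / N)) := by
    ext r
    constructor
    · rintro ⟨s, hs, rfl⟩
      refine ⟨exp_pos _, exp_lt_exp.2 ?_⟩
      have : x < s := hs
      gcongr
    · rintro ⟨h0, h1⟩
      refine ⟨-(N * log r), ?_, ?_⟩
      · have h2 := log_lt_log h0 h1
        rw [log_exp, lt_div_iff₀ hN'] at h2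
        rw [mem_Ioi]; linarith
      · simp only [neg_neg]
        rw [mul_div_cancel_left₀ _ hN'.ne', exp_log h0]
  rw [intervalIntegral.integral_of_le (exp_pos _).le, integral_Ioc_eq_integral_Ioo, ← himg,
    integral_image_eq_integral_abs_deriv_smul measurableSet_Ioi
    (fun s _ => (hasDerivAt_exp_neg_div N s).hasDerivWithinAt) (injOn_exp_neg_div hN _),
    ← integral_const_mul]
  refine setIntegral_congr_fun measurableSet_Ioi fun s hs => ?_
  have hs0 : 0 < s := lt_of_le_of_lt hx hs
  simp only [smul_eq_mul]
  rw [hg s hs0, abs_neg, abs_of_nonneg (by positivity)]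
  have : exp (-s) = exp (-s / N) * exp (-s / N) ^ (N - 1) := by
    rw [← pow_succ', Nat.sub_add_cancel hN, ← exp_nat_mul]
    congr 1; field_simp
  rw [this]
  field_simp

/-- Improved profiles come from `k`-admissible radial functions. -/
theorem exists_radial_of_improved {N k : ℕ} (hk : 0 < k) (hN : N = 2 * k) {μ : ℝ}
    {φ v u : ℝ → ℝ} (W : Weight k (critScale N k) μ φ) (hv : Profile k v) (hvc : Continuous v)
    (hvi : IntegrableOn v (Ioi 0)) (hv0 : 0 < v 0) {c : ℝ} (hc : 0 < c)
    (hu : ∀ x, 0 ≤ x → u x =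
      (c * ∫ s in Ioi x, density k (critScale N k) μ φ (prim v) s) ^ (1 / (k : ℝ))) :
    ∃ w, KAdmRad N k w ∧ ∀ s, 0 ≤ s → logProfile N k w s = u s := by
  have hN0 : 0 < N := by omega
  have hN' : (0 : ℝ) < N := by exact_mod_cast hN0
  have hb := critScale_pos hk hN
  obtain ⟨h, hhc, hpos, hdens⟩ := exists_continuous_density hk W hv hvc hvi hv0 hN0
  set A := critScale N k * N * (c * N) ^ (1 / (k : ℝ)) with hA
  have hA0 : 0 ≤ A := by positivity
  obtain ⟨w, hw, hwd⟩ := exists_radial_of_density hk hN hhc hpos hA0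
  refine ⟨w, hw, fun s hs => ?_⟩
  have hmem : exp (-s / N) ∈ Icc (0 : ℝ) 1 := by
    simpa [abs_of_nonneg hs] using exp_neg_abs_div_mem N s
  have hI : 0 ≤ ∫ ρ in (0 : ℝ)..exp (-s / N), h ρ * ρ ^ (N - 1) := by
    rw [intervalIntegral.integral_of_le (exp_pos _).le, integral_Ioc_eq_integral_Ioo]
    exact setIntegral_nonneg measurableSet_Ioo fun ρ hρ =>
      mul_nonneg (hpos ρ ⟨hρ.1.le, hρ.2.trans_le hmem.2⟩).le (pow_nonneg hρ.1.le _)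
  rw [hu s hs, integral_Ioi_density_eq hN0 hdens hs]
  simp only [logProfile]
  rw [abs_of_nonneg hs, hwd _ ⟨exp_pos _, hmem.2⟩, ← mul_assoc c,
    mul_rpow (by positivity) hI, hA]
  field_simp

/-- Every input curve is dominated by a normalised `k`-admissible radial function. -/
theorem exists_radial_ge {N k : ℕ} (hk : 0 < k) (hN : N = 2 * k) {f : ℝ → ℝ}
    (hfc : ContinuousOn f (Ico 0 1)) (hfnn : ∀ r ∈ Ico (0 : ℝ) 1, 0 ≤ f r)
    (W : Weight k (critScale N k) (muN N k) fun s => f (exp (-s / N)))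
    {Φ : ℝ → ℝ} (hΦ : TestInput k Φ) :
    ∃ w, (KAdmRad N k w ∧ normPhi N k w = 1) ∧
      volume (Metric.ball (0 : EuclideanSpace ℝ (Fin N)) 1) *
        logFunctional k (critScale N k) (muN N k) (fun s => f (exp (-s / N))) Φ ≤
          ballIntegral N k f w := by
  obtain ⟨v, -, -, hv, hvc, hvi, -, hΦv, hv0, -⟩ := exists_improved_profile hk W hΦ
  have hT : TestInput k (prim v) := hv.testInput hk hvi ⟨1, one_pos, hv.prim_pos hvc hv0 one_pos⟩
  obtain ⟨u, c, hc, -, -, -, hu1, hvu, -, hu⟩ := exists_improved_profile hk W hT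
  obtain ⟨w, hw, hwu⟩ := exists_radial_of_improved hk hN W hv hvc hvi hv0 hc hu
  have hd := hw.derivWithin_nonneg hk hN
  refine ⟨w, ⟨hw, (normPhi_eq_one_iff hk hN hw.smooth hd).2 ?_⟩, ?_⟩
  · rw [← hu1]
    exact setIntegral_congr_fun measurableSet_Ioi fun s hs => by simp only [hwu s (le_of_lt hs)]
  · rw [ballIntegral_eq_logFunctional hk hN hfc hfnn hw.smooth hw.bdry hd]
    refine mul_le_mul_right (hΦv.trans (hvu.trans_eq ?_)) _
    refine setLIntegral_congr_fun measurableSet_Ioi fun s hs => ?_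
    have : prim (logProfile N k w) s = prim u s :=
      intervalIntegral.integral_congr fun x hx => hwu x (by
        rw [uIcc_of_le (le_of_lt hs)] at hx; exact hx.1)
    simp only [this]

theorem stmt1 (N k : ℕ) (hk : 0 < k) (hN : N = 2 * k)
    (f : ℝ → ℝ) (hfc : ContinuousOn f (Ico 0 1)) (hf0 : f 0 = 0)
    (hfpos : ∀ r ∈ Ioo (0:ℝ) 1, 0 < f r) (hfnn : ∀ r ∈ Ico (0:ℝ) 1, 0 ≤ f r)
    (hσ : ∃ σ : ℝ, 2 < σ ∧ IsBoundedUnder (· ≤ ·) (nhdsWithin (0:ℝ) (Ioi 0))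
      (fun r => f r * |log r| ^ σ))
    :
    ∃ w : ℝ → ℝ, KAdmRad N k w ∧ normPhi N k w = 1 ∧
      ballIntegral N k f w =
        ⨆ w' : {u : ℝ → ℝ // KAdmRad N k u ∧ normPhi N k u = 1},
          ballIntegral N k f w'.1 := by
  have W := weight_of_decay hk hN hfc hf0 hfnn hσ
  set J := logFunctional k (critScale N k) (muN N k) (fun s => f (exp (-s / N)))
  set A := {u : ℝ → ℝ // KAdmRad N k u ∧ normPhi N k u = 1}
  set c₀ := volume (Metric.ball (0 : EuclideanSpace ℝ (Fin N)) 1)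
  have hc₀ : c₀ ≠ 0 := (Metric.measure_ball_pos _ _ one_pos).ne'
  have hc₀' : c₀ ≠ ⊤ := measure_ball_lt_top.ne
  have hball : ∀ w : A, ballIntegral N k f w.1 = c₀ * J (prim (logProfile N k w.1)) := fun w =>
    ballIntegral_eq_logFunctional hk hN hfc hfnn w.2.1.smooth w.2.1.bdry
      (w.2.1.derivWithin_nonneg hk hN)
  set M := ⨆ w : A, J (prim (logProfile N k w.1))
  have hsup : ⨆ w : A, ballIntegral N k f w.1 = c₀ * M := by
    simp only [hball, M, ENNReal.mul_iSup]
  obtain ⟨v, hv, hvi, hpos, hlevel⟩ := exists_profile_gt_level hk W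
  obtain ⟨w₀, hw₀, hw₀J⟩ := exists_radial_ge hk hN hfc hfnn W (hv.testInput hk hvi hpos)
  have : Nonempty A := ⟨⟨w₀, hw₀⟩⟩
  have hM : ENNReal.ofReal (1 + exp (harm k)) < M := by
    rw [hball ⟨w₀, hw₀⟩] at hw₀J
    exact hlevel.trans_le (((ENNReal.mul_le_mul_iff_right hc₀ hc₀').1 hw₀J).trans
      (le_iSup (fun w : A => J (prim (logProfile N k w.1))) ⟨w₀, hw₀⟩))
  obtain ⟨y, -, hylim, hy⟩ := exists_seq_tendsto_sSup
    (range_nonempty fun w : A => J (prim (logProfile N k w.1))) (OrderTop.bddAbove _)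
  choose w hwy using hy
  have hlim : Tendsto (fun n => J (prim (logProfile N k (w n).1))) atTop (nhds M) := by
    simp only [hwy]
    exact hylim
  obtain ⟨Φ, hΦ, hΦM⟩ := exists_limit_curve hk W hM
    (fun n => profile_logProfile hk hN (w n).2.1.smooth ((w n).2.1.derivWithin_nonneg hk hN)
      ((normPhi_eq_one_iff hk hN (w n).2.1.smooth
        ((w n).2.1.derivWithin_nonneg hk hN)).1 (w n).2.2))
    (fun n => continuous_logProfile (w n).2.1.smooth)
    (fun n => by simpa using integrableOn_logProfile_pow (k := k) (by omega) (w n).2.1.smooth 0)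
    hlim
  obtain ⟨z, hz, hzJ⟩ := exists_radial_ge hk hN hfc hfnn W hΦ
  refine ⟨z, hz.1, hz.2, le_antisymm (le_iSup (fun w : A => ballIntegral N k f w.1) ⟨z, hz⟩) ?_⟩
  rw [hsup, ← hΦM]
  exact hzJ
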